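/- Let Σ be a finite type with decidable equality and I an irreflexive symmetric relation on Σ, and let π : List (Σ ⊕ Σ) → G(Σ,I) be the evaluation homomorphism of the graph group. Then the following are equivalent: (i) for every regular language L ⊆ List (Σ ⊕ Σ), the predicate on words w ↦ (π w ∈ π '' L) is computable (ComputablePred); (ii) (Σ,I) is a transitive forest. (Decidability of the rational subset membership problem for graph groups.) -/

import Mathlib

/-- The relators of the graph group: commutators of independent generators. -/
def GraphGroupRels {S : Type} (I : S → S → Prop) : Set (FreeGroup S) :=
  { r | ∃ a b : S, I a b ∧
      r = FreeGroup.of a * FreeGroup.of b * (FreeGroup.of a)⁻¹ * (FreeGroup.of b)⁻¹ }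

/-- The graph group of an independence alphabet. -/
abbrev GraphGroup {S : Type} (I : S → S → Prop) : Type :=
  PresentedGroup (GraphGroupRels I)

/-- Evaluation homomorphism from the free monoid on `S ⊕ S` to the graph group,
sending `inl a` to the generator `a` and `inr a` to its inverse. -/
noncomputable def graphEval {S : Type} (I : S → S → Prop) :
    FreeMonoid (S ⊕ S) →* GraphGroup I :=
  FreeMonoid.lift (Sum.elim
    (fun a => (PresentedGroup.of (rels := GraphGroupRels I) a))
    (fun a => (PresentedGroup.of (rels := GraphGroupRels I) a)⁻¹))

/-- `(S, I)` is a transitive forest: there is a strict partial order whose strict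
down-sets are linearly ordered, realizing `I` as the comparability relation. -/
def IsTransitiveForest {S : Type} (I : S → S → Prop) : Prop :=
  ∃ r : S → S → Prop, IsStrictOrder S r ∧
    (∀ a b c : S, r b a → r c a → (r b c ∨ b = c ∨ r c b)) ∧
    (∀ a b : S, I a b ↔ (a ≠ b ∧ (r a b ∨ r b a)))

/-- Any finite type with decidable equality is primcodable. -/
noncomputable instance (priority := 50) fintypePrimcodable {α : Type} [Fintype α] [DecidableEq α] :
    Primcodable α :=
  Primcodable.ofEquiv (Fin (Fintype.card α)) (Fintype.equivFin α)

section Semilinear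

open Pointwise

variable {M N : Type*} [AddCommMonoid M] [AddCommMonoid N]

theorem IsSemilinearSet.prod {s : Set M} {t : Set N} (hs : IsSemilinearSet s)
    (ht : IsSemilinearSet t) : IsSemilinearSet (s ×ˢ t) := by
  convert (hs.image (AddMonoidHom.inl M N)).add (ht.image (AddMonoidHom.inr M N)) using 1
  ext ⟨a, b⟩
  simp [Set.mem_add]

theorem IsSemilinearSet.nsmul_graph {s : Set M} (hs : IsSemilinearSet s) :
    IsSemilinearSet {x : M × ℕ | x.1 ∈ x.2 • s} := by
  convert ((hs.image (AddMonoidHom.inl M ℕ)).vadd ((0 : M), 1)).closure using 1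
  ext ⟨a, n⟩
  simp only [Set.mem_ofPred_eq, SetLike.mem_coe]
  constructor
  · intro h
    induction n generalizing a with
    | zero =>
      have h : a = 0 := by simpa using h
      subst h
      exact zero_mem _
    | succ n ih =>
      rw [succ_nsmul] at h
      obtain ⟨b, hb, c, hc, rfl⟩ := Set.mem_add.1 h
      have := add_mem (ih b hb) (AddSubmonoid.subset_closure
        (s := ((0 : M), 1) +ᵥ (AddMonoidHom.inl M ℕ) '' s)
        (Set.vadd_mem_vadd_set (Set.mem_image_of_mem _ hc)))
      simpa using this
  · intro h
    suffices ∀ x ∈ AddSubmonoid.closure (((0 : M), 1) +ᵥ (AddMonoidHom.inl M ℕ) '' s),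
        x.1 ∈ x.2 • s from this _ h
    intro x hx
    induction hx using AddSubmonoid.closure_induction with
    | mem x hx =>
      obtain ⟨_, ⟨y, hy, rfl⟩, rfl⟩ := Set.mem_vadd_set.1 hx
      simpa using hy
    | zero => simp
    | add x y _ _ hx hy =>
      simp only [Prod.fst_add, Prod.snd_add, add_nsmul]
      exact Set.add_mem_add hx hy

end Semilinear

section CommutativeGrammar

open Pointwise

variable {V M : Type*} [AddCommMonoid M]

theorem Set.nsmul_mono {s t : Set M} (h : s ⊆ t) (n : ℕ) : n • s ⊆ n • t := by
  induction n with
  | zero => simp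
  | succ n ih =>
    rw [succ_nsmul, succ_nsmul]
    exact Set.add_subset_add ih h

theorem Set.sum_mono {ι : Type*} (u : Finset ι) {s t : ι → Set M} (h : ∀ i, s i ⊆ t i) :
    ∑ i ∈ u, s i ⊆ ∑ i ∈ u, t i := by
  classical
  induction u using Finset.induction_on with
  | empty => simp
  | insert a u ha ih =>
    rw [Finset.sum_insert ha, Finset.sum_insert ha]
    exact Set.add_subset_add (h a) ih

theorem exists_small_of_mem_nsmul {S : Set ((V → ℕ) × M)} (y : V) (t n : ℕ) {x : (V → ℕ) × M}
    (hx : x ∈ (n + 1) • S) (h : x.1 y < (n + 1) * (t + 1)) :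
    ∃ a ∈ S, a.1 y ≤ t ∧ ∃ b ∈ n • S, x = a + b := by
  induction n generalizing x with
  | zero =>
    refine ⟨x, by simpa using hx, by omega, 0, by simp, by simp⟩
  | succ n ih =>
    rw [succ_nsmul] at hx
    obtain ⟨c, hc, a, ha, rfl⟩ := Set.mem_add.1 hx
    by_cases hat : a.1 y ≤ t
    · exact ⟨a, ha, hat, c, hc, add_comm _ _⟩
    · obtain ⟨a', ha', hat', b, hb, rfl⟩ := ih hc (by
        simp only [Prod.fst_add, Pi.add_apply] at h
        nlinarith)
      refine ⟨a', ha', hat', b + a, ?_, add_assoc _ _ _⟩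
      rw [succ_nsmul]
      exact Set.add_mem_add hb ha

section

variable [DecidableEq V]

/-- Forgetting the coordinate `y`. -/
def eraseCoord (y : V) : (V → ℕ) →+ (V → ℕ) where
  toFun k := Function.update k y 0
  map_zero' := by
    ext z
    by_cases hz : z = y <;> simp [hz]
  map_add' k l := by
    ext z
    by_cases hz : z = y
    · subst hz; simp
    · simp [hz]

theorem eraseCoord_self (y : V) (k : V → ℕ) : eraseCoord y k y = 0 := by
  simp [eraseCoord]

theorem eraseCoord_of_ne {y z : V} (h : z ≠ y) (k : V → ℕ) : eraseCoord y k z = k z := by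
  simp [eraseCoord, h]

theorem eraseCoord_add_single (y : V) (k : V → ℕ) : eraseCoord y k + Pi.single y (k y) = k := by
  ext z
  by_cases hz : z = y
  · subst hz; simp [eraseCoord]
  · simp [eraseCoord, hz]

/-- What can be produced from the variable `y` by rewriting only `y`, and until it has gone. -/
def solveVar (S : Set ((V → ℕ) × M)) (y : V) : Set ((V → ℕ) × M) :=
  {x | ∃ k n, (k, x.2) ∈ n • S ∧ k y + 1 = n ∧ x.1 = eraseCoord y k}

/-- Productions with the variable `y` eliminated. -/
def eliminateVar (T : V → Set ((V → ℕ) × M)) (y X : V) : Set ((V → ℕ) × M) :=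
  {x | ∃ z ∈ T X, ∃ w ∈ z.1 y • solveVar (T y) y, x = (eraseCoord y z.1 + w.1, z.2 + w.2)}

theorem exists_nsmul_of_mem_nsmul_solveVar {S : Set ((V → ℕ) × M)} {y : V} (j : ℕ)
    {x : (V → ℕ) × M} (hx : x ∈ j • solveVar S y) :
    ∃ k n, (k, x.2) ∈ n • S ∧ k y + j = n ∧ x.1 = eraseCoord y k := by
  induction j generalizing x with
  | zero =>
    have : x = 0 := by simpa using hx
    subst this
    exact ⟨0, 0, by simp, by simp, by simp⟩
  | succ j ih =>
    rw [succ_nsmul] at hx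
    obtain ⟨a, ha, b, ⟨k, n, hb, hn, hk⟩, rfl⟩ := Set.mem_add.1 hx
    obtain ⟨k', n', ha, hn', hk'⟩ := ih ha
    refine ⟨k' + k, n' + n, ?_, ?_, ?_⟩
    · rw [add_nsmul]
      exact Set.add_mem_add ha hb
    · simp only [Pi.add_apply]; omega
    · simp [hk, hk']

theorem eliminateVar_subset_solveVar (T : V → Set ((V → ℕ) × M)) (y : V) :
    eliminateVar T y y ⊆ solveVar (T y) y := by
  rintro _ ⟨z, hz, w, hw, rfl⟩
  obtain ⟨k, n, hk, hn, hw1⟩ := exists_nsmul_of_mem_nsmul_solveVar _ hw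
  refine ⟨k + z.1, n + 1, ?_, ?_, ?_⟩
  · rw [succ_nsmul, add_comm z.2]
    exact Set.add_mem_add hk hz
  · simp only [Pi.add_apply]; omega
  · simp [hw1, add_comm]

end

variable [Fintype V]

/-- The sums of `k y` elements of `D y`, over all variables `y`. -/
def substSums (D : V → Set M) (k : V → ℕ) : Set M :=
  ∑ y, k y • D y

/-- The family `D` is closed under the productions `T`: an element `(k, m)` of `T X` stands for the
production rewriting the variable `X` to `m` together with `k y` copies of each variable `y`. -/
def ClosedUnder (T : V → Set ((V → ℕ) × M)) (D : V → Set M) : Prop :=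
  ∀ X, ∀ x ∈ T X, {x.2} + substSums D x.1 ⊆ D X

/-- The commutative language generated by the productions `T`. -/
def generated (T : V → Set ((V → ℕ) × M)) (X : V) : Set M :=
  {m | ∀ D, ClosedUnder T D → m ∈ D X}

theorem substSums_add (D : V → Set M) (k l : V → ℕ) :
    substSums D (k + l) = substSums D k + substSums D l := by
  simp [substSums, add_nsmul, Finset.sum_add_distrib]

theorem substSums_zero (D : V → Set M) : substSums D 0 = 0 := by
  simp [substSums]

theorem substSums_mono {D E : V → Set M} (h : ∀ y, D y ⊆ E y) (k : V → ℕ) :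
    substSums D k ⊆ substSums E k :=
  Set.sum_mono _ fun y => Set.nsmul_mono (h y) _

theorem generated_subset {T : V → Set ((V → ℕ) × M)} {D : V → Set M} (h : ClosedUnder T D) (X : V) :
    generated T X ⊆ D X :=
  fun _ hm => hm D h

theorem closedUnder_generated (T : V → Set ((V → ℕ) × M)) : ClosedUnder T (generated T) := by
  intro X x hx m hm D hD
  exact hD X x hx (Set.add_subset_add_left (substSums_mono (generated_subset hD) _) hm)

theorem exists_of_mem_generated {T : V → Set ((V → ℕ) × M)} {X : V} {m : M}
    (h : m ∈ generated T X) : ∃ x ∈ T X, m ∈ {x.2} + substSums (generated T) x.1 := by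
  refine h (fun X => {m | ∃ x ∈ T X, m ∈ {x.2} + substSums (generated T) x.1}) ?_
  intro X x hx m hm
  refine ⟨x, hx, Set.add_subset_add_left (substSums_mono ?_ _) hm⟩
  rintro Y m ⟨z, hz, hm⟩
  exact closedUnder_generated T Y z hz hm

theorem mem_nsmul_of_forall {S : Set ((V → ℕ) × M)} {D : V → Set M} {E : Set M}
    (h : ∀ x ∈ S, {x.2} + substSums D x.1 ⊆ E) (n : ℕ) {x : (V → ℕ) × M} (hx : x ∈ n • S) :
    {x.2} + substSums D x.1 ⊆ n • E := by
  induction n generalizing x with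
  | zero =>
    have : x = 0 := by simpa using hx
    subst this
    simp [substSums_zero]
  | succ n ih =>
    rw [succ_nsmul] at hx ⊢
    obtain ⟨a, ha, b, hb, rfl⟩ := Set.mem_add.1 hx
    refine subset_trans (subset_of_eq ?_) (Set.add_subset_add (ih ha) (h b hb))
    simp only [Prod.snd_add, Prod.fst_add, substSums_add]
    rw [← Set.singleton_add_singleton]
    abel

theorem exists_of_mem_nsmul {S : Set ((V → ℕ) × M)} {D : V → Set M} {E : Set M}
    (h : ∀ m ∈ E, ∃ x ∈ S, m ∈ {x.2} + substSums D x.1) (n : ℕ) {m : M} (hm : m ∈ n • E) :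
    ∃ x ∈ n • S, m ∈ {x.2} + substSums D x.1 := by
  induction n generalizing m with
  | zero =>
    have : m = 0 := by simpa using hm
    subst this
    exact ⟨0, by simp, by simp [substSums_zero]⟩
  | succ n ih =>
    rw [succ_nsmul] at hm
    obtain ⟨a, ha, b, hb, rfl⟩ := Set.mem_add.1 hm
    obtain ⟨x, hx, hax⟩ := ih ha
    obtain ⟨z, hz, hbz⟩ := h b hb
    refine ⟨x + z, ?_, ?_⟩
    · rw [succ_nsmul]
      exact Set.add_mem_add hx hz
    · have := Set.add_mem_add hax hbz
      convert this using 1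
      simp only [Prod.snd_add, Prod.fst_add, substSums_add]
      rw [← Set.singleton_add_singleton]
      abel

variable [DecidableEq V]

theorem substSums_single (D : V → Set M) (y : V) (n : ℕ) :
    substSums D (Pi.single y n) = n • D y := by
  rw [substSums, Finset.sum_eq_single y]
  · simp
  · intro z _ hz
    simp [hz]
  · simp

theorem ClosedUnder.nsmul_subset {T : V → Set ((V → ℕ) × M)} {D : V → Set M}
    (h : ClosedUnder T D) (y : V) (n t : ℕ) {x : (V → ℕ) × M} (hx : x ∈ n • T y)
    (hn : x.1 y + 1 = n + t) :
    {x.2} + substSums D (eraseCoord y x.1) + t • D y ⊆ D y := by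
  induction n generalizing t x with
  | zero =>
    have : x = 0 := by simpa using hx
    subst this
    have : t = 1 := by simp at hn; omega
    subst this
    simp [substSums_zero]
  | succ n ih =>
    obtain ⟨a, ha, hat, b, hb, rfl⟩ := exists_small_of_mem_nsmul y t n hx (by nlinarith)
    obtain ⟨s, rfl⟩ := Nat.exists_eq_add_of_le hat
    have key := ih (s + 1) hb (by
      simp only [Prod.fst_add, Pi.add_apply] at hn
      omega)
    have h1 := h y a ha
    rw [← eraseCoord_add_single y a.1, substSums_add, substSums_single] at h1
    refine subset_trans ?_ key
    simp only [Prod.snd_add, Prod.fst_add, map_add, substSums_add, add_nsmul, one_nsmul]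
    rw [← Set.singleton_add_singleton]
    have h2 := Set.add_subset_add_left (s := {b.2} + substSums D (eraseCoord y b.1) + s • D y) h1
    refine subset_trans (subset_of_eq ?_) (h2.trans (subset_of_eq ?_)) <;> abel

theorem ClosedUnder.solveVar_subset {T : V → Set ((V → ℕ) × M)} {D : V → Set M}
    (h : ClosedUnder T D) (y : V) {x : (V → ℕ) × M} (hx : x ∈ solveVar (T y) y) :
    {x.2} + substSums D x.1 ⊆ D y := by
  obtain ⟨k, n, hk, hn, hx1⟩ := hx
  have := h.nsmul_subset y n 0 hk (by simpa using hn)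
  simpa [hx1] using this

theorem generated_eliminateVar (T : V → Set ((V → ℕ) × M)) (y : V) :
    generated (eliminateVar T y) = generated T := by
  funext X
  apply Set.Subset.antisymm
  · refine generated_subset ?_ X
    rintro X _ ⟨z, hz, w, hw, rfl⟩
    have h1 := mem_nsmul_of_forall (D := generated T) (E := generated T y)
      (fun x hx => (closedUnder_generated T).solveVar_subset y hx) _ hw
    refine subset_trans ?_ (closedUnder_generated T X z hz)
    have h2 := Set.add_subset_add_left
      (s := {z.2} + substSums (generated T) (eraseCoord y z.1)) h1
    conv_rhs => rw [← eraseCoord_add_single y z.1, substSums_add, substSums_single]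
    refine subset_trans (subset_of_eq ?_) (h2.trans (subset_of_eq ?_))
    · simp only [substSums_add]
      rw [← Set.singleton_add_singleton]
      abel
    · abel
  · refine generated_subset ?_ X
    intro X z hz m hm
    rw [← eraseCoord_add_single y z.1, substSums_add, substSums_single, ← add_assoc] at hm
    obtain ⟨a, ha, b, hb, rfl⟩ := Set.mem_add.1 hm
    obtain ⟨w, hw, hbw⟩ := exists_of_mem_nsmul (D := generated (eliminateVar T y))
      (S := solveVar (T y) y) (fun m hm => by
        obtain ⟨x, hx, hm⟩ := exists_of_mem_generated hm
        exact ⟨x, eliminateVar_subset_solveVar T y hx, hm⟩) _ hb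
    refine closedUnder_generated (eliminateVar T y) X
      (eraseCoord y z.1 + w.1, z.2 + w.2) ⟨z, hz, w, hw, rfl⟩ ?_
    convert Set.add_mem_add ha hbw using 1
    simp only [substSums_add]
    rw [← Set.singleton_add_singleton]
    abel

variable [AddMonoid.FG M]

theorem IsSemilinearSet.solveVar {S : Set ((V → ℕ) × M)} (hS : IsSemilinearSet S) (y : V) :
    IsSemilinearSet (solveVar S y) := by
  have h := (hS.nsmul_graph.inter (isSemilinearSet_setOfPred_eq (M := ((V → ℕ) × M) × ℕ) (N := ℕ)
    1 0 ((Pi.evalAddMonoidHom (fun _ => ℕ) y).comp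
      ((AddMonoidHom.fst (V → ℕ) M).comp (AddMonoidHom.fst _ ℕ)))
    (AddMonoidHom.snd _ ℕ))).image
      (((eraseCoord y).prodMap (AddMonoidHom.id M)).comp (AddMonoidHom.fst _ ℕ))
  convert h using 1
  ext ⟨k, m⟩
  constructor
  · rintro ⟨k', n, h1, h2, h3⟩
    refine ⟨((k', m), n), ⟨h1, ?_⟩, ?_⟩
    · simp [← h2, add_comm]
    · simp_all
  · rintro ⟨⟨⟨k', m'⟩, n⟩, ⟨h1, h2⟩, h3⟩
    simp only [Set.mem_ofPred_eq, AddMonoidHom.coe_comp, AddMonoidHom.coe_fst, Function.comp_apply,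
      Pi.evalAddMonoidHom_apply, AddMonoidHom.coe_snd, AddMonoidHom.prodMap_def,
      AddMonoidHom.prod_apply, AddMonoidHom.id_apply, Prod.mk.injEq] at h1 h2 h3
    obtain ⟨rfl, rfl⟩ := h3
    exact ⟨k', n, h1, by omega, rfl⟩

theorem IsSemilinearSet.eliminateVar {T : V → Set ((V → ℕ) × M)}
    (hT : ∀ X, IsSemilinearSet (T X)) (y X : V) : IsSemilinearSet (eliminateVar T y X) := by
  have h := (((hT X).prod (((hT y).solveVar y).nsmul_graph)).inter
    (isSemilinearSet_setOfPred_eq (M := ((V → ℕ) × M) × (((V → ℕ) × M) × ℕ)) (N := ℕ)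
    0 0 ((Pi.evalAddMonoidHom (fun _ => ℕ) y).comp
      ((AddMonoidHom.fst (V → ℕ) M).comp (AddMonoidHom.fst _ (((V → ℕ) × M) × ℕ))))
    ((AddMonoidHom.snd ((V → ℕ) × M) ℕ).comp (AddMonoidHom.snd ((V → ℕ) × M)
      (((V → ℕ) × M) × ℕ))))).image
    (((eraseCoord y).prodMap (AddMonoidHom.id M)).comp
        (AddMonoidHom.fst ((V → ℕ) × M) (((V → ℕ) × M) × ℕ)) +
      (AddMonoidHom.fst ((V → ℕ) × M) ℕ).comp
        (AddMonoidHom.snd ((V → ℕ) × M) (((V → ℕ) × M) × ℕ)))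
  convert h using 1
  ext x
  constructor
  · rintro ⟨z, hz, w, hw, rfl⟩
    exact ⟨(z, (w, z.1 y)), ⟨⟨hz, hw⟩, by simp⟩, by simp [Prod.ext_iff]⟩
  · rintro ⟨⟨z, ⟨w, n⟩⟩, ⟨⟨hz, hw⟩, hn⟩, rfl⟩
    have hn' : z.1 y = n := by simpa using hn
    refine ⟨z, hz, w, hn' ▸ hw, by simp [Prod.ext_iff]⟩

/-- Commutative context-free languages over a semilinear set of productions are semilinear. -/
theorem isSemilinearSet_generated {T : V → Set ((V → ℕ) × M)} (hT : ∀ X, IsSemilinearSet (T X))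
    (X : V) : IsSemilinearSet (generated T X) := by
  suffices H : ∀ (U : Finset V) (T : V → Set ((V → ℕ) × M)), (∀ X, IsSemilinearSet (T X)) →
      (∀ X, ∀ x ∈ T X, ∀ z ∉ U, x.1 z = 0) → IsSemilinearSet (generated T X) from
    H Finset.univ T hT (by simp)
  intro U
  induction U using Finset.induction_on with
  | empty =>
    intro T hT h
    convert (hT X).image (AddMonoidHom.snd (V → ℕ) M) using 1
    have h0 : ∀ X, ∀ x ∈ T X, x.1 = 0 := fun X x hx => funext fun z => h X x hx z (by simp)
    ext m
    constructor
    · intro hm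
      obtain ⟨x, hx, hm⟩ := exists_of_mem_generated hm
      refine ⟨x, hx, ?_⟩
      simpa [h0 X x hx, substSums_zero, eq_comm] using hm
    · rintro ⟨x, hx, rfl⟩
      refine closedUnder_generated T X x hx ?_
      simp [h0 X x hx, substSums_zero]
  | insert y U hy ih =>
    intro T hT h
    rw [← generated_eliminateVar T y]
    refine ih _ (IsSemilinearSet.eliminateVar hT y) ?_
    rintro X _ ⟨z, hz, w, hw, rfl⟩ v hv
    obtain ⟨k, n, hk, -, hw1⟩ := exists_nsmul_of_mem_nsmul_solveVar _ hw
    simp only [Pi.add_apply, hw1]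
    by_cases hvy : v = y
    · subst hvy; simp [eraseCoord_self]
    · have hvU : v ∉ insert y U := by simp [hvy, hv]
      rw [eraseCoord_of_ne hvy, eraseCoord_of_ne hvy, h X z hz v hvU, zero_add]
      clear hw1 hw
      have : ∀ n : ℕ, ∀ x ∈ n • T y, x.1 v = 0 := by
        intro n
        induction n with
        | zero => simp +contextual
        | succ n ih =>
          intro x hx
          rw [succ_nsmul] at hx
          obtain ⟨a, ha, b, hb, rfl⟩ := Set.mem_add.1 hx
          simp [ih a ha, h y b hb v hvU]
      exact this n _ hk

end CommutativeGrammar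

section LinearCover

open Pointwise

variable {ι κ J : Type*} [Fintype ι] [Fintype κ]

/-- Every point of `s` lies in a linear subset of `s` with periods from `P₀` and with a base point
of size at most `C * (n + 1)`. -/
def IsCovered (C : ℕ) (P₀ : Finset (ι → ℕ)) (n : ℕ) (s : Set (ι → ℕ)) : Prop :=
  ∀ v ∈ s, ∃ b : ι → ℕ, ∃ P : Finset (ι → ℕ), P ⊆ P₀ ∧ ∑ i, b i ≤ C * (n + 1) ∧
    v ∈ b +ᵥ (AddSubmonoid.closure (P : Set (ι → ℕ)) : Set (ι → ℕ)) ∧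
    b +ᵥ (AddSubmonoid.closure (P : Set (ι → ℕ)) : Set (ι → ℕ)) ⊆ s

/-- A family of sets of vectors, all of whose members are unions of linear sets with periods from
a common finite set and with bases of size linear in `ℓ`. -/
def LinearlyCovered (ℓ : J → ℕ) (F : J → Set (ι → ℕ)) : Prop :=
  ∃ C P₀, ∀ j, IsCovered C P₀ (ℓ j) (F j)

theorem IsCovered.mono {C C' : ℕ} {P₀ P₀' : Finset (ι → ℕ)} {n n' : ℕ} {s : Set (ι → ℕ)}
    (h : IsCovered C P₀ n s) (hC : C ≤ C') (hP : P₀ ⊆ P₀') (hn : n ≤ n') :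
    IsCovered C' P₀' n' s := by
  intro v hv
  obtain ⟨b, P, hPP, hb, h⟩ := h v hv
  exact ⟨b, P, hPP.trans hP, hb.trans (Nat.mul_le_mul hC (by omega)), h⟩

theorem IsCovered.isSemilinearSet {C : ℕ} {P₀ : Finset (ι → ℕ)} {n : ℕ} {s : Set (ι → ℕ)}
    (h : IsCovered C P₀ n s) : IsSemilinearSet s := by
  classical
  have hfin : {b : ι → ℕ | ∑ i, b i ≤ C * (n + 1)}.Finite :=
    (Set.finite_Icc 0 (fun _ : ι => C * (n + 1))).subset fun b hb => ⟨zero_le, fun i =>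
      (Finset.single_le_sum (fun _ _ => Nat.zero_le _) (Finset.mem_univ i)).trans hb⟩
  have hfin2 := (hfin.prod P₀.powerset.finite_toSet).image
    (fun x : (ι → ℕ) × Finset (ι → ℕ) =>
      x.1 +ᵥ (AddSubmonoid.closure (x.2 : Set (ι → ℕ)) : Set (ι → ℕ)))
  refine ⟨_, hfin2.subset (Set.sep_subset _ (fun t => t ⊆ s)), ?_, ?_⟩
  · rintro _ ⟨⟨⟨b, P⟩, _, rfl⟩, _⟩
    exact ⟨b, P, P.finite_toSet, rfl⟩
  · ext v
    constructor
    · intro hv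
      obtain ⟨b, P, hPP, hb, hv, hs⟩ := h v hv
      exact ⟨_, ⟨⟨(b, P), ⟨hb, by simpa using hPP⟩, rfl⟩, hs⟩, hv⟩
    · rintro ⟨t, ⟨_, ht⟩, hv⟩
      exact ht hv

theorem LinearlyCovered.comp {J' : Type*} {ℓ : J → ℕ} {F : J → Set (ι → ℕ)}
    (h : LinearlyCovered ℓ F) (f : J' → J) : LinearlyCovered (ℓ ∘ f) (F ∘ f) := by
  obtain ⟨C, P₀, h⟩ := h
  exact ⟨C, P₀, fun j => h (f j)⟩

theorem exists_isCovered_of_finite {I : Type*} [Finite I] {J : I → Type*} {ℓ : ∀ i, J i → ℕ}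
    {F : ∀ i, J i → Set (ι → ℕ)} (h : ∀ i, LinearlyCovered (ℓ i) (F i)) :
    ∃ C P₀, ∀ i j, IsCovered C P₀ (ℓ i j) (F i j) := by
  classical
  have := Fintype.ofFinite I
  choose C P h using h
  exact ⟨∑ i, C i, Finset.univ.biUnion P, fun i j => (h i j).mono
    (Finset.single_le_sum (fun _ _ => Nat.zero_le _) (Finset.mem_univ i))
    (Finset.subset_biUnion_of_mem P (Finset.mem_univ i)) le_rfl⟩

theorem IsCovered.iUnion {I : Type*} {C : ℕ} {P₀ : Finset (ι → ℕ)} {n : ℕ}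
    {F : I → Set (ι → ℕ)} (h : ∀ i, IsCovered C P₀ n (F i)) : IsCovered C P₀ n (⋃ i, F i) := by
  intro v hv
  obtain ⟨i, hv⟩ := Set.mem_iUnion.1 hv
  obtain ⟨b, P, hP, hb, hv, hs⟩ := h i v hv
  exact ⟨b, P, hP, hb, hv, hs.trans (Set.subset_iUnion F i)⟩

theorem IsCovered.add {C C' C'' : ℕ} {P₀ : Finset (ι → ℕ)} {n n' n'' : ℕ}
    {s t : Set (ι → ℕ)} (hs : IsCovered C P₀ n s) (ht : IsCovered C' P₀ n' t)
    (h : C * (n + 1) + C' * (n' + 1) ≤ C'' * (n'' + 1)) : IsCovered C'' P₀ n'' (s + t) := by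
  classical
  rintro _ ⟨v, hv, w, hw, rfl⟩
  obtain ⟨b, P, hP, hb, hv, hs⟩ := hs v hv
  obtain ⟨b', P', hP', hb', hw, ht⟩ := ht w hw
  have key : (b + b') +ᵥ (AddSubmonoid.closure ((P ∪ P' : Finset (ι → ℕ)) : Set (ι → ℕ)) :
      Set (ι → ℕ)) = (b +ᵥ (AddSubmonoid.closure (P : Set (ι → ℕ)) : Set (ι → ℕ))) +
        (b' +ᵥ (AddSubmonoid.closure (P' : Set (ι → ℕ)) : Set (ι → ℕ))) := by
    rw [Finset.coe_union, AddSubmonoid.closure_union]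
    ext v
    simp only [Set.mem_vadd_set, Set.mem_add, SetLike.mem_coe, AddSubmonoid.mem_sup]
    constructor
    · rintro ⟨_, ⟨x, hx, y, hy, rfl⟩, rfl⟩
      exact ⟨_, ⟨x, hx, rfl⟩, _, ⟨y, hy, rfl⟩, (add_add_add_comm b b' x y).symm⟩
    · rintro ⟨_, ⟨x, hx, rfl⟩, _, ⟨y, hy, rfl⟩, rfl⟩
      exact ⟨_, ⟨x, hx, y, hy, rfl⟩, add_add_add_comm b b' x y⟩
  refine ⟨b + b', P ∪ P', Finset.union_subset hP hP', ?_, ?_, ?_⟩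
  · simp only [Pi.add_apply, Finset.sum_add_distrib]
    omega
  · rw [key]; exact Set.add_mem_add hv hw
  · rw [key]; exact Set.add_subset_add hs ht

theorem LinearlyCovered.iUnion {I : Type*} [Finite I] {ℓ : J → ℕ}
    {F : I → J → Set (ι → ℕ)} (h : ∀ i, LinearlyCovered ℓ (F i)) :
    LinearlyCovered ℓ (fun j => ⋃ i, F i j) := by
  obtain ⟨C, P₀, h⟩ := exists_isCovered_of_finite h
  refine ⟨C, P₀, fun j v hv => ?_⟩
  obtain ⟨i, hv⟩ := Set.mem_iUnion.1 hv
  obtain ⟨b, P, hP, hb, hv, hs⟩ := h i j v hv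
  exact ⟨b, P, hP, hb, hv, hs.trans (Set.subset_iUnion (fun i => F i j) i)⟩

theorem linearlyCovered_of_isLinearSet {A : Type*} [AddCommMonoid A] (σ : A →+ ℕ)
    (hσ : ∀ a, σ a = 0 → a = 0) {T : Set (A × (κ → ℕ))} (hT : IsLinearSet T) :
    LinearlyCovered σ (fun a => {v | (a, v) ∈ T}) := by
  classical
  obtain ⟨x₀, t, rfl⟩ := isLinearSet_iff.1 hT
  let P₀ : Finset (κ → ℕ) := (t.filter (fun q => q.1 = 0)).image Prod.snd
  let K := ∑ q ∈ t, ∑ i, q.2 i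
  have hP : ∀ p ∈ AddSubmonoid.closure (P₀ : Set (κ → ℕ)),
      ((0 : A), p) ∈ AddSubmonoid.closure (t : Set (A × (κ → ℕ))) := by
    have : AddSubmonoid.closure (P₀ : Set (κ → ℕ)) ≤
        (AddSubmonoid.closure (t : Set (A × (κ → ℕ)))).comap (AddMonoidHom.inr A (κ → ℕ)) := by
      rw [AddSubmonoid.closure_le]
      intro p hp
      obtain ⟨q, hq, rfl⟩ := Finset.mem_image.1 (Finset.mem_coe.1 hp)
      obtain ⟨hq, hq0⟩ := Finset.mem_filter.1 hq
      have := AddSubmonoid.subset_closure (s := (t : Set (A × (κ → ℕ)))) hq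
      rwa [← Prod.mk.eta (p := q), hq0] at this
    exact fun p hp => this hp
  have hx : ∀ x ∈ AddSubmonoid.closure (t : Set (A × (κ → ℕ))),
      ∃ y ∈ AddSubmonoid.closure (t : Set (A × (κ → ℕ))),
      ∃ p ∈ AddSubmonoid.closure (P₀ : Set (κ → ℕ)), x = y + (0, p) ∧ ∑ i, y.2 i ≤ K * σ y.1 := by
    intro x hx
    induction hx using AddSubmonoid.closure_induction with
    | mem x hx =>
      by_cases hx0 : x.1 = 0
      · refine ⟨0, zero_mem _, x.2, AddSubmonoid.subset_closure ?_, ?_, by simp⟩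
        · exact Finset.mem_coe.2 (Finset.mem_image_of_mem _ (Finset.mem_filter.2 ⟨hx, hx0⟩))
        · ext1 <;> simp [hx0]
      · refine ⟨x, AddSubmonoid.subset_closure hx, 0, zero_mem _, by ext1 <;> simp, ?_⟩
        have h1 : 1 ≤ σ x.1 := Nat.one_le_iff_ne_zero.2 fun h => hx0 (hσ _ h)
        calc ∑ i, x.2 i ≤ K := Finset.single_le_sum (f := fun q : A × (κ → ℕ) => ∑ i, q.2 i)
              (fun _ _ => Nat.zero_le _) (Finset.mem_coe.1 hx)
          _ ≤ K * σ x.1 := Nat.le_mul_of_pos_right _ h1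
    | zero => exact ⟨0, zero_mem _, 0, zero_mem _, by simp; rfl, by simp⟩
    | add x x' _ _ ih ih' =>
      obtain ⟨y, hy, p, hp, rfl, h⟩ := ih
      obtain ⟨y', hy', p', hp', rfl, h'⟩ := ih'
      refine ⟨y + y', add_mem hy hy', p + p', add_mem hp hp', ?_, ?_⟩
      · ext1
        · simp
        · simp only [Prod.snd_add]; abel
      · simp only [Prod.snd_add, Prod.fst_add, Pi.add_apply, Finset.sum_add_distrib, map_add]
        linarith
  refine ⟨K + ∑ i, x₀.2 i, P₀, fun a v hv => ?_⟩
  obtain ⟨x, hxt, hxe⟩ := Set.mem_vadd_set.1 hv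
  obtain ⟨y, hy, p, hp, rfl, hyK⟩ := hx x hxt
  simp only [vadd_eq_add, Prod.ext_iff, Prod.fst_add, Prod.snd_add, add_zero] at hxe
  obtain ⟨rfl, rfl⟩ := hxe
  refine ⟨x₀.2 + y.2, P₀, subset_rfl, ?_, ?_, ?_⟩
  · simp only [Pi.add_apply, Finset.sum_add_distrib, map_add]
    calc ∑ i, x₀.2 i + ∑ i, y.2 i ≤ (∑ i, x₀.2 i) * (σ x₀.1 + σ y.1 + 1) +
          K * (σ x₀.1 + σ y.1 + 1) := add_le_add (Nat.le_mul_of_pos_right _ (by omega))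
            (hyK.trans (Nat.mul_le_mul_left _ (by omega)))
      _ = _ := by ring
  · rw [← add_assoc]
    exact Set.vadd_mem_vadd_set hp
  · intro v' hv'
    obtain ⟨p', hp', rfl⟩ := Set.mem_vadd_set.1 hv'
    refine Set.mem_vadd_set.2 ⟨y + (0, p'), add_mem hy (hP p' hp'), ?_⟩
    ext1
    · simp
    · simp [add_assoc]

theorem linearlyCovered_of_isSemilinearSet {A : Type*} [AddCommMonoid A] (σ : A →+ ℕ)
    (hσ : ∀ a, σ a = 0 → a = 0) {T : Set (A × (κ → ℕ))} (hT : IsSemilinearSet T) :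
    LinearlyCovered σ (fun a => {v | (a, v) ∈ T}) := by
  obtain ⟨S, hS, rfl⟩ := isSemilinearSet_iff.1 hT
  have := LinearlyCovered.iUnion (I := S) (ℓ := σ) (F := fun (i : S) (a : A) =>
      {v | (a, v) ∈ (i : Set (A × (κ → ℕ)))})
    fun i => linearlyCovered_of_isLinearSet σ hσ (hS i i.2)
  convert this using 2 with a
  ext v
  simp

/-- The total size of a vector, as a homomorphism. -/
def vecSize (ι : Type*) [Fintype ι] : (ι → ℕ) →+ ℕ where
  toFun v := ∑ i, v i
  map_zero' := by simp
  map_add' v w := by simp [Finset.sum_add_distrib]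

/-- Linearly covered families are preserved by semilinear correspondences with parameters of
linear size. -/
theorem LinearlyCovered.transfer {ℓ : J → ℕ} {F : J → Set (ι → ℕ)} (h : LinearlyCovered ℓ F)
    {R : Set (((ι → ℕ) × (ℕ × ℕ)) × (κ → ℕ))} (hR : IsSemilinearSet R) (c : ℕ) (e : J → ℕ × ℕ)
    (he : ∀ j, (e j).1 + (e j).2 ≤ c * (ℓ j + 1)) :
    LinearlyCovered ℓ (fun j => {v' | ∃ v ∈ F j, ((v, e j), v') ∈ R}) := by
  classical
  obtain ⟨C, P₀, h⟩ := h
  let σ : (ι → ℕ) × (ℕ × ℕ) →+ ℕ :=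
    (vecSize ι).comp (AddMonoidHom.fst _ _) +
      ((AddMonoidHom.fst ℕ ℕ) + (AddMonoidHom.snd ℕ ℕ)).comp (AddMonoidHom.snd (ι → ℕ) (ℕ × ℕ))
  have hσa : ∀ b n m, σ (b, n, m) = ∑ i, b i + (n + m) := fun b n m => rfl
  have hσ : ∀ a, σ a = 0 → a = 0 := by
    rintro ⟨b, n, m⟩ h
    rw [hσa] at h
    have h1 : ∑ i, b i = 0 := by omega
    have : b = 0 := funext fun i => Finset.sum_eq_zero_iff.1 h1 i (Finset.mem_univ i)
    subst this
    ext1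
    · rfl
    · ext1 <;> simp <;> omega
  let T : Finset (ι → ℕ) → Set (((ι → ℕ) × (ℕ × ℕ)) × (κ → ℕ)) := fun P =>
    {x | ∃ v ∈ x.1.1 +ᵥ (AddSubmonoid.closure (P : Set (ι → ℕ)) : Set (ι → ℕ)),
      ((v, x.1.2), x.2) ∈ R}
  have hT : ∀ P, IsSemilinearSet (T P) := by
    intro P
    let B := (ι → ℕ) × (ι → ℕ) × ((ℕ × ℕ) × (κ → ℕ))
    let f1 : B →+ (ι → ℕ) := (AddMonoidHom.fst _ _).comp (AddMonoidHom.snd _ _)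
    let f0 : B →+ (ι → ℕ) := AddMonoidHom.fst _ _
    let fe : B →+ (ℕ × ℕ) :=
      (AddMonoidHom.fst _ _).comp ((AddMonoidHom.snd _ _).comp (AddMonoidHom.snd _ _))
    let fv : B →+ (κ → ℕ) :=
      (AddMonoidHom.snd _ _).comp ((AddMonoidHom.snd _ _).comp (AddMonoidHom.snd _ _))
    have := (((IsSemilinearSet.closure_finset P).preimage f1).inter
      (hR.preimage (((f0 + f1).prod fe).prod fv))).image ((f0.prod fe).prod fv)
    convert this using 1
    ext ⟨⟨b, n⟩, v'⟩
    constructor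
    · rintro ⟨v, hv, hR⟩
      obtain ⟨x, hx, rfl⟩ := Set.mem_vadd_set.1 hv
      exact ⟨(b, x, n, v'), ⟨hx, hR⟩, rfl⟩
    · rintro ⟨⟨b, x, n, v'⟩, ⟨hx, hR⟩, h⟩
      cases h
      exact ⟨b + x, Set.vadd_mem_vadd_set hx, hR⟩
  obtain ⟨K, Q₀, hK⟩ := exists_isCovered_of_finite (I := P₀.powerset)
    (fun P => linearlyCovered_of_isSemilinearSet σ hσ (hT P))
  refine ⟨K * (C + c + 1), Q₀, ?_⟩
  rintro j v' ⟨v, hv, hR⟩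
  obtain ⟨b, P, hP, hb, hvb, hs⟩ := h j v hv
  obtain ⟨b', P', hP', hb', hv', hs'⟩ := hK ⟨P, Finset.mem_powerset.2 hP⟩ (b, e j) v' ⟨v, hvb, hR⟩
  refine ⟨b', P', hP', hb'.trans ?_, hv', fun u hu => ?_⟩
  · rw [mul_assoc]
    refine Nat.mul_le_mul_left _ ?_
    have : σ (b, e j) = ∑ i, b i + ((e j).1 + (e j).2) := rfl
    rw [this]
    have := he j
    nlinarith
  · obtain ⟨v, hv, hR⟩ := hs' hu
    exact ⟨v, hs hv, hR⟩

end LinearCover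

section Tame

open Pointwise

/-- `Run src tgt lab p g v q`: the automaton with edges `e : src e ⟶ tgt e` labelled by `lab e` has
a run from `p` to `q` that evaluates to `g` and uses each edge `e` exactly `v e` times. -/
inductive Run {G Q E : Type*} [Group G] [DecidableEq E] (src tgt : E → Q) (lab : E → G) :
    Q → G → (E → ℕ) → Q → Prop
  | nil (q : Q) : Run src tgt lab q 1 0 q
  | cons (e : E) {g : G} {v : E → ℕ} {q : Q} : Run src tgt lab (tgt e) g v q →
      Run src tgt lab (src e) (lab e * g) (Pi.single e 1 + v) q

theorem Run.append {G Q E : Type*} [Group G] [DecidableEq E] {src tgt : E → Q} {lab : E → G}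
    {p q r : Q} {g h : G} {v w : E → ℕ} (h₁ : Run src tgt lab p g v r)
    (h₂ : Run src tgt lab r h w q) : Run src tgt lab p (g * h) (v + w) q := by
  induction h₁ with
  | nil => simpa using h₂
  | cons e _ ih =>
    rw [mul_assoc, add_assoc]
    exact (ih h₂).cons e

theorem Run.map {G H Q E : Type*} [Group G] [Group H] [DecidableEq E] {src tgt : E → Q}
    {lab : E → G} {p q : Q} {g : G} {v : E → ℕ} (h : Run src tgt lab p g v q) (f : G →* H) :
    Run src tgt (f ∘ lab) p (f g) v q := by
  induction h with
  | nil => rw [map_one]; exact Run.nil _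
  | cons e _ ih => rw [map_mul]; exact ih.cons e

/-- A group is tame with respect to `S` if the Parikh images of the runs of a finite automaton over
`S` that evaluate to a given product of elements of `S` are linearly covered in the length of that
product. -/
def Tame (G : Type*) [Group G] (S : Set G) : Prop :=
  ∀ (Q E : Type) [Fintype Q] [DecidableEq Q] [Fintype E] [DecidableEq E] (src tgt : E → Q)
    (lab : E → G), (∀ e, lab e ∈ S) → ∀ p q,
    LinearlyCovered (J := List S) List.length
      (fun w => {v | Run src tgt lab p (w.map Subtype.val).prod v q})

theorem Tame.of_injective {G H : Type*} [Group G] [Group H] {S : Set G} {T : Set H}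
    (hT : Tame H T) (f : G →* H) (hf : Function.Injective f) (hS : ∀ x ∈ S, f x ∈ T) :
    Tame G S := by
  intro Q E _ _ _ _ src tgt lab hlab p q
  have := (hT Q E src tgt (f ∘ lab) (fun e => hS _ (hlab e)) p q).comp
    (fun w : List S => w.map fun x : S => (⟨f x, hS x x.2⟩ : T))
  convert this using 1
  · ext w; simp
  · funext w
    have hw : (List.map Subtype.val (w.map fun x : S => (⟨f x, hS x x.2⟩ : T))).prod =
        f (w.map Subtype.val).prod := by
      rw [map_list_prod]; simp [Function.comp_def]
    simp only [Function.comp_apply, hw]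
    ext v
    refine ⟨fun h => h.map f, fun h => ?_⟩
    change Run _ _ _ _ _ _ _ at h
    change Run _ _ _ _ _ _ _
    clear this hw
    generalize hg : f (w.map Subtype.val).prod = g at h
    generalize (w.map Subtype.val).prod = x at hg
    induction h generalizing x with
    | nil =>
      rw [← map_one f] at hg
      rw [hf hg]; exact Run.nil _
    | @cons e g v q _ ih =>
      have := (ih ((lab e)⁻¹ * x) (by simp [hg])).cons (lab := lab) e
      simpa using this

theorem Run.prod_iff {G Q E : Type*} [Group G] [Fintype E] [DecidableEq E] {src tgt : E → Q}
    {lab : E → G × Multiplicative ℤ} {p q : Q} {g : G × Multiplicative ℤ} {v : E → ℕ} :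
    Run src tgt lab p g v q ↔ Run src tgt (fun e => (lab e).1) p g.1 v q ∧
      g.2.toAdd = ∑ e, v e * (lab e).2.toAdd := by
  constructor
  · intro h
    refine ⟨h.map (MonoidHom.fst _ _), ?_⟩
    induction h with
    | nil => simp
    | cons e _ ih =>
      simp [ih, add_mul, Finset.sum_add_distrib, Pi.single_apply]
  · obtain ⟨g, z⟩ := g
    rintro ⟨h, hz⟩
    simp only at h hz
    induction h generalizing z with
    | nil =>
      have : z = 1 := by simpa using hz
      subst this
      exact Run.nil _
    | @cons e g v q _ ih =>
      have := (ih (Multiplicative.ofAdd (∑ e, v e * (lab e).2.toAdd)) rfl).cons (lab := lab) e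
      convert this using 1
      refine Prod.ext rfl ?_
      · apply Multiplicative.toAdd.injective
        simp [hz, add_mul, Finset.sum_add_distrib, Pi.single_apply, mul_comm]

theorem Tame.prod_int {G : Type*} [Group G] {S : Set G} (hS : Tame G S) :
    Tame (G × Multiplicative ℤ) {x | x.1 ∈ S ∧ |x.2.toAdd| ≤ 1} := by
  intro Q E _ _ _ _ src tgt lab hlab p q
  let T : Set (G × Multiplicative ℤ) := {x | x.1 ∈ S ∧ |x.2.toAdd| ≤ 1}
  have h := (hS Q E src tgt (fun e => (lab e).1) (fun e => (hlab e).1) p q).comp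
    (fun w : List T => w.map fun x => ⟨x.1.1, x.2.1⟩)
  have hℓ : (List.length ∘ fun w : List T => w.map fun x => (⟨x.1.1, x.2.1⟩ : S)) =
      List.length := by
    ext w; simp
  rw [hℓ] at h
  let z : List T → ℤ := fun w => (w.map Subtype.val).prod.2.toAdd
  have hz : ∀ w : List T, |z w| ≤ w.length := by
    intro w
    induction w with
    | nil => simp [z]
    | cons x w ih =>
      have h1 : z (x :: w) = x.1.2.toAdd + z w := by simp [z]
      have h2 := abs_add_le x.1.2.toAdd (z w)
      have h3 : |x.1.2.toAdd| ≤ 1 := x.2.2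
      rw [h1, List.length_cons]
      push_cast
      linarith
  let φ : (E → ℕ) →+ ℤ :=
    { toFun := fun v => ∑ e, v e * (lab e).2.toAdd
      map_zero' := by simp
      map_add' := fun v w => by simp [add_mul, Finset.sum_add_distrib] }
  let A := ((E → ℕ) × (ℕ × ℕ)) × (E → ℕ)
  let f1 : A →+ (E → ℕ) := (AddMonoidHom.fst _ _).comp (AddMonoidHom.fst _ _)
  let f2 : A →+ (E → ℕ) := AddMonoidHom.snd _ _
  let fs : A →+ ℤ := (Nat.castAddMonoidHom ℤ).comp
    ((AddMonoidHom.fst _ _).comp ((AddMonoidHom.snd _ _).comp (AddMonoidHom.fst _ _)))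
  let ft : A →+ ℤ := (Nat.castAddMonoidHom ℤ).comp
    ((AddMonoidHom.snd _ _).comp ((AddMonoidHom.snd _ _).comp (AddMonoidHom.fst _ _)))
  have hR := (isSemilinearSet_setOfPred_eq (M := A) 0 0 f1 f2).inter
    (isSemilinearSet_setOfPred_eq (M := A) 0 0 fs (φ.comp f1 + ft))
  have := h.transfer hR 1 (fun w => ((z w).toNat, (-z w).toNat)) (fun w => by
    have := hz w
    have := abs_le.1 this
    simp only
    omega)
  convert this using 1
  funext w
  ext v
  change Run _ _ _ _ _ _ _ ↔ _
  rw [Run.prod_iff]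
  have h1 : ((w.map Subtype.val).prod).1 =
      ((w.map fun x : T => (⟨x.1.1, x.2.1⟩ : S)).map Subtype.val).prod := by
    clear * -
    induction w with
    | nil => rfl
    | cons x w ih => exact congrArg (x.1.1 * ·) ih
  have h2 : ∀ u : E → ℕ, ((0 : ℤ) + fs ((u, (z w).toNat, (-z w).toNat), v) = 0 +
      (φ.comp f1 + ft) ((u, (z w).toNat, (-z w).toNat), v)) ↔
      z w = ∑ e, u e * (lab e).2.toAdd := by
    intro u
    change (0 : ℤ) + (((z w).toNat : ℕ) : ℤ) = 0 + (∑ e, u e * (lab e).2.toAdd +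
      (((-z w).toNat : ℕ) : ℤ)) ↔ _
    omega
  constructor
  · rintro ⟨ha, hb⟩
    exact ⟨v, by rw [h1] at ha; exact ha, rfl, (h2 v).2 hb⟩
  · rintro ⟨u, ha, hb, hc⟩
    have hb : (0 : E → ℕ) + u = 0 + v := hb
    rw [zero_add, zero_add] at hb
    subst hb
    exact ⟨by rw [h1]; exact ha, (h2 u).1 hc⟩

end Tame

section SubstGraph

open Pointwise

theorem isSemilinearSet_substSums_graph {V M : Type*} [AddCommMonoid M] [Fintype V] [DecidableEq V]
    [AddMonoid.FG M] {D : V → Set M} (hD : ∀ y, IsSemilinearSet (D y)) :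
    IsSemilinearSet {x : (V → ℕ) × M | x.2 ∈ substSums D x.1} := by
  have key : ∀ u : Finset V,
      IsSemilinearSet {x : (V → ℕ) × M | x.2 ∈ ∑ y ∈ u, x.1 y • D y} := by
    intro u
    induction u using Finset.induction_on with
    | empty =>
      convert (IsSemilinearSet.univ (M := V → ℕ)).prod (IsSemilinearSet.singleton (0 : M)) using 1
      ext ⟨k, m⟩
      simp
    | insert y u hy ih =>
      let A := M × ((V → ℕ) × M)
      let f : A →+ M × ℕ := (AddMonoidHom.fst _ _).prod ((Pi.evalAddMonoidHom (fun _ => ℕ) y).comp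
        ((AddMonoidHom.fst _ _).comp (AddMonoidHom.snd _ _)))
      let g : A →+ (V → ℕ) × M := ((AddMonoidHom.fst _ _).comp (AddMonoidHom.snd _ _)).prod
        (AddMonoidHom.fst _ _ + (AddMonoidHom.snd _ _).comp (AddMonoidHom.snd _ _))
      convert (((hD y).nsmul_graph.preimage f).inter (ih.preimage (AddMonoidHom.snd M _))).image g
        using 1
      ext ⟨k, m⟩
      change m ∈ ∑ y ∈ insert y u, k y • D y ↔ _
      rw [Finset.sum_insert hy]
      constructor
      · rintro ⟨a, ha, b, hb, rfl⟩
        exact ⟨(a, k, b), ⟨ha, hb⟩, rfl⟩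
      · rintro ⟨⟨a, k', b⟩, ⟨ha, hb⟩, h⟩
        cases h
        exact ⟨a, ha, b, hb, rfl⟩
  exact key Finset.univ

end SubstGraph

section FreeProduct

open Pointwise Monoid

variable {ι : Type} {H : ι → Type} [∀ i, Group (H i)] {S : ∀ i, Set (H i)} {Q E : Type}
  [DecidableEq E] [DecidableEq Q]

/-- The generators of a free product. -/
def freeProductGens (S : ∀ i, Set (H i)) : Set (CoprodI H) :=
  {x | x = 1 ∨ ∃ i, ∃ h ∈ S i, x = CoprodI.of h}

/-- The sources of the edges of the automaton of the factor `i`: the edges of the original automaton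
that are not labelled in `S i` are attached to an extra state, and for all states `p` and `q` there
is an additional edge. -/
noncomputable def factorSrc (S : ∀ i, Set (H i)) (src : E → Q) (lab : E → CoprodI H) (i : ι) :
    E ⊕ (Q × Q) → Option Q :=
  open Classical in
  Sum.elim (fun e => if ∃ h ∈ S i, lab e = CoprodI.of h then some (src e) else none)
    fun x => some x.1

/-- The targets of the edges of the automaton of the factor `i`. -/
noncomputable def factorTgt (S : ∀ i, Set (H i)) (tgt : E → Q) (lab : E → CoprodI H) (i : ι) :
    E ⊕ (Q × Q) → Option Q :=
  open Classical in
  Sum.elim (fun e => if ∃ h ∈ S i, lab e = CoprodI.of h then some (tgt e) else none)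
    fun x => some x.2

/-- The labels of the edges of the automaton of the factor `i`. -/
noncomputable def factorLab (S : ∀ i, Set (H i)) (lab : E → CoprodI H) (i : ι) :
    E ⊕ (Q × Q) → H i :=
  open Classical in
  Sum.elim (fun e => if h : ∃ h ∈ S i, lab e = CoprodI.of h then h.choose else 1) fun _ => 1

/-- The runs of the automaton of a factor. -/
def FactorRun (S : ∀ i, Set (H i)) (src tgt : E → Q) (lab : E → CoprodI H) (i : ι) (p : Q)
    (h : H i) (u : E ⊕ (Q × Q) → ℕ) (q : Q) : Prop :=
  Run (factorSrc S src lab i) (factorTgt S tgt lab i) (factorLab S lab i) (some p) h u (some q)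

theorem FactorRun.nil (src tgt : E → Q) (lab : E → CoprodI H) (i : ι) (q : Q) :
    FactorRun S src tgt lab i q 1 0 q :=
  Run.nil _

theorem FactorRun.cons_inl {src tgt : E → Q} {lab : E → CoprodI H} {i : ι} {e : E} {x : H i}
    (hx : x ∈ S i) (he : lab e = CoprodI.of x) {h : H i} {u : E ⊕ (Q × Q) → ℕ} {q : Q}
    (hr : FactorRun S src tgt lab i (tgt e) h u q) :
    FactorRun S src tgt lab i (src e) (x * h) (Pi.single (Sum.inl e) 1 + u) q := by
  have hex : ∃ h ∈ S i, lab e = CoprodI.of h := ⟨x, hx, he⟩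
  have h1 : factorSrc S src lab i (.inl e) = some (src e) := if_pos hex
  have h2 : factorTgt S tgt lab i (.inl e) = some (tgt e) := if_pos hex
  have h3 : factorLab (Q := Q) S lab i (.inl e) = x := by
    have : factorLab (Q := Q) S lab i (.inl e) = hex.choose := dif_pos hex
    rw [this]
    exact CoprodI.of_injective _ (hex.choose_spec.2.symm.trans he)
  have := Run.cons (src := factorSrc S src lab i) (lab := factorLab S lab i)
    (tgt := factorTgt S tgt lab i) (.inl e) (by rw [h2]; exact hr)
  rwa [h1, h3] at this

theorem FactorRun.cons_inr {src tgt : E → Q} {lab : E → CoprodI H} {i : ι} {p r : Q} {h : H i}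
    {u : E ⊕ (Q × Q) → ℕ} {q : Q} (hr : FactorRun S src tgt lab i r h u q) :
    FactorRun S src tgt lab i p h (Pi.single (Sum.inr (p, r)) 1 + u) q := by
  have := Run.cons (src := factorSrc S src lab i) (lab := factorLab S lab i)
    (tgt := factorTgt S tgt lab i) (.inr (p, r)) hr
  have h1 : factorLab S lab i (.inr (p, r)) = 1 := rfl
  rwa [h1, one_mul] at this

theorem FactorRun.rec' {src tgt : E → Q} {lab : E → CoprodI H} {i : ι} {q : Q}
    {P : Q → H i → (E ⊕ (Q × Q) → ℕ) → Prop} (nil : P q 1 0)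
    (inl : ∀ e x h u, lab e = CoprodI.of x → P (tgt e) h u →
      P (src e) (x * h) (Pi.single (Sum.inl e) 1 + u))
    (inr : ∀ p r h u, P r h u → P p h (Pi.single (Sum.inr (p, r)) 1 + u))
    {p : Q} {h : H i} {u : E ⊕ (Q × Q) → ℕ} (hr : FactorRun S src tgt lab i p h u q) : P p h u := by
  unfold FactorRun at hr
  generalize hp : some p = p' at hr
  generalize hq : some q = q' at hr
  induction hr generalizing p with
  | nil => cases hp.trans hq.symm; exact nil
  | @cons e g v q' _ ih =>
    obtain e | ⟨a, b⟩ := e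
    · by_cases hex : ∃ h ∈ S i, lab e = CoprodI.of h
      · have h1 : factorSrc S src lab i (.inl e) = some (src e) := if_pos hex
        have h2 : factorTgt S tgt lab i (.inl e) = some (tgt e) := if_pos hex
        have h3 : factorLab (Q := Q) S lab i (.inl e) = hex.choose := dif_pos hex
        rw [h1] at hp
        cases hp
        rw [h3]
        exact inl e _ _ _ hex.choose_spec.2 (ih h2.symm hq)
      · have h1 : factorSrc S src lab i (.inl e) = none := if_neg hex
        rw [h1] at hp
        cases hp
    · have : p = a := Option.some.inj hp
      subst this
      have := inr p b _ _ (ih (p := b) rfl hq)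
      simpa [factorLab] using this

theorem single_inl_comp_inl (e : E) (u : E ⊕ (Q × Q) → ℕ) :
    (Pi.single (Sum.inl e) 1 + u) ∘ Sum.inl = Pi.single e 1 + u ∘ Sum.inl := by
  ext e'; simp [Pi.single_apply]

theorem single_inl_comp_inr (e : E) (u : E ⊕ (Q × Q) → ℕ) :
    (Pi.single (Sum.inl e) 1 + u) ∘ Sum.inr = u ∘ Sum.inr := by
  ext e'; simp

theorem single_inr_comp_inl (x : Q × Q) (u : E ⊕ (Q × Q) → ℕ) :
    (Pi.single (Sum.inr x) 1 + u) ∘ Sum.inl = u ∘ Sum.inl := by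
  ext e'; simp

theorem single_inr_comp_inr (x : Q × Q) (u : E ⊕ (Q × Q) → ℕ) :
    (Pi.single (Sum.inr x) 1 + u) ∘ Sum.inr = Pi.single x 1 + u ∘ Sum.inr := by
  ext e'; simp [Pi.single_apply]

variable [Fintype Q]

/-- The productions describing the runs that evaluate to `1`. -/
def loopProductions (S : ∀ i, Set (H i)) (src tgt : E → Q) (lab : E → CoprodI H) (x : Q × Q) :
    Set ((Q × Q → ℕ) × (E → ℕ)) :=
  (⋃ i, (fun u : E ⊕ (Q × Q) → ℕ => (u ∘ Sum.inr, u ∘ Sum.inl)) ''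
    {u | FactorRun S src tgt lab i x.1 1 u x.2}) ∪
  ((⋃ e ∈ {e | src e = x.1 ∧ tgt e = x.2 ∧ lab e = 1}, {(0, Pi.single e 1)}) ∪
  ((⋃ _ : x.1 = x.2, {(0, 0)}) ∪
    ⋃ r, {(Pi.single (x.1, r) 1 + Pi.single (r, x.2) 1, 0)}))

/-- The Parikh images of the runs that evaluate to `1`. -/
def loops (S : ∀ i, Set (H i)) (src tgt : E → Q) (lab : E → CoprodI H) : Q × Q → Set (E → ℕ) :=
  generated (loopProductions S src tgt lab)

/-- The Parikh images of the runs that evaluate to an element `h` of a factor, obtained from the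
runs of the automaton of this factor by substituting runs that evaluate to `1`. -/
def syllableRuns (S : ∀ i, Set (H i)) (src tgt : E → Q) (lab : E → CoprodI H) (i : ι) (p : Q)
    (h : H i) (q : Q) : Set (E → ℕ) :=
  {m | ∃ u, FactorRun S src tgt lab i p h u q ∧
    m ∈ {u ∘ Sum.inl} + substSums (loops S src tgt lab) (u ∘ Sum.inr)}

theorem FactorRun.toRun {src tgt : E → Q} {lab : E → CoprodI H} {D : Q × Q → Set (E → ℕ)}
    (hD : ∀ p q, ∀ v ∈ D (p, q), Run src tgt lab p 1 v q) {i : ι} {p q : Q} {h : H i}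
    {u : E ⊕ (Q × Q) → ℕ} (hr : FactorRun S src tgt lab i p h u q) {m : E → ℕ}
    (hm : m ∈ {u ∘ Sum.inl} + substSums D (u ∘ Sum.inr)) :
    Run src tgt lab p (CoprodI.of h) m q := by
  refine FactorRun.rec' (P := fun p h u => ∀ m ∈ {u ∘ Sum.inl} + substSums D (u ∘ Sum.inr),
    Run src tgt lab p (CoprodI.of h) m q) ?_ ?_ ?_ hr m hm
  · intro m hm
    have h0 : (0 : E ⊕ (Q × Q) → ℕ) ∘ Sum.inr = 0 := rfl
    rw [h0, substSums_zero, add_zero] at hm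
    rw [Set.mem_singleton_iff.1 hm, map_one]
    exact Run.nil q
  · intro e x h u he ih m hm
    rw [single_inl_comp_inl, single_inl_comp_inr, ← Set.singleton_add_singleton, add_assoc] at hm
    obtain ⟨_, rfl, m, hm, rfl⟩ := hm
    rw [map_mul, ← he]
    exact (ih m hm).cons e
  · intro p r h u ih m hm
    rw [single_inr_comp_inl, single_inr_comp_inr, substSums_add, substSums_single, one_nsmul,
      add_left_comm] at hm
    obtain ⟨v, hv, m, hm, rfl⟩ := hm
    simpa using (hD p r v hv).append (ih m hm)

theorem Run.of_mem_loops {src tgt : E → Q} {lab : E → CoprodI H} {p q : Q} {v : E → ℕ}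
    (h : v ∈ loops S src tgt lab (p, q)) : Run src tgt lab p 1 v q := by
  refine generated_subset (D := fun x => {v | Run src tgt lab x.1 1 v x.2}) ?_ (p, q) h
  rintro ⟨p, q⟩ x hx m hm
  change Run src tgt lab p 1 m q
  obtain hx | hx | hx | hx := hx
  · obtain ⟨i, u, hu, rfl⟩ := Set.mem_iUnion.1 hx
    rw [← map_one CoprodI.of]
    exact FactorRun.toRun (fun _ _ _ h => h) hu hm
  · simp only [Set.mem_iUnion] at hx
    obtain ⟨e, ⟨rfl, rfl, he⟩, rfl⟩ := hx
    rw [substSums_zero, add_zero] at hm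
    rw [Set.mem_singleton_iff.1 hm]
    simpa [he] using (Run.nil (src := src) (lab := lab) (tgt e)).cons (tgt := tgt) e
  · simp only [Set.mem_iUnion] at hx
    obtain ⟨h, rfl⟩ := hx
    cases h
    rw [substSums_zero, add_zero] at hm
    rw [Set.mem_singleton_iff.1 hm]
    exact Run.nil _
  · obtain ⟨r, rfl⟩ := Set.mem_iUnion.1 hx
    rw [substSums_add, substSums_single, substSums_single, one_nsmul, one_nsmul] at hm
    obtain ⟨_, rfl, _, ⟨v, hv, w, hw, rfl⟩, rfl⟩ := hm
    simpa using Run.append hv hw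

theorem loops_nil (src tgt : E → Q) (lab : E → CoprodI H) (q : Q) :
    0 ∈ loops S src tgt lab (q, q) := by
  refine closedUnder_generated _ (q, q) (0, 0) ?_ ?_
  · exact Or.inr (Or.inr (Or.inl (Set.mem_iUnion.2 ⟨rfl, rfl⟩)))
  · simp [substSums_zero]

theorem loops_edge {src tgt : E → Q} {lab : E → CoprodI H} {e : E} (he : lab e = 1) :
    Pi.single e 1 ∈ loops S src tgt lab (src e, tgt e) := by
  refine closedUnder_generated _ (src e, tgt e) (0, Pi.single e 1) ?_ ?_
  · exact Or.inr (Or.inl (Set.mem_biUnion (x := e) ⟨rfl, rfl, he⟩ rfl))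
  · simp [substSums_zero]

theorem loops_append {src tgt : E → Q} {lab : E → CoprodI H} {p r q : Q} {v w : E → ℕ}
    (hv : v ∈ loops S src tgt lab (p, r)) (hw : w ∈ loops S src tgt lab (r, q)) :
    v + w ∈ loops S src tgt lab (p, q) := by
  refine closedUnder_generated _ (p, q) (Pi.single (p, r) 1 + Pi.single (r, q) 1, 0) ?_ ?_
  · exact Or.inr (Or.inr (Or.inr (Set.mem_iUnion.2 ⟨r, rfl⟩)))
  · rw [substSums_add, substSums_single, substSums_single, one_nsmul, one_nsmul]
    have := Set.add_mem_add (Set.mem_singleton (0 : E → ℕ)) (Set.add_mem_add hv hw)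
    rwa [zero_add] at this

theorem syllableRuns_nil (src tgt : E → Q) (lab : E → CoprodI H) (i : ι) (q : Q) :
    0 ∈ syllableRuns S src tgt lab i q 1 q := by
  refine ⟨0, FactorRun.nil _ _ _ _ _, ?_⟩
  have h0 : (0 : E ⊕ (Q × Q) → ℕ) ∘ Sum.inr = 0 := rfl
  rw [h0, substSums_zero, add_zero]
  rfl

theorem syllableRuns_one_subset (src tgt : E → Q) (lab : E → CoprodI H) (i : ι) (p q : Q) :
    syllableRuns S src tgt lab i p 1 q ⊆ loops S src tgt lab (p, q) := by
  rintro m ⟨u, hu, hm⟩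
  refine closedUnder_generated _ (p, q) (u ∘ Sum.inr, u ∘ Sum.inl) (Or.inl ?_) hm
  exact Set.mem_iUnion.2 ⟨i, u, hu, rfl⟩

theorem syllableRuns_edge {src tgt : E → Q} {lab : E → CoprodI H} {i : ι} {e : E} {x : H i}
    (hx : x ∈ S i) (he : lab e = CoprodI.of x) {h : H i} {q : Q} {v : E → ℕ}
    (hv : v ∈ syllableRuns S src tgt lab i (tgt e) h q) :
    Pi.single e 1 + v ∈ syllableRuns S src tgt lab i (src e) (x * h) q := by
  obtain ⟨u, hu, hv⟩ := hv
  refine ⟨_, hu.cons_inl hx he, ?_⟩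
  rw [single_inl_comp_inl, single_inl_comp_inr, ← Set.singleton_add_singleton, add_assoc]
  exact ⟨_, rfl, v, hv, rfl⟩

theorem syllableRuns_loop {src tgt : E → Q} {lab : E → CoprodI H} {i : ι} {p r q : Q} {h : H i}
    {v w : E → ℕ} (hv : v ∈ loops S src tgt lab (p, r))
    (hw : w ∈ syllableRuns S src tgt lab i r h q) :
    v + w ∈ syllableRuns S src tgt lab i p h q := by
  obtain ⟨u, hu, hw⟩ := hw
  refine ⟨_, hu.cons_inr (p := p), ?_⟩
  rw [single_inr_comp_inl, single_inr_comp_inr, substSums_add, substSums_single, one_nsmul,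
    add_left_comm]
  exact ⟨v, hv, w, hw, rfl⟩

/-- The Parikh images of the runs that evaluate to the product of a list of syllables. -/
def wordRuns (S : ∀ i, Set (H i)) (src tgt : E → Q) (lab : E → CoprodI H) (q : Q) :
    List (Σ i, H i) → Q → Set (E → ℕ)
  | [], p => loops S src tgt lab (p, q)
  | x :: l, p => ⋃ r, syllableRuns S src tgt lab x.1 p x.2 r + wordRuns S src tgt lab q l r

theorem mem_wordRuns_cons {src tgt : E → Q} {lab : E → CoprodI H} {p q : Q} {x : Σ i, H i}
    {l : List (Σ i, H i)} {v : E → ℕ} :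
    v ∈ wordRuns S src tgt lab q (x :: l) p ↔ ∃ r, ∃ v₁ ∈ syllableRuns S src tgt lab x.1 p x.2 r,
      ∃ v₂ ∈ wordRuns S src tgt lab q l r, v₁ + v₂ = v :=
  Set.mem_iUnion

theorem wordRuns_loop {src tgt : E → Q} {lab : E → CoprodI H} {p r q : Q} {l : List (Σ i, H i)}
    {v w : E → ℕ} (hv : v ∈ loops S src tgt lab (p, r)) (hw : w ∈ wordRuns S src tgt lab q l r) :
    v + w ∈ wordRuns S src tgt lab q l p := by
  cases l with
  | nil => exact loops_append hv hw
  | cons x l =>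
    obtain ⟨s, w₁, hw₁, w₂, hw₂, rfl⟩ := mem_wordRuns_cons.1 hw
    rw [← add_assoc]
    exact mem_wordRuns_cons.2 ⟨s, _, syllableRuns_loop hv hw₁, w₂, hw₂, rfl⟩

theorem Run.of_mem_wordRuns {src tgt : E → Q} {lab : E → CoprodI H} {p q : Q}
    {l : List (Σ i, H i)} {v : E → ℕ} (hv : v ∈ wordRuns S src tgt lab q l p) :
    Run src tgt lab p (l.map fun x => CoprodI.of x.2).prod v q := by
  induction l generalizing p v with
  | nil => exact Run.of_mem_loops hv
  | cons x l ih =>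
    obtain ⟨s, v₁, ⟨u, hu, hv₁⟩, v₂, hv₂, rfl⟩ := mem_wordRuns_cons.1 hv
    rw [List.map_cons, List.prod_cons]
    exact (hu.toRun (fun _ _ _ => Run.of_mem_loops) hv₁).append (ih hv₂)

section Words

variable [∀ i, DecidableEq (H i)]

theorem wordRuns_rcons {src tgt : E → Q} {lab : E → CoprodI H} {p q : Q} {i : ι}
    (w : CoprodI.Word.Pair H i) {v : E → ℕ} :
    v ∈ wordRuns S src tgt lab q (CoprodI.Word.rcons w).toList p ↔
      v ∈ wordRuns S src tgt lab q (⟨i, w.head⟩ :: w.tail.toList) p := by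
  by_cases h : w.head = 1
  · rw [CoprodI.Word.rcons, dif_pos h, h]
    constructor
    · intro hv
      exact mem_wordRuns_cons.2 ⟨p, 0, syllableRuns_nil _ _ _ _ _, v, hv, zero_add _⟩
    · intro hv
      obtain ⟨s, v₁, hv₁, v₂, hv₂, rfl⟩ := mem_wordRuns_cons.1 hv
      exact wordRuns_loop (syllableRuns_one_subset _ _ _ _ _ _ hv₁) hv₂
  · rw [CoprodI.Word.rcons, dif_neg h]
    rfl

theorem mem_wordRuns_of_run [DecidableEq ι] {src tgt : E → Q} {lab : E → CoprodI H}
    (hlab : ∀ e, lab e ∈ freeProductGens S) {p q : Q} {g : CoprodI H} {v : E → ℕ}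
    (hr : Run src tgt lab p g v q) :
    v ∈ wordRuns S src tgt lab q (g • (CoprodI.Word.empty : CoprodI.Word H)).toList p := by
  induction hr with
  | nil => rw [one_smul]; exact loops_nil _ _ _ _
  | @cons e g v q _ ih =>
    obtain he | ⟨i, x, hx, he⟩ := hlab e
    · rw [he, one_mul]
      exact wordRuns_loop (loops_edge he) ih
    · generalize hw : g • (CoprodI.Word.empty : CoprodI.Word H) = w at ih
      rw [mul_smul, hw, he, CoprodI.Word.of_smul_def, wordRuns_rcons]
      rw [← (CoprodI.Word.equivPair i).symm_apply_apply w, CoprodI.Word.equivPair_symm,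
        wordRuns_rcons] at ih
      obtain ⟨s, v₁, hv₁, v₂, hv₂, rfl⟩ := mem_wordRuns_cons.1 ih
      rw [← add_assoc]
      exact mem_wordRuns_cons.2 ⟨s, _, syllableRuns_edge hx he hv₁, v₂, hv₂, rfl⟩

end Words

end FreeProduct

section FreeProduct

open Pointwise Monoid

variable {ι : Type} {H : ι → Type} [∀ i, Group (H i)] {S : ∀ i, Set (H i)}

/-- Every syllable of a list is a nonempty product of generators, with at most `n` factors in
total. -/
def WordCost (S : ∀ i, Set (H i)) : List (Σ i, H i) → ℕ → Prop
  | [], _ => True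
  | x :: l, n => ∃ w : List (S x.1), w ≠ [] ∧ x.2 = (w.map Subtype.val).prod ∧
      ∃ m, w.length + m ≤ n ∧ WordCost S l m

theorem WordCost.mono {l : List (Σ i, H i)} {n n' : ℕ} (h : WordCost S l n) (hn : n ≤ n') :
    WordCost S l n' := by
  cases l with
  | nil => trivial
  | cons x l =>
    obtain ⟨w, hw, hx, m, hm, h⟩ := h
    exact ⟨w, hw, hx, m, hm.trans hn, h⟩

theorem wordCost_rcons [∀ i, DecidableEq (H i)] {i : ι} (p : CoprodI.Word.Pair H i) {n : ℕ} :
    WordCost S (CoprodI.Word.rcons p).toList n ↔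
      ∃ w : List (S i), p.head = (w.map Subtype.val).prod ∧
        ∃ m, w.length + m ≤ n ∧ WordCost S p.tail.toList m := by
  by_cases h : p.head = 1
  · rw [CoprodI.Word.rcons, dif_pos h]
    constructor
    · exact fun hp => ⟨[], by simpa using h, n, by simp, hp⟩
    · rintro ⟨w, _, m, hm, hp⟩
      exact hp.mono (by omega)
  · rw [CoprodI.Word.rcons, dif_neg h]
    constructor
    · rintro ⟨w, _, hp⟩
      exact ⟨w, hp⟩
    · rintro ⟨w, hw, hp⟩
      exact ⟨w, by rintro rfl; exact h hw, hw, hp⟩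

theorem wordCost_prod [DecidableEq ι] [∀ i, DecidableEq (H i)]
    (w : List (freeProductGens S)) :
    WordCost S ((w.map Subtype.val).prod • (CoprodI.Word.empty : CoprodI.Word H)).toList
      w.length := by
  induction w with
  | nil => rw [List.map_nil, List.prod_nil, one_smul]; trivial
  | cons x w ih =>
    rw [List.map_cons, List.prod_cons, mul_smul, List.length_cons]
    obtain hx | ⟨i, h, hh, hx⟩ := x.2
    · rw [hx, one_smul]
      exact ih.mono (Nat.le_succ _)
    · generalize (w.map Subtype.val).prod • (CoprodI.Word.empty : CoprodI.Word H) = u at ih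
      rw [hx, CoprodI.Word.of_smul_def, wordCost_rcons]
      rw [← (CoprodI.Word.equivPair i).symm_apply_apply u, CoprodI.Word.equivPair_symm,
        wordCost_rcons] at ih
      obtain ⟨w', hw', m, hm, ih⟩ := ih
      refine ⟨⟨h, hh⟩ :: w', by simp [hw'], m, ?_, ih⟩
      rw [List.length_cons]
      omega

variable {Q E : Type}

theorem factorLab_mem (h1 : ∀ i, 1 ∈ S i) (lab : E → CoprodI H) (i : ι) (e : E ⊕ (Q × Q)) :
    factorLab S lab i e ∈ S i := by
  obtain e | e := e
  · by_cases hex : ∃ h ∈ S i, lab e = CoprodI.of h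
    · have h3 : factorLab (Q := Q) S lab i (.inl e) = hex.choose := dif_pos hex
      rw [h3]
      exact hex.choose_spec.1
    · have h3 : factorLab (Q := Q) S lab i (.inl e) = 1 := dif_neg hex
      rw [h3]
      exact h1 i
  · exact h1 i

variable [DecidableEq E] [DecidableEq Q] [Fintype Q] [Fintype E]

/-- Splitting a vector indexed by a sum type, as a homomorphism. -/
def sumSplit (E V : Type*) : (E ⊕ V → ℕ) →+ (V → ℕ) × (E → ℕ) where
  toFun u := (u ∘ Sum.inr, u ∘ Sum.inl)
  map_zero' := rfl
  map_add' _ _ := rfl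

theorem isSemilinearSet_loops [Finite ι] (hS : ∀ i, Tame (H i) (S i)) (h1 : ∀ i, 1 ∈ S i)
    (src tgt : E → Q) (lab : E → CoprodI H) (x : Q × Q) :
    IsSemilinearSet (loops S src tgt lab x) := by
  refine isSemilinearSet_generated (fun x => ?_) x
  refine IsSemilinearSet.union (.iUnion fun i => ?_) (.union ?_ (.union ?_ ?_))
  · obtain ⟨C, P, h⟩ := hS i _ _ (factorSrc S src lab i) (factorTgt S tgt lab i) _
      (factorLab_mem h1 lab i) (some x.1) (some x.2)
    have := (h []).isSemilinearSet
    exact this.image (sumSplit E (Q × Q))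
  · exact .biUnion (Set.toFinite _) fun _ _ => .singleton _
  · by_cases h : x.1 = x.2
    · simp [h]
    · simp [h]
  · exact .iUnion fun _ => .singleton _

theorem linearlyCovered_syllableRuns [Finite ι] (hS : ∀ i, Tame (H i) (S i)) (h1 : ∀ i, 1 ∈ S i)
    (src tgt : E → Q) (lab : E → CoprodI H) (i : ι) (p q : Q) :
    LinearlyCovered (J := List (S i)) List.length
      (fun w => syllableRuns S src tgt lab i p (w.map Subtype.val).prod q) := by
  let A := (((E ⊕ (Q × Q) → ℕ) × (ℕ × ℕ)) × (E → ℕ)) × (E → ℕ)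
  have hl := isSemilinearSet_substSums_graph (isSemilinearSet_loops hS h1 src tgt lab)
  let f1 : A →+ (E ⊕ (Q × Q) → ℕ) :=
    (AddMonoidHom.fst _ _).comp ((AddMonoidHom.fst _ _).comp (AddMonoidHom.fst _ _))
  let f2 : A →+ (E → ℕ) := (AddMonoidHom.snd _ _).comp (AddMonoidHom.fst _ _)
  let f3 : A →+ (E → ℕ) := AddMonoidHom.snd _ _
  have hR := ((hl.preimage (((AddMonoidHom.fst _ _).comp ((sumSplit E (Q × Q)).comp f1)).prod
    f3)).inter (isSemilinearSet_setOfPred_eq (M := A) 0 0 f2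
      ((AddMonoidHom.snd _ _).comp ((sumSplit E (Q × Q)).comp f1) + f3))).image
    (AddMonoidHom.fst _ _)
  have := (hS i _ _ (factorSrc S src lab i) (factorTgt S tgt lab i) _
    (factorLab_mem h1 lab i) (some p) (some q)).transfer hR 1 (fun _ => (0, 0)) (by simp)
  convert this using 1
  funext w
  ext m
  constructor
  · rintro ⟨u, hu, hm⟩
    obtain ⟨_, rfl, m, hm, rfl⟩ := hm
    exact ⟨u, hu, (((u, 0, 0), u ∘ Sum.inl + m), m), ⟨hm, rfl⟩, rfl⟩
  · rintro ⟨u, hu, ⟨⟨⟨u', e⟩, m'⟩, m₀⟩, ⟨hm, hm'⟩, h⟩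
    cases h
    have hm' : 0 + m = 0 + (u ∘ Sum.inl + m₀) := hm'
    rw [zero_add, zero_add] at hm'
    exact ⟨u, hu, Set.mem_add.2 ⟨_, rfl, m₀, hm, hm'.symm⟩⟩

theorem Tame.coprodI [Finite ι] (hS : ∀ i, Tame (H i) (S i)) (h1 : ∀ i, 1 ∈ S i) :
    Tame (CoprodI H) (freeProductGens S) := by
  classical
  intro Q E _ _ _ _ src tgt lab hlab p q
  obtain ⟨C, P, hC⟩ := exists_isCovered_of_finite (I := ι × Q × Q) (J := fun x => List (S x.1))
    (ℓ := fun _ => List.length)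
    (F := fun x w => syllableRuns S src tgt lab x.1 x.2.1 (w.map Subtype.val).prod x.2.2)
    fun x => linearlyCovered_syllableRuns hS h1 src tgt lab x.1 x.2.1 x.2.2
  obtain ⟨C', P', hC'⟩ := exists_isCovered_of_finite (I := Q × Q) (J := fun _ => ℕ)
    (ℓ := fun _ => id) (F := fun x _ => loops S src tgt lab x) fun x =>
      linearlyCovered_of_isSemilinearSet (AddMonoidHom.id ℕ) (fun _ h => h)
        ((isSemilinearSet_loops hS h1 src tgt lab x).preimage (AddMonoidHom.snd ℕ (E → ℕ)))
  have key : ∀ (l : List (Σ i, H i)) (n : ℕ) (p : Q), WordCost S l n →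
      IsCovered (2 * C + C') (P ∪ P') n (wordRuns S src tgt lab q l p) := by
    intro l
    induction l with
    | nil =>
      intro n p _
      exact (hC' (p, q) n).mono (by omega) Finset.subset_union_right le_rfl
    | cons x l ih =>
      rintro n p ⟨w, hw, hx, m, hm, hl⟩
      refine IsCovered.iUnion fun r => ?_
      have h1 := (hC (x.1, p, r) w).mono le_rfl (Finset.subset_union_left (s₂ := P')) le_rfl
      rw [← hx] at h1
      refine h1.add (ih m r hl) ?_
      have := List.length_pos_iff.2 hw
      nlinarith
  refine ⟨2 * C + C', P ∪ P', fun w => ?_⟩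
  have := key _ _ p (wordCost_prod w)
  convert this using 1
  ext v
  constructor
  · exact fun h => mem_wordRuns_of_run hlab h
  · intro h
    have := Run.of_mem_wordRuns h
    have hw : ∀ g : CoprodI H, ((g • (CoprodI.Word.empty : CoprodI.Word H)).toList.map
        fun x => CoprodI.of x.2).prod = g := by
      intro g
      change CoprodI.Word.prod (g • CoprodI.Word.empty) = g
      rw [CoprodI.Word.prod_smul, CoprodI.Word.prod_empty, mul_one]
    rwa [hw] at this

end FreeProduct

section Forest

open Monoid

/-- The generators of a graph group, their inverses, and `1`. -/
def graphLetters {S : Type} (I : S → S → Prop) : Set (GraphGroup I) :=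
  {x | x = 1 ∨ ∃ a, x = PresentedGroup.of a ∨ x = (PresentedGroup.of a)⁻¹}

theorem inv_mem_graphLetters {S : Type} {I : S → S → Prop} {x : GraphGroup I}
    (hx : x ∈ graphLetters I) : x⁻¹ ∈ graphLetters I := by
  obtain rfl | ⟨a, rfl | rfl⟩ := hx
  · exact Or.inl inv_one
  · exact Or.inr ⟨a, Or.inr rfl⟩
  · exact Or.inr ⟨a, Or.inl (inv_inv _)⟩

theorem GraphGroup.commute_of {S : Type} {I : S → S → Prop} {a b : S} (h : I a b) :
    Commute (PresentedGroup.of (rels := GraphGroupRels I) a) (PresentedGroup.of b) := by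
  have : PresentedGroup.mk (GraphGroupRels I) (FreeGroup.of a * FreeGroup.of b *
      (FreeGroup.of a)⁻¹ * (FreeGroup.of b)⁻¹) = 1 :=
    PresentedGroup.mk_eq_one_iff.2 (Subgroup.subset_normalClosure ⟨a, b, h, rfl⟩)
  simp only [map_mul, map_inv] at this
  rw [mul_inv_eq_one, mul_inv_eq_iff_eq_mul] at this
  exact this

/-- The homomorphism from a graph group given by a map on the generators that respects the
independence relation. -/
def GraphGroup.lift {G : Type*} [Group G] {S : Type} {I : S → S → Prop} (φ : S → G)
    (h : ∀ a b, I a b → Commute (φ a) (φ b)) : GraphGroup I →* G :=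
  PresentedGroup.toGroup (f := φ) (by
    rintro _ ⟨a, b, hab, rfl⟩
    simp only [map_mul, map_inv, FreeGroup.lift_apply_of]
    rw [mul_inv_eq_one, mul_inv_eq_iff_eq_mul]
    exact h a b hab)

@[simp]
theorem GraphGroup.lift_of {G : Type*} [Group G] {S : Type} {I : S → S → Prop} (φ : S → G)
    (h : ∀ a b, I a b → Commute (φ a) (φ b)) (a : S) :
    GraphGroup.lift φ h (PresentedGroup.of a) = φ a :=
  PresentedGroup.toGroup.of _

theorem GraphGroup.commute_lift {G : Type*} [Group G] {S : Type} {I : S → S → Prop} (φ : S → G)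
    (h : ∀ a b, I a b → Commute (φ a) (φ b)) {g : G} (hg : ∀ a, Commute (φ a) g)
    (x : GraphGroup I) : Commute (GraphGroup.lift φ h x) g := by
  have : x ∈ (Subgroup.centralizer {g}).comap (GraphGroup.lift φ h) := by
    have htop : (⊤ : Subgroup (GraphGroup I)) ≤
        (Subgroup.centralizer {g}).comap (GraphGroup.lift φ h) := by
      rw [← PresentedGroup.closure_range_of, Subgroup.closure_le]
      rintro _ ⟨a, rfl⟩
      simp only [Subgroup.coe_comap, Set.mem_preimage, GraphGroup.lift_of, SetLike.mem_coe]
      exact Subgroup.mem_centralizer_singleton_iff.2 (hg a)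
    exact htop trivial
  exact Subgroup.mem_centralizer_singleton_iff.1 (Subgroup.mem_comap.1 this)

/-- The comparability relation of `r`. -/
def Comparable {S : Type} (r : S → S → Prop) (a b : S) : Prop :=
  a ≠ b ∧ (r a b ∨ r b a)

/-- The restriction of `r` to the strict up-set of `i`. -/
def aboveRel {S : Type} (r : S → S → Prop) (i : S) (a b : {a // r i a}) : Prop :=
  r a b

/-- The minimal elements of `r`. -/
abbrev Root {S : Type} (r : S → S → Prop) : Type :=
  {i : S // ∀ b, ¬ r b i}

/-- The factor of the graph group of a forest that belongs to the tree with root `i`. -/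
abbrev TreeGroup {S : Type} (r : S → S → Prop) (i : Root r) : Type :=
  GraphGroup (Comparable (aboveRel r i.1)) × Multiplicative ℤ

theorem tame_graphGroup_comparable {S : Type} [Finite S] (r : S → S → Prop) [IsStrictOrder S r]
    (hr : ∀ a b c : S, r b a → r c a → (r b c ∨ b = c ∨ r c b)) :
    Tame (GraphGroup (Comparable r)) (graphLetters (Comparable r)) := by
  classical
  induction hn : Nat.card S using Nat.strong_induction_on generalizing S with
  | _ n ih =>
  have hT : ∀ i : Root r, Tame (TreeGroup r i)
      {x | x.1 ∈ graphLetters (Comparable (aboveRel r i.1)) ∧ |x.2.toAdd| ≤ 1} := by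
    intro i
    have : IsStrictOrder {a // r i a} (aboveRel r i.1) :=
      { irrefl := fun a => irrefl_of r a.1
        trans := fun a b c => trans_of r }
    refine (ih (Nat.card {a // r i a}) ?_ (aboveRel r i.1) ?_ rfl).prod_int
    · rw [← hn]
      exact Finite.card_subtype_lt (x := i.1) (irrefl_of r i.1)
    · intro a b c hb hc
      simpa only [aboveRel, Subtype.ext_iff] using hr a b c hb hc
  have root_unique : ∀ (a : S) (i j : Root r), (i.1 = a ∨ r i a) → (j.1 = a ∨ r j a) → i = j := by
    rintro a ⟨i, hi⟩ ⟨j, hj⟩ (rfl | h) (rfl | h')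
    · rfl
    · exact absurd h' (hi j)
    · exact absurd h (hj i)
    · obtain h | h | h := hr _ _ _ h h'
      · exact absurd h (hj i)
      · exact Subtype.ext h
      · exact absurd h (hi j)
  have exists_root : ∀ a : S, ∃ i : Root r, i.1 = a ∨ r i a := by
    intro a
    have hwf : WellFounded r := Finite.wellFounded_of_trans_of_irrefl r
    induction a using hwf.induction with
    | _ a ih =>
    by_cases h : ∀ b, ¬ r b a
    · exact ⟨⟨a, h⟩, Or.inl rfl⟩
    · push Not at h
      obtain ⟨b, hb⟩ := h
      obtain ⟨i, hi⟩ := ih b hb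
      refine ⟨i, Or.inr ?_⟩
      obtain hi | hi := hi
      · rwa [hi]
      · exact trans_of r hi hb
  choose ρ hρ using exists_root
  let x : ∀ i : Root r, S → TreeGroup r i := fun i a =>
    if h : r i a then (PresentedGroup.of ⟨a, h⟩, 1) else (1, Multiplicative.ofAdd 1)
  let φ : S → CoprodI (TreeGroup r) := fun a => CoprodI.of (x (ρ a) a)
  have hφr : ∀ a b, r a b → Commute (φ a) (φ b) := by
    intro a b hab
    have hi : ρ b = ρ a := root_unique b _ _ (hρ b) (Or.inr <| by
      obtain h | h := hρ a
      · rwa [h]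
      · exact trans_of r h hab)
    change Commute (CoprodI.of (x (ρ a) a)) (CoprodI.of (x (ρ b) b))
    rw [hi]
    refine Commute.map ?_ CoprodI.of
    have hb : r (ρ a) b := by
      obtain h | h := hρ a
      · rwa [h]
      · exact trans_of r h hab
    simp only [x, dif_pos hb]
    by_cases ha : r (ρ a) a
    · rw [dif_pos ha]
      refine Prod.ext ?_ rfl
      exact GraphGroup.commute_of ⟨fun h => irrefl_of r a (by cases h; exact hab), Or.inl hab⟩
    · rw [dif_neg ha]
      exact Prod.ext (by simp) (by simp)
  let f : GraphGroup (Comparable r) →* CoprodI (TreeGroup r) := GraphGroup.lift φ (by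
    rintro a b ⟨_, h | h⟩
    · exact hφr a b h
    · exact (hφr b a h).symm)
  have hk : ∀ i : Root r, ∀ a b : {a // r i a}, Comparable (aboveRel r i.1) a b →
      Commute (PresentedGroup.of (rels := GraphGroupRels (Comparable r)) a.1)
        (PresentedGroup.of b.1) :=
    fun i a b h => GraphGroup.commute_of ⟨fun h' => h.1 (Subtype.ext h'), h.2⟩
  let k : ∀ i : Root r, GraphGroup (Comparable (aboveRel r i.1)) →* GraphGroup (Comparable r) :=
    fun i => GraphGroup.lift (fun a => PresentedGroup.of a.1) (hk i)
  let g : CoprodI (TreeGroup r) →* GraphGroup (Comparable r) := CoprodI.lift fun i =>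
    (k i).noncommCoprod (zpowersHom _ (PresentedGroup.of i.1)) fun m z =>
      (GraphGroup.commute_lift _ _ (fun a => GraphGroup.commute_of
        ⟨fun h => i.2 i (by have := a.2; rwa [h] at this), Or.inr a.2⟩) m).zpow_right z.toAdd
  have hgf : g.comp f = MonoidHom.id _ := by
    apply PresentedGroup.ext
    intro a
    simp only [MonoidHom.comp_apply, MonoidHom.id_apply, f, g, GraphGroup.lift_of, φ,
      CoprodI.lift_of]
    by_cases ha : r (ρ a) a
    · simp only [x, dif_pos ha, k]
      refine (MonoidHom.noncommCoprod_apply _ _ _ _).trans ?_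
      rw [map_one, mul_one]
      exact GraphGroup.lift_of _ (hk (ρ a)) (⟨a, ha⟩ : {a' // r (ρ a).1 a'})
    · simp [x, dif_neg ha, (hρ a).resolve_right ha]
  refine (Tame.coprodI hT fun i => ⟨Or.inl rfl, by simp⟩).of_injective f
    (Function.LeftInverse.injective (g := g) fun y => DFunLike.congr_fun hgf y) ?_
  have hx : ∀ i a, x i a ∈
      {x : TreeGroup r i | x.1 ∈ graphLetters (Comparable (aboveRel r i.1)) ∧ |x.2.toAdd| ≤ 1} := by
    intro i a
    by_cases ha : r i a
    · simp only [x, dif_pos ha]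
      exact ⟨Or.inr ⟨_, Or.inl rfl⟩, by simp⟩
    · simp only [x, dif_neg ha]
      exact ⟨Or.inl rfl, by simp⟩
  rintro _ (rfl | ⟨a, rfl | rfl⟩)
  · exact Or.inl (map_one f)
  · exact Or.inr ⟨ρ a, x (ρ a) a, hx _ _, GraphGroup.lift_of _ _ _⟩
  · refine Or.inr ⟨ρ a, (x (ρ a) a)⁻¹, ⟨inv_mem_graphLetters (hx _ _).1, ?_⟩, ?_⟩
    · have := (hx (ρ a) a).2
      simpa using this
    · rw [map_inv, map_inv]
      exact congrArg _ (GraphGroup.lift_of _ _ _)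

end Forest

section ShortRepresentatives

variable {S : Type}

/-- The value of a letter in the graph group. -/
noncomputable def letterValue (I : S → S → Prop) : S ⊕ S → GraphGroup I :=
  Sum.elim (fun a => PresentedGroup.of a) (fun a => (PresentedGroup.of a)⁻¹)

theorem graphEval_ofList (I : S → S → Prop) (w : List (S ⊕ S)) :
    graphEval I (FreeMonoid.ofList w) = (w.map (letterValue I)).prod :=
  FreeMonoid.lift_apply _ _

theorem letterValue_mem_graphLetters (I : S → S → Prop) (x : S ⊕ S) :
    letterValue I x ∈ graphLetters I := by
  obtain a | a := x
  · exact Or.inr ⟨a, Or.inl rfl⟩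
  · exact Or.inr ⟨a, Or.inr rfl⟩

theorem exists_labelled_run {G A σ : Type*} [Group G] (M : DFA A σ) (f : A → G)
    [DecidableEq (σ × A)] (u : List A) (p : σ) :
    ∃ v, Run Prod.fst (fun e => M.step e.1 e.2) (fun e : σ × A => f e.2) p (u.map f).prod v
      (M.evalFrom p u) := by
  induction u generalizing p with
  | nil => exact ⟨0, Run.nil p⟩
  | cons a u ih =>
    obtain ⟨v, hv⟩ := ih (M.step p a)
    exact ⟨_, hv.cons (src := Prod.fst) (tgt := fun e => M.step e.1 e.2)
      (lab := fun e : σ × A => f e.2) (p, a)⟩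

theorem Run.exists_word {G A σ : Type*} [Group G] {M : DFA A σ} {f : A → G}
    [DecidableEq (σ × A)] [Fintype (σ × A)] {p q : σ} {g : G} {v : σ × A → ℕ}
    (h : Run Prod.fst (fun e => M.step e.1 e.2) (fun e : σ × A => f e.2) p g v q) :
    ∃ u : List A, M.evalFrom p u = q ∧ (u.map f).prod = g ∧ u.length = ∑ e, v e := by
  induction h with
  | nil => exact ⟨[], rfl, rfl, by simp⟩
  | cons e _ ih =>
    obtain ⟨u, h₁, h₂, h₃⟩ := ih
    refine ⟨e.2 :: u, h₁, ?_, ?_⟩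
    · rw [List.map_cons, List.prod_cons, h₂]
    · simp [Finset.sum_add_distrib, h₃, add_comm]

theorem IsTransitiveForest.tame [Finite S] {I : S → S → Prop} (h : IsTransitiveForest I) :
    Tame (GraphGroup I) (graphLetters I) := by
  obtain ⟨r, h₁, h₂, h₃⟩ := h
  obtain rfl : I = Comparable r := by
    funext a b
    exact propext (h₃ a b)
  exact tame_graphGroup_comparable r h₂

theorem IsTransitiveForest.exists_short_word [Fintype S] {I : S → S → Prop}
    (h : IsTransitiveForest I) {σ : Type} [Fintype σ] (M : DFA (S ⊕ S) σ) :
    ∃ C, ∀ w : List (S ⊕ S), ∀ u ∈ M.accepts,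
      (u.map (letterValue I)).prod = (w.map (letterValue I)).prod →
      ∃ u' ∈ M.accepts, (u'.map (letterValue I)).prod = (w.map (letterValue I)).prod ∧
        u'.length ≤ C * (w.length + 1) := by
  classical
  have key : ∀ q : σ, ∃ C, ∀ w u : List (S ⊕ S), M.eval u = q →
      (u.map (letterValue I)).prod = (w.map (letterValue I)).prod →
      ∃ u', M.eval u' = q ∧ (u'.map (letterValue I)).prod = (w.map (letterValue I)).prod ∧
        u'.length ≤ C * (w.length + 1) := by
    intro q
    obtain ⟨C, P₀, hC⟩ := h.tame σ (σ × (S ⊕ S)) Prod.fst (fun e => M.step e.1 e.2)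
      (fun e => letterValue I e.2) (fun e => letterValue_mem_graphLetters I e.2) M.start q
    refine ⟨C, fun w u hq hu => ?_⟩
    let w' : List (graphLetters I) := w.map fun x => ⟨_, letterValue_mem_graphLetters I x⟩
    have hw' : w'.map Subtype.val = w.map (letterValue I) := by
      simp [w', Function.comp_def]
    have hlen : w'.length = w.length := List.length_map _
    obtain ⟨v, hv⟩ := exists_labelled_run M (letterValue I) u M.start
    rw [hu, ← hw'] at hv
    obtain ⟨b, P, -, hb, -, hP⟩ := hC w' v (by rw [← hq]; exact hv)
    have hrun : b ∈ {v | Run Prod.fst (fun e => M.step e.1 e.2)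
        (fun e : σ × (S ⊕ S) => letterValue I e.2) M.start (w'.map Subtype.val).prod v q} :=
      by
      refine hP (Set.mem_vadd_set.2 ⟨0, ?_, add_zero b⟩)
      exact zero_mem (AddSubmonoid.closure (P : Set (σ × (S ⊕ S) → ℕ)))
    obtain ⟨u', h₁, h₂, h₃⟩ := Run.exists_word hrun
    exact ⟨u', h₁, h₂.trans (by rw [hw']), by rw [h₃, ← hlen]; exact hb⟩
  choose C hC using key
  refine ⟨∑ q, C q, fun w u hu huw => ?_⟩
  obtain ⟨u', h₁, h₂, h₃⟩ := hC _ w u rfl huw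
  refine ⟨u', ?_, h₂, h₃.trans ?_⟩
  · rw [DFA.mem_accepts, h₁]; exact hu
  · gcongr
    exact Finset.single_le_sum (f := C) (fun _ _ => Nat.zero_le _) (Finset.mem_univ _)

end ShortRepresentatives

section WordProblem

variable {S : Type}

/-- Independence of letters of the graph group. -/
def LetterIndep (I : S → S → Prop) (x y : S ⊕ S) : Prop :=
  I (Sum.elim id id x) (Sum.elim id id y)

/-- Equality of words up to commutation of adjacent independent letters. -/
inductive TraceEqv (I : S → S → Prop) : List (S ⊕ S) → List (S ⊕ S) → Prop
  | refl (x) : TraceEqv I x x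
  | cons (a) {x y} : TraceEqv I x y → TraceEqv I (a :: x) (a :: y)
  | swap {a b} (h : LetterIndep I a b) (x) : TraceEqv I (a :: b :: x) (b :: a :: x)
  | trans {x y z} : TraceEqv I x y → TraceEqv I y z → TraceEqv I x z

open Classical in
/-- Remove `a` from the front of a word, if possible up to commutation. -/
noncomputable def removeFront (I : S → S → Prop) (a : S ⊕ S) : List (S ⊕ S) → Option (List (S ⊕ S))
  | [] => none
  | y :: ys => if y = a then some ys else
      if LetterIndep I a y then (removeFront I a ys).map (y :: ·) else none

/-- Left multiplication of a reduced word by a letter. -/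
noncomputable def reducedCons (I : S → S → Prop) (a : S ⊕ S) (x : List (S ⊕ S)) : List (S ⊕ S) :=
  (removeFront I a.swap x).getD (a :: x)

/-- Words that contain no cancelling pair of letters, up to commutation. -/
def IsReducedTrace (I : S → S → Prop) : List (S ⊕ S) → Prop
  | [] => True
  | a :: x => IsReducedTrace I x ∧ removeFront I a.swap x = none

variable {I : S → S → Prop}

theorem TraceEqv.symm (hsym : ∀ a b, I a b → I b a) {x y : List (S ⊕ S)} (h : TraceEqv I x y) :
    TraceEqv I y x := by
  induction h with
  | refl x => exact .refl x
  | cons a _ ih => exact ih.cons a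
  | swap h x => exact .swap (hsym _ _ h) x
  | trans _ _ ih₁ ih₂ => exact ih₂.trans ih₁

theorem LetterIndep.ne (hirr : ∀ a, ¬ I a a) {a b : S ⊕ S} (h : LetterIndep I a b) : a ≠ b := by
  rintro rfl
  exact hirr _ h

theorem letterIndep_swap_left {a b : S ⊕ S} : LetterIndep I a.swap b ↔ LetterIndep I a b := by
  cases a <;> rfl

theorem letterIndep_swap_right {a b : S ⊕ S} : LetterIndep I a b.swap ↔ LetterIndep I a b := by
  cases b <;> rfl

theorem removeFront_cons_self (a : S ⊕ S) (x : List (S ⊕ S)) :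
    removeFront I a (a :: x) = some x := by
  simp [removeFront]

theorem removeFront_cons_of_indep (hirr : ∀ a, ¬ I a a) {a b : S ⊕ S} (h : LetterIndep I a b)
    (x : List (S ⊕ S)) : removeFront I a (b :: x) = (removeFront I a x).map (b :: ·) := by
  simp [removeFront, (h.ne hirr).symm, h]

theorem traceEqv_of_removeFront {a : S ⊕ S} {x z : List (S ⊕ S)} (hsym : ∀ a b, I a b → I b a)
    (h : removeFront I a x = some z) : TraceEqv I x (a :: z) := by
  induction x generalizing z with
  | nil => simp [removeFront] at h
  | cons y ys ih =>
    rw [removeFront] at h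
    split_ifs at h with h₁ h₂
    · cases h
      rw [h₁]
      exact .refl _
    · obtain ⟨z', hz', rfl⟩ := Option.map_eq_some_iff.1 h
      exact ((ih hz').cons y).trans (.swap (hsym _ _ h₂) _)

theorem TraceEqv.removeFront (hirr : ∀ a, ¬ I a a) (hsym : ∀ a b, I a b → I b a)
    {x y : List (S ⊕ S)} (h : TraceEqv I x y) (a : S ⊕ S) :
    Option.Rel (TraceEqv I) (removeFront I a x) (removeFront I a y) := by
  have hrefl : ∀ o : Option (List (S ⊕ S)), Option.Rel (TraceEqv I) o o := by
    rintro (_ | x)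
    · exact .none
    · exact .some (.refl x)
  induction h with
  | refl x => exact hrefl _
  | @cons b x y h ih =>
    rw [_root_.removeFront, _root_.removeFront]
    split_ifs
    · exact .some h
    · revert ih
      generalize _root_.removeFront I a x = o
      generalize _root_.removeFront I a y = o'
      rintro (h | _)
      · exact .some (h.cons b)
      · exact .none
    · exact .none
  | @swap b c h x =>
    have hne := h.ne hirr
    simp only [_root_.removeFront]
    by_cases hb : b = a
    · subst hb
      simp only [if_true, if_neg hne.symm, if_pos h]
      exact hrefl _
    by_cases hc : c = a
    · subst hc
      have := hsym _ _ h
      simp only [if_true, if_neg hne, if_pos (show LetterIndep I c b from this)]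
      exact hrefl _
    simp only [if_neg hb, if_neg hc]
    by_cases hb' : LetterIndep I a b <;> by_cases hc' : LetterIndep I a c <;>
      simp only [hb', hc', if_true, if_false, Option.map_none]
    · generalize _root_.removeFront I a x = o
      cases o with
      | none => exact .none
      | some z => exact .some (.swap h z)
    all_goals exact .none
  | @trans x y z _ _ ih₁ ih₂ =>
    revert ih₁ ih₂
    generalize _root_.removeFront I a x = o₁
    generalize _root_.removeFront I a y = o₂
    generalize _root_.removeFront I a z = o₃
    rintro (h₁ | _) h₂
    · cases h₂ with
      | some h₂ => exact .some (h₁.trans h₂)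
    · exact h₂

theorem TraceEqv.removeFront_eq_none (hirr : ∀ a, ¬ I a a) (hsym : ∀ a b, I a b → I b a)
    {x y : List (S ⊕ S)} (h : TraceEqv I x y) (a : S ⊕ S)
    (hx : _root_.removeFront I a x = none) : _root_.removeFront I a y = none := by
  have := h.removeFront hirr hsym a
  rw [hx] at this
  generalize _root_.removeFront I a y = o at this ⊢
  cases this
  rfl

theorem TraceEqv.exists_removeFront_eq_some (hirr : ∀ a, ¬ I a a) (hsym : ∀ a b, I a b → I b a)
    {x y : List (S ⊕ S)} (h : TraceEqv I x y) (a : S ⊕ S) {x' : List (S ⊕ S)}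
    (hx : _root_.removeFront I a x = some x') :
    ∃ y', _root_.removeFront I a y = some y' ∧ TraceEqv I x' y' := by
  have := h.removeFront hirr hsym a
  rw [hx] at this
  cases hy : _root_.removeFront I a y with
  | none => rw [hy] at this; cases this
  | some y' =>
    rw [hy] at this
    cases this with
    | some h => exact ⟨y', rfl, h⟩

theorem TraceEqv.reducedCons (hirr : ∀ a, ¬ I a a) (hsym : ∀ a b, I a b → I b a)
    {x y : List (S ⊕ S)} (h : TraceEqv I x y) (a : S ⊕ S) :
    TraceEqv I (reducedCons I a x) (reducedCons I a y) := by
  have := h.removeFront hirr hsym a.swap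
  rw [_root_.reducedCons, _root_.reducedCons]
  revert this
  generalize _root_.removeFront I a.swap x = o
  generalize _root_.removeFront I a.swap y = o'
  rintro (h' | _)
  · exact h'
  · exact h.cons a

theorem TraceEqv.isReducedTrace (hirr : ∀ a, ¬ I a a) (hsym : ∀ a b, I a b → I b a)
    {x y : List (S ⊕ S)} (h : TraceEqv I x y) (hx : IsReducedTrace I x) : IsReducedTrace I y := by
  induction h with
  | refl => exact hx
  | cons a h ih => exact ⟨ih hx.1, h.removeFront_eq_none hirr hsym _ hx.2⟩
  | @swap a b h x =>
    obtain ⟨⟨h₁, h₂⟩, h₃⟩ := hx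
    rw [removeFront_cons_of_indep hirr (letterIndep_swap_left.2 h), Option.map_eq_none_iff] at h₃
    refine ⟨⟨h₁, h₃⟩, ?_⟩
    rw [removeFront_cons_of_indep hirr (letterIndep_swap_left.2 (hsym _ _ h)), h₂]
    rfl
  | trans _ _ ih₁ ih₂ => exact ih₂ (ih₁ hx)

theorem IsReducedTrace.reducedCons (hirr : ∀ a, ¬ I a a) (hsym : ∀ a b, I a b → I b a)
    {x : List (S ⊕ S)} (hx : IsReducedTrace I x) (a : S ⊕ S) :
    IsReducedTrace I (reducedCons I a x) := by
  rw [_root_.reducedCons]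
  cases h : removeFront I a.swap x with
  | none => exact ⟨hx, h⟩
  | some z => exact ((traceEqv_of_removeFront hsym h).isReducedTrace hirr hsym hx).1

theorem reducedCons_swap_reducedCons (hirr : ∀ a, ¬ I a a) (hsym : ∀ a b, I a b → I b a)
    {x : List (S ⊕ S)} (hx : IsReducedTrace I x) (a : S ⊕ S) :
    TraceEqv I (reducedCons I a.swap (reducedCons I a x)) x := by
  rw [reducedCons, reducedCons, Sum.swap_swap]
  cases h : removeFront I a.swap x with
  | none =>
    rw [Option.getD_none, removeFront_cons_self]
    exact .refl x
  | some z =>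
    have h₁ := traceEqv_of_removeFront hsym h
    have h₂ : removeFront I a z = none := by
      simpa using (h₁.isReducedTrace hirr hsym hx).2
    rw [Option.getD_some, h₂]
    exact h₁.symm hsym

theorem reducedCons_comm (hirr : ∀ a, ¬ I a a) (hsym : ∀ a b, I a b → I b a) {a b : S ⊕ S}
    (hab : LetterIndep I a b) (x : List (S ⊕ S)) :
    TraceEqv I (reducedCons I a (reducedCons I b x)) (reducedCons I b (reducedCons I a x)) := by
  have main : ∀ {a b : S ⊕ S}, LetterIndep I a b → ∀ {z}, removeFront I a.swap x = some z →
      removeFront I b.swap x = none →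
      reducedCons I a (reducedCons I b x) = reducedCons I b (reducedCons I a x) := by
    intro a b hab z hz hn
    have h₁ := (traceEqv_of_removeFront hsym hz).removeFront_eq_none hirr hsym _ hn
    rw [removeFront_cons_of_indep hirr
      (letterIndep_swap_left.2 (letterIndep_swap_right.2 (hsym _ _ hab))),
      Option.map_eq_none_iff] at h₁
    simp only [reducedCons, hz, hn, Option.getD_none, Option.getD_some, h₁,
      removeFront_cons_of_indep hirr (letterIndep_swap_left.2 hab), Option.map_some]
  cases ha : removeFront I a.swap x with
  | none =>
    cases hb : removeFront I b.swap x with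
    | none =>
      simp only [reducedCons, ha, hb, Option.getD_none,
        removeFront_cons_of_indep hirr (letterIndep_swap_left.2 hab),
        removeFront_cons_of_indep hirr (letterIndep_swap_left.2 (hsym _ _ hab)), Option.map_none]
      exact .swap hab x
    | some z =>
      rw [main (hsym _ _ hab) hb ha]
      exact .refl _
  | some z =>
    cases hb : removeFront I b.swap x with
    | none =>
      rw [main hab ha hb]
      exact .refl _
    | some z' =>
      obtain ⟨y, hy, hzy⟩ := (traceEqv_of_removeFront hsym ha).exists_removeFront_eq_some hirr hsym
        _ hb
      rw [removeFront_cons_of_indep hirr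
        (letterIndep_swap_left.2 (letterIndep_swap_right.2 (hsym _ _ hab)))] at hy
      obtain ⟨y', hy', rfl⟩ := Option.map_eq_some_iff.1 hy
      have := hzy.reducedCons hirr hsym a
      simp only [reducedCons, ha, hb, Option.getD_some, hy', removeFront_cons_self] at this ⊢
      exact this

end WordProblem

section WordProblemCorrect

variable {S : Type} {I : S → S → Prop}

/-- Commutation equivalence of reduced words. -/
def traceSetoid (I : S → S → Prop) (hsym : ∀ a b, I a b → I b a) :
    Setoid {x : List (S ⊕ S) // IsReducedTrace I x} where
  r x y := TraceEqv I x y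
  iseqv := ⟨fun x => .refl x.1, fun h => h.symm hsym, fun h k => h.trans k⟩

/-- The permutation of the reduced traces given by left multiplication by a letter. -/
noncomputable def tracePerm (hirr : ∀ a, ¬ I a a) (hsym : ∀ a b, I a b → I b a) (a : S ⊕ S) :
    Equiv.Perm (Quotient (traceSetoid I hsym)) where
  toFun := Quotient.map (fun x => ⟨reducedCons I a x, x.2.reducedCons hirr hsym a⟩)
    fun _ _ h => h.reducedCons hirr hsym a
  invFun := Quotient.map (fun x => ⟨reducedCons I a.swap x, x.2.reducedCons hirr hsym a.swap⟩)
    fun _ _ h => h.reducedCons hirr hsym a.swap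
  left_inv := by
    rintro ⟨x⟩
    exact Quotient.sound (reducedCons_swap_reducedCons hirr hsym x.2 a)
  right_inv := by
    rintro ⟨x⟩
    have := reducedCons_swap_reducedCons hirr hsym x.2 a.swap
    rw [Sum.swap_swap] at this
    exact Quotient.sound this

/-- The action of the graph group on reduced traces. -/
noncomputable def traceAction (hirr : ∀ a, ¬ I a a) (hsym : ∀ a b, I a b → I b a) :
    GraphGroup I →* Equiv.Perm (Quotient (traceSetoid I hsym)) :=
  GraphGroup.lift (fun a => tracePerm hirr hsym (Sum.inl a)) fun a b h => by
    ext ⟨x⟩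
    exact Quotient.sound (reducedCons_comm hirr hsym (a := Sum.inl a) (b := Sum.inl b) h x.1)

theorem traceAction_letterValue (hirr : ∀ a, ¬ I a a) (hsym : ∀ a b, I a b → I b a) (x : S ⊕ S) :
    traceAction hirr hsym (letterValue I x) = tracePerm hirr hsym x := by
  obtain a | a := x
  · exact GraphGroup.lift_of _ _ _
  · refine (map_inv _ _).trans ?_
    exact congrArg _ (GraphGroup.lift_of _ _ _)

theorem isReducedTrace_foldr (hirr : ∀ a, ¬ I a a) (hsym : ∀ a b, I a b → I b a)
    (w : List (S ⊕ S)) : IsReducedTrace I (w.foldr (reducedCons I) []) := by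
  induction w with
  | nil => trivial
  | cons a w ih => exact ih.reducedCons hirr hsym a

theorem traceAction_prod (hirr : ∀ a, ¬ I a a) (hsym : ∀ a b, I a b → I b a)
    (w : List (S ⊕ S)) : traceAction hirr hsym (w.map (letterValue I)).prod
      (Quotient.mk _ ⟨[], trivial⟩) =
      Quotient.mk _ ⟨w.foldr (reducedCons I) [], isReducedTrace_foldr hirr hsym w⟩ := by
  induction w with
  | nil => simp
  | cons a w ih =>
    rw [List.map_cons, List.prod_cons, map_mul, Equiv.Perm.mul_apply, ih, traceAction_letterValue]
    rfl

theorem letterValue_swap (x : S ⊕ S) : letterValue I x.swap = (letterValue I x)⁻¹ := by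
  obtain a | a := x
  · rfl
  · exact (inv_inv _).symm

theorem commute_letterValue {x y : S ⊕ S} (h : LetterIndep I x y) :
    Commute (letterValue I x) (letterValue I y) := by
  have hc : Commute (PresentedGroup.of (rels := GraphGroupRels I) (Sum.elim id id x))
      (PresentedGroup.of (Sum.elim id id y)) :=
    GraphGroup.commute_of (I := I) h
  obtain a | a := x <;> obtain b | b := y
  · exact hc
  · exact hc.inv_right
  · exact hc.inv_left
  · exact hc.inv_inv

theorem TraceEqv.prod_eq {x y : List (S ⊕ S)} (h : TraceEqv I x y) :
    (x.map (letterValue I)).prod = (y.map (letterValue I)).prod := by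
  induction h with
  | refl => rfl
  | cons a _ ih => simp [ih]
  | swap h x =>
    simp only [List.map_cons, List.prod_cons]
    rw [← mul_assoc, (commute_letterValue h).eq, mul_assoc]
  | trans _ _ ih₁ ih₂ => exact ih₁.trans ih₂

theorem prod_reducedCons (hsym : ∀ a b, I a b → I b a) (a : S ⊕ S) (x : List (S ⊕ S)) :
    ((reducedCons I a x).map (letterValue I)).prod =
      letterValue I a * (x.map (letterValue I)).prod := by
  rw [reducedCons]
  cases h : removeFront I a.swap x with
  | none => simp
  | some z =>
    rw [(traceEqv_of_removeFront hsym h).prod_eq]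
    simp [letterValue_swap]

theorem TraceEqv.eq_nil {x y : List (S ⊕ S)} (h : TraceEqv I x y) (hx : x = []) : y = [] := by
  induction h with
  | refl => exact hx
  | cons => cases hx
  | swap => cases hx
  | trans _ _ ih₁ ih₂ => exact ih₂ (ih₁ hx)

/-- The word problem of a graph group. -/
theorem prod_letterValue_eq_one_iff (hirr : ∀ a, ¬ I a a) (hsym : ∀ a b, I a b → I b a)
    (w : List (S ⊕ S)) :
    (w.map (letterValue I)).prod = 1 ↔ w.foldr (reducedCons I) [] = [] := by
  constructor
  · intro h
    have := traceAction_prod hirr hsym w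
    rw [h, map_one, Equiv.Perm.one_apply] at this
    have h' : TraceEqv I [] (w.foldr (reducedCons I) []) := Quotient.exact this
    exact h'.eq_nil rfl
  · intro h
    have : ((w.foldr (reducedCons I) []).map (letterValue I)).prod =
        (w.map (letterValue I)).prod := by
      clear h
      induction w with
      | nil => rfl
      | cons a w ih =>
        rw [List.foldr_cons, prod_reducedCons hsym, ih, List.map_cons, List.prod_cons]
    rw [← this, h, List.map_nil, List.prod_nil]

end WordProblemCorrect

section Decidability

theorem Primrec.foldl_finite {A σ : Type} [Primcodable A] [Finite A] [Primcodable σ] [Finite σ]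
    (step : σ → A → σ) (s : σ) : Primrec fun w : List A => w.foldl step s :=
  Primrec.list_foldl (h := fun _ p => step p.1 p.2) .id (.const s)
    ((Primrec.dom_finite fun p : σ × A => step p.1 p.2).comp .snd)

/-- All words of length at most `n` over the letters in `l`. -/
def wordsUpTo {A : Type} (l : List A) (n : ℕ) : List (List A) :=
  n.rec [[]] fun _ W => W ++ W.flatMap fun w => l.map (· :: w)

theorem mem_wordsUpTo {A : Type} {l : List A} (hl : ∀ a, a ∈ l) {n : ℕ} {w : List A} :
    w ∈ wordsUpTo l n ↔ w.length ≤ n := by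
  induction n generalizing w with
  | zero => simp [wordsUpTo]
  | succ n ih =>
    change w ∈ wordsUpTo l n ++ (wordsUpTo l n).flatMap _ ↔ _
    simp only [List.mem_append, List.mem_flatMap, ih, List.mem_map]
    constructor
    · rintro (h | ⟨v, hv, a, -, rfl⟩)
      · omega
      · simpa using hv
    · intro h
      cases w with
      | nil => simp
      | cons a w => exact Or.inr ⟨w, by simpa using h, a, hl a, rfl⟩

theorem primrec_wordsUpTo {A : Type} [Primcodable A] (l : List A) : Primrec (wordsUpTo l) := by
  refine Primrec.nat_rec₁ _ ?_
  refine Primrec.list_append.comp .snd (Primrec.list_flatMap .snd ?_)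
  exact Primrec.list_map (.const l) (Primrec.list_cons.comp .snd (Primrec.snd.comp .fst))

theorem prod_reverse_map_swap {S : Type} (I : S → S → Prop) (u : List (S ⊕ S)) :
    ((u.map Sum.swap).reverse.map (letterValue I)).prod = (u.map (letterValue I)).prod⁻¹ := by
  rw [List.prod_inv_reverse, List.map_reverse, List.map_map, List.map_map]
  congr 2
  exact List.map_congr_left fun x _ => letterValue_swap x

variable {S : Type} [Primcodable S] [Finite S]

open Classical in
theorem primrec_removeFront (I : S → S → Prop) : Primrec₂ (removeFront I) := by
  have hI : PrimrecPred fun p : (S ⊕ S) × (S ⊕ S) => LetterIndep I p.1 p.2 :=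
    ⟨inferInstance, Primrec.dom_finite _⟩
  have : Primrec fun p : (S ⊕ S) × List (S ⊕ S) =>
      (List.recOn p.2 (none : Option (List (S ⊕ S))) fun y ys ih =>
        if y = p.1 then some ys else
          if LetterIndep I p.1 y then ih.map (y :: ·) else none : Option (List (S ⊕ S))) := by
    refine Primrec.list_rec (h := fun (p : (S ⊕ S) × List (S ⊕ S))
      (t : (S ⊕ S) × List (S ⊕ S) × Option (List (S ⊕ S))) =>
        if t.1 = p.1 then some t.2.1 else
          if LetterIndep I p.1 t.1 then t.2.2.map (t.1 :: ·) else none) .snd (.const none) ?_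
    have h₁ : Primrec fun q : ((S ⊕ S) × List (S ⊕ S)) ×
      ((S ⊕ S) × List (S ⊕ S) × Option (List (S ⊕ S))) => q.2.1 := Primrec.fst.comp .snd
    have h₂ : Primrec fun q : ((S ⊕ S) × List (S ⊕ S)) ×
      ((S ⊕ S) × List (S ⊕ S) × Option (List (S ⊕ S))) => q.1.1 := Primrec.fst.comp .fst
    refine Primrec.ite (Primrec.eq.comp h₁ h₂)
      (Primrec.option_some.comp (Primrec.fst.comp (Primrec.snd.comp .snd)))
      (Primrec.ite (hI.comp (h₂.pair h₁)) ?_ (.const none))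
    exact Primrec.option_map (Primrec.snd.comp (Primrec.snd.comp .snd))
      (Primrec.list_cons.comp (h₁.comp .fst) .snd)
  refine this.of_eq fun p => ?_
  obtain ⟨a, x⟩ := p
  induction x with
  | nil => rfl
  | cons y ys ih =>
    rw [removeFront, ← ih]

theorem primrec_reducedCons (I : S → S → Prop) : Primrec₂ (reducedCons I) :=
  Primrec.option_getD.comp
    ((primrec_removeFront I).comp ((Primrec.dom_finite Sum.swap).comp .fst) .snd)
    (Primrec.list_cons.comp .fst .snd)

theorem primrecPred_foldr_reducedCons (I : S → S → Prop) :
    PrimrecPred fun w : List (S ⊕ S) => w.foldr (reducedCons I) [] = [] := by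
  classical
  exact Primrec.eq.comp (Primrec.list_foldr (h := fun _ p => reducedCons I p.1 p.2) .id (.const [])
    ((primrec_reducedCons I).comp (Primrec.fst.comp .snd) (Primrec.snd.comp .snd))) (.const [])

theorem IsTransitiveForest.computablePred_mem {I : S → S → Prop} (h : IsTransitiveForest I)
    (hirr : ∀ a, ¬ I a a) (hsym : ∀ a b, I a b → I b a) {L : Language (S ⊕ S)}
    (hL : L.IsRegular) :
    ComputablePred fun w : List (S ⊕ S) =>
      graphEval I (FreeMonoid.ofList w) ∈
        (fun v : List (S ⊕ S) => graphEval I (FreeMonoid.ofList v)) '' L := by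
  classical
  have := Fintype.ofFinite S
  obtain ⟨σ, _, M, rfl⟩ := hL
  obtain ⟨C, hC⟩ := h.exists_short_word M
  obtain ⟨l, -, hl⟩ := Finite.exists_univ_list (S ⊕ S)
  have hfold : PrimrecRel fun (u w : List (S ⊕ S)) => M.eval u ∈ M.accept ∧
      ((u.map Sum.swap).reverse ++ w).foldr (reducedCons I) [] = [] := by
    have hacc : PrimrecPred fun s : σ => s ∈ M.accept := ⟨inferInstance, Primrec.dom_finite _⟩
    refine (hacc.comp ((Primrec.foldl_finite M.step M.start).comp .fst)).and ?_
    refine (primrecPred_foldr_reducedCons I).comp (Primrec.list_append.comp ?_ .snd)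
    exact Primrec.list_reverse.comp
      (Primrec.list_map .fst ((Primrec.dom_finite Sum.swap).comp .snd))
  have hlen : Primrec fun w : List (S ⊕ S) => wordsUpTo l (C * (w.length + 1)) :=
    (primrec_wordsUpTo l).comp (Primrec.nat_mul.comp (.const C)
      (Primrec.succ.comp Primrec.list_length))
  refine PrimrecPred.computablePred ((hfold.exists_mem_list.comp hlen .id).of_eq fun w => ?_)
  have key : ∀ u : List (S ⊕ S), ((u.map Sum.swap).reverse ++ w).foldr (reducedCons I) [] = [] ↔
      (u.map (letterValue I)).prod = (w.map (letterValue I)).prod := by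
    intro u
    rw [← prod_letterValue_eq_one_iff hirr hsym, List.map_append, List.prod_append,
      prod_reverse_map_swap, inv_mul_eq_one]
  simp only [mem_wordsUpTo hl, id, key, graphEval_ofList]
  constructor
  · rintro ⟨u, -, hu, huw⟩
    exact ⟨u, hu, huw⟩
  · rintro ⟨u, hu, huw⟩
    obtain ⟨u', h₁, h₂, h₃⟩ := hC w u hu huw
    exact ⟨u', h₃, h₁, h₂⟩

end Decidability

section Wolk

/-- An independence alphabet that is not a transitive forest contains a path on four vertices
whose vertices at distance two are dependent. -/
theorem exists_path_of_not_isTransitiveForest {S : Type} [Finite S] {I : S → S → Prop}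
    (hirr : ∀ a, ¬ I a a) (hsym : ∀ a b, I a b → I b a) (h : ¬ IsTransitiveForest I) :
    ∃ a b c d, I a b ∧ I b c ∧ I c d ∧ ¬ I a c ∧ ¬ I b d ∧ a ≠ c ∧ b ≠ d := by
  by_contra! hpath
  apply h
  let N : S → Set S := fun a => {x | x = a ∨ I a x}
  have nested : ∀ x y, I x y → N x ⊆ N y ∨ N y ⊆ N x := by
    intro x y hxy
    by_contra! hn
    obtain ⟨hn₁, hn₂⟩ := hn
    obtain ⟨a, ha, ha'⟩ := Set.not_subset.1 hn₁
    obtain ⟨d, hd, hd'⟩ := Set.not_subset.1 hn₂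
    change ¬ (a = y ∨ I y a) at ha'
    change ¬ (d = x ∨ I x d) at hd'
    push Not at ha' hd'
    have hxa : I x a := ha.resolve_left fun h => ha'.2 (h ▸ hsym _ _ hxy)
    have hyd : I y d := hd.resolve_left fun h => hd'.2 (h ▸ hxy)
    exact hd'.1 (hpath a x y d (hsym _ _ hxa) hxy hyd (fun h => ha'.2 (hsym _ _ h)) hd'.2
      ha'.1).symm
  obtain ⟨n, ⟨e⟩⟩ := Finite.exists_equiv_fin S
  let r : S → S → Prop := fun b a => I a b ∧ (N a ⊂ N b ∨ N a = N b ∧ e b < e a)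
  have hsub : ∀ {a b}, r b a → N a ⊆ N b := by
    rintro a b ⟨-, h | h⟩
    · exact h.subset
    · exact h.1.subset
  have total : ∀ a b, I a b → r b a ∨ r a b := by
    intro a b hab
    have hne : e a ≠ e b := fun h => hirr a (by rw [← e.injective h] at hab; exact hab)
    by_cases heq : N a = N b
    · obtain hlt | hlt := lt_or_gt_of_ne hne
      · exact Or.inr ⟨hsym _ _ hab, Or.inr ⟨heq.symm, hlt⟩⟩
      · exact Or.inl ⟨hab, Or.inr ⟨heq, hlt⟩⟩
    · obtain h | h := nested a b hab
      · exact Or.inl ⟨hab, Or.inl (h.ssubset_of_ne heq)⟩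
      · exact Or.inr ⟨hsym _ _ hab, Or.inl (h.ssubset_of_ne (Ne.symm heq))⟩
  refine ⟨r, { irrefl := fun a h => hirr a h.1, trans := ?_ }, ?_, ?_⟩
  · intro c b a hcb hba
    have hac : a ∈ N c := hsub hcb (hsub hba (Or.inl rfl))
    have hstep : N a ⊂ N c ∨ N a = N c ∧ e c < e a := by
      obtain ⟨-, h | h⟩ := hcb
      · exact Or.inl ((hsub hba).trans_ssubset h)
      · obtain ⟨-, h' | h'⟩ := hba
        · exact Or.inl (h.1 ▸ h')
        · exact Or.inr ⟨h'.1.trans h.1, h.2.trans h'.2⟩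
    refine ⟨hac.elim ?_ (hsym _ _), hstep⟩
    rintro rfl
    obtain h | h := hstep
    · exact absurd rfl h.ne
    · exact absurd h.2 (lt_irrefl _)
  · intro a b c hb hc
    have : c ∈ N b := hsub hb (Or.inr hc.1)
    obtain rfl | h := this
    · exact Or.inr (Or.inl rfl)
    · obtain h | h := total b c h
      · exact Or.inr (Or.inr h)
      · exact Or.inl h
  · intro a b
    constructor
    · intro h
      exact ⟨fun h' => hirr a (h' ▸ h), (total a b h).symm⟩
    · rintro ⟨-, h | h⟩
      · exact hsym _ _ h.1
      · exact h.1

end Wolk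

namespace Language

open scoped Computability

variable {α : Type*}

theorem isRegular_singleton (w : List α) : IsRegular ({w} : Set (List α)) := by
  apply IsRegular.of_finite_range_leftQuotient
  refine Set.Finite.subset (s := insert (0 : Language α)
    ((fun v => ({v} : Set (List α))) '' {v | v ∈ w.tails}))
    ((w.tails.finite_toSet.image _).insert _) ?_
  rintro _ ⟨x, rfl⟩
  by_cases hx : ∃ v, x ++ v = w
  · obtain ⟨v, rfl⟩ := hx
    refine Or.inr ⟨v, ?_, ?_⟩
    · simp
    · ext u
      change u = v ↔ x ++ u = x ++ v
      simp
  · refine Or.inl ?_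
    ext u
    exact iff_of_false (fun h => hx ⟨u, h⟩) (notMem_zero u)

theorem isRegular_zero : IsRegular (0 : Language α) :=
  ⟨PUnit, inferInstance, ⟨fun _ _ => PUnit.unit, PUnit.unit, ∅⟩, by
    ext w
    simp [DFA.mem_accepts, notMem_zero]⟩

theorem IsRegular.mul {L M : Language α} (hL : L.IsRegular) (hM : M.IsRegular) :
    (L * M).IsRegular := by
  apply IsRegular.of_finite_range_leftQuotient
  let f : Language α × Set (Language α) → Language α := fun p => p.1 * M + (sSup p.2 : Language α)
  refine Set.Finite.subset ((hL.finite_range_leftQuotient.prod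
    hM.finite_range_leftQuotient.finite_subsets).image f) ?_
  rintro _ ⟨x, rfl⟩
  refine ⟨(L.leftQuotient x, {N | ∃ u ∈ L, ∃ v, u ++ v = x ∧ N = M.leftQuotient v}),
    ⟨⟨x, rfl⟩, ?_⟩, ?_⟩
  · rintro _ ⟨u, -, v, -, rfl⟩
    exact ⟨v, rfl⟩
  · ext w
    simp only [f, mem_add, mem_mul, mem_leftQuotient]
    constructor
    · rintro (⟨a, ha, b, hb, rfl⟩ | h)
      · exact ⟨x ++ a, ha, b, hb, by simp⟩
      · obtain ⟨_, ⟨u, hu, v, rfl, rfl⟩, hw⟩ := h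
        exact ⟨u, hu, v ++ w, hw, by simp⟩
    · rintro ⟨a, ha, b, hb, h⟩
      obtain ⟨c, rfl, rfl⟩ | ⟨c, rfl, rfl⟩ := List.append_eq_append_iff.1 h
      · refine Or.inr ?_
        exact ⟨_, ⟨a, ha, c, rfl, rfl⟩, hb⟩
      · exact Or.inl ⟨c, ha, b, hb, rfl⟩

theorem IsRegular.kstar {L : Language α} (hL : L.IsRegular) : (L∗).IsRegular := by
  apply IsRegular.of_finite_range_leftQuotient
  let f : Set (Language α) → Language α := fun p => (sSup p : Language α) * L∗
  refine Set.Finite.subset ((hL.finite_range_leftQuotient.finite_subsets.image f).insert (L∗)) ?_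
  rintro _ ⟨x, rfl⟩
  by_cases hx : x = []
  · exact Or.inl (by rw [hx, leftQuotient_nil])
  refine Or.inr ⟨{N | ∃ u ∈ L∗, ∃ v, u ++ v = x ∧ N = L.leftQuotient v}, ?_, ?_⟩
  · rintro _ ⟨u, -, v, -, rfl⟩
    exact ⟨v, rfl⟩
  · ext w
    simp only [f, mem_mul, mem_leftQuotient]
    constructor
    · rintro ⟨a, ⟨_, ⟨u, hu, v, rfl, rfl⟩, ha⟩, b, hb, rfl⟩
      have ha' : v ++ a ∈ L := ha
      have h := append_mem_mul (append_mem_mul hu ha') hb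
      have hle : L∗ * L * L∗ ≤ L∗ := by
        rw [mul_assoc]
        exact (mul_le_mul_right mul_kstar_le_kstar _).trans (kstar_mul_kstar L).le
      have h' := hle h
      rwa [← List.append_assoc u, List.append_assoc] at h'
    · intro h
      obtain ⟨l, hl, hmem⟩ := mem_kstar.1 h
      clear h
      suffices H : ∀ (l : List (List α)) (u x : List α), u ∈ L∗ → x ≠ [] → x ++ w = l.flatten →
          (∀ y ∈ l, y ∈ L) → ∃ a, (∃ u' ∈ L∗, ∃ v, u' ++ v = u ++ x ∧ v ++ a ∈ L) ∧
            ∃ b ∈ L∗, a ++ b = w by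
        obtain ⟨a, ⟨u, hu, v, h, ha⟩, hb⟩ := H l [] x (nil_mem_kstar L) hx hl hmem
        refine ⟨a, ?_, hb⟩
        exact ⟨_, ⟨u, hu, v, h, rfl⟩, ha⟩
      intro l
      induction l with
      | nil =>
        intro u x _ hx h
        simp_all
      | cons y l ih =>
        intro u x hu hx h hmem
        rw [List.flatten_cons] at h
        have hy := hmem y (by simp)
        have hl : ∀ z ∈ l, z ∈ L := fun z hz => hmem z (by simp [hz])
        obtain ⟨c, h₁, h₂⟩ | ⟨c, h₁, h₂⟩ := List.append_eq_append_iff.1 h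
        · exact ⟨c, ⟨u, hu, x, rfl, h₁ ▸ hy⟩, _, join_mem_kstar hl, h₂.symm⟩
        · by_cases hc : c = []
          · subst hc
            refine ⟨[], ⟨u, hu, x, rfl, ?_⟩, w, ?_, rfl⟩
            · simpa [h₁] using hy
            · have : w = l.flatten := by simpa using h₂.symm
              exact this ▸ join_mem_kstar hl
          · subst h₁
            have huy : u ++ y ∈ L∗ := by
              have hle : L∗ * L ≤ L∗ := kstar_mul_le_kstar
              exact hle (append_mem_mul hu hy)
            obtain ⟨a, ⟨u', hu', v, hv, ha⟩, hb⟩ := ih (u ++ y) c huy hc h₂.symm hl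
            exact ⟨a, ⟨u', hu', v, by simpa using hv, ha⟩, hb⟩

end Language

open Finsupp in
/-- Relations on register contents computed by nondeterministic counter programs. -/
inductive IsProgram : ((ℕ →₀ ℕ) → (ℕ →₀ ℕ) → Prop) → Prop
  | skip : IsProgram fun s s' => s = s'
  | inc (i : ℕ) : IsProgram fun s s' => s' = s + single i 1
  | dec (i : ℕ) : IsProgram fun s s' => s = s' + single i 1
  | test (i : ℕ) : IsProgram fun s s' => s' = s ∧ s i = 0
  | comp {R R'} : IsProgram R → IsProgram R' → IsProgram (Relation.Comp R R')
  | star {R} : IsProgram R → IsProgram (Relation.ReflTransGen R)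

namespace IsProgram

open Finsupp Relation

variable {α : Type*} {s s' t u : α} {R R' B : α → α → Prop}

/-- From `s`, the relation `R` leads to `t` and nowhere else. -/
def Runs (R : α → α → Prop) (s t : α) : Prop := ∀ s', R s s' ↔ s' = t

theorem Runs.comp_iff (h : Runs R s t) : Comp R R' s s' ↔ R' t s' := by
  constructor
  · rintro ⟨u, hu, hu'⟩
    rwa [(h u).1 hu] at hu'
  · exact fun h' => ⟨t, (h t).2 rfl, h'⟩

theorem Runs.comp (h : Runs R s t) (h' : Runs R' t u) : Runs (Comp R R') s u :=
  fun s' => h.comp_iff.trans (h' s')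

theorem runs_inc (i : ℕ) (s : ℕ →₀ ℕ) :
    Runs (fun s s' : ℕ →₀ ℕ => s' = s + single i 1) s (s + single i 1) :=
  fun _ => Iff.rfl

theorem runs_dec (i : ℕ) (s : ℕ →₀ ℕ) :
    Runs (fun s s' : ℕ →₀ ℕ => s = s' + single i 1) (s + single i 1) s :=
  fun _ => ⟨fun h => (add_right_cancel h).symm, fun h => by rw [h]⟩

/-- The program that repeats `B`, decrementing register `i` each time, until it vanishes. -/
def Loop (i : ℕ) (B : (ℕ →₀ ℕ) → (ℕ →₀ ℕ) → Prop) : (ℕ →₀ ℕ) → (ℕ →₀ ℕ) → Prop :=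
  Comp (ReflTransGen (Comp (fun s s' => s = s' + single i 1) B)) (fun s s' => s' = s ∧ s i = 0)

section Loop

variable {i : ℕ} {B : (ℕ →₀ ℕ) → (ℕ →₀ ℕ) → Prop} {s s' t : ℕ →₀ ℕ}

theorem loop (hB : IsProgram B) : IsProgram (Loop i B) := ((dec i).comp hB).star.comp (test i)

theorem loop_zero (h : s i = 0) : Runs (Loop i B) s s := by
  intro s'
  constructor
  · rintro ⟨u, hu, rfl, -⟩
    obtain rfl | ⟨_, ⟨v, rfl, -⟩, -⟩ := hu.cases_head
    · rfl
    · simp at h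
  · rintro rfl
    exact ⟨_, .refl, rfl, h⟩

theorem loop_succ (h : Runs B s t) : Loop i B (s + single i 1) s' ↔ Loop i B t s' := by
  have hstep : Runs (Comp (fun s s' => s = s' + single i 1) B) (s + single i 1) t :=
    (runs_dec i s).comp h
  constructor
  · rintro ⟨u, hu, hs, hi⟩
    obtain rfl | ⟨v, hv, hvu⟩ := hu.cases_head
    · simp at hi
    · rw [(hstep v).1 hv] at hvu
      exact ⟨u, hvu, hs, hi⟩
  · rintro ⟨u, hu, h'⟩
    exact ⟨u, .head ((hstep t).2 rfl) hu, h'⟩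

theorem exists_clear (i : ℕ) : ∃ R, IsProgram R ∧
    ∀ (s : ℕ →₀ ℕ) k, s i = 0 → Runs R (s + single i k) s := by
  refine ⟨_, skip.loop (i := i), fun s k hs => ?_⟩
  induction k with
  | zero => simpa using loop_zero hs
  | succ k ih =>
    intro s'
    rw [single_add, ← add_assoc, loop_succ (t := s + single i k) fun s' => eq_comm]
    exact ih s'

theorem exists_move {i o : ℕ} (hio : i ≠ o) : ∃ R, IsProgram R ∧
    ∀ (s : ℕ →₀ ℕ) k, s i = 0 → Runs R (s + single i k) (s + single o k) := by
  refine ⟨_, (inc o).loop (i := i), fun s k hs => ?_⟩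
  induction k generalizing s with
  | zero => simpa using loop_zero hs
  | succ k ih =>
    intro s'
    rw [single_add, ← add_assoc, loop_succ (runs_inc o _), add_right_comm,
      ih (s + single o 1) (by simp [hs, hio.symm]) s', add_comm k 1, single_add, add_assoc]

theorem exists_copy {i o m : ℕ} (hio : i ≠ o) (him : i ≠ m) (hom : o ≠ m) :
    ∃ R, IsProgram R ∧ ∀ s : ℕ →₀ ℕ, s m = 0 → Runs R s (s + single o (s i)) := by
  obtain ⟨M, hM, hMr⟩ := exists_move him.symm
  have hloop : ∀ (k : ℕ) (s : ℕ →₀ ℕ), s i = 0 →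
      Runs (Loop i (Comp (fun s s' => s' = s + single o 1) (fun s s' => s' = s + single m 1)))
        (s + single i k) (s + single o k + single m k) := by
    intro k
    induction k with
    | zero =>
      intro s hs
      simpa using loop_zero hs
    | succ k ih =>
      intro s hs s'
      rw [single_add, ← add_assoc, loop_succ ((runs_inc o _).comp (runs_inc m _)),
        show s + single i k + single o 1 + single m 1 = s + single o 1 + single m 1 + single i k by
          abel, ih _ (by simp [hs, hio.symm, him.symm]) s']
      simp only [single_add]
      rw [show s + single o 1 + single m 1 + single o k + single m k =
        s + (single o k + single o 1) + (single m k + single m 1) by abel]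
  refine ⟨_, (((inc o).comp (inc m)).loop (i := i)).comp hM, fun s hs => ?_⟩
  obtain ⟨u, hu, hui⟩ : ∃ u, s = u + single i (s i) ∧ u i = 0 :=
    ⟨s.erase i, by rw [add_comm, single_add_erase], by simp⟩
  have hum : u m = 0 := by
    rw [hu] at hs
    simpa [him] using hs
  have h1 := hloop (s i) u hui
  have h2 := hMr (u + single o (s i)) (s i) (by simp [hum, hom])
  have := h1.comp h2
  rw [← hu] at this
  convert this using 1
  conv_lhs => rw [hu]
  simp [hui, add_right_comm]

end Loop

end IsProgram

namespace IsProgram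

open Finsupp Relation

/-- The function `f` is computed by counter programs: for any choice of input registers, of an
output register and of a bound beyond which all registers are scratch, some program adds the value
of `f` to the output register, leaving all other registers unchanged. -/
def Realizes {n : ℕ} (f : List.Vector ℕ n →. ℕ) : Prop :=
  ∀ (r : Fin n → ℕ) (o N : ℕ), (∀ i, r i < N) → o < N → (∀ i, r i ≠ o) →
    ∃ R, IsProgram R ∧ ∀ s : ℕ →₀ ℕ, (∀ j, N ≤ j → s j = 0) → ∀ s',
      R s s' ↔ ∃ y ∈ f (List.Vector.ofFn fun i => s (r i)), s' = s + single o y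

theorem realizes_zero : Realizes fun _ : List.Vector ℕ 0 => Part.some 0 := by
  intro r o N _ _ _
  exact ⟨_, skip, fun s _ s' => by simp [eq_comm]⟩

theorem realizes_succ : Realizes fun v : List.Vector ℕ 1 => Part.some v.head.succ := by
  intro r o N hr ho hro
  obtain ⟨R, hR, hRr⟩ := exists_copy (hro 0) (hr 0).ne ho.ne
  refine ⟨_, hR.comp (inc o), fun s hs s' => ?_⟩
  rw [(hRr s (hs N le_rfl)).comp_iff]
  simp [add_assoc, ← single_add]

theorem realizes_get {n : ℕ} (i : Fin n) :
    Realizes fun v : List.Vector ℕ n => Part.some (v.get i) := by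
  intro r o N hr ho hro
  obtain ⟨R, hR, hRr⟩ := exists_copy (hro i) (hr i).ne ho.ne
  refine ⟨_, hR, fun s hs s' => ?_⟩
  rw [hRr s (hs N le_rfl) s']
  simp

theorem mem_mOfFn {α : Type*} {n : ℕ} (f : Fin n → Part α) (w : List.Vector α n) :
    w ∈ List.Vector.mOfFn f ↔ ∀ i, w.get i ∈ f i := by
  induction n with
  | zero =>
    refine iff_of_true ?_ fun i => i.elim0
    rw [List.Vector.eq_nil w]
    exact Part.mem_some _
  | succ n ih =>
    simp only [List.Vector.mOfFn, Part.bind_eq_bind, Part.mem_bind_iff, ih, Part.pure_eq_some,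
      Part.mem_some_iff, Fin.forall_fin_succ]
    constructor
    · rintro ⟨a, ha, v, hv, rfl⟩
      simpa using ⟨ha, hv⟩
    · rintro ⟨h₀, h⟩
      refine ⟨_, h₀, w.tail, fun i => ?_, ?_⟩
      · simpa [List.Vector.get_tail_succ] using h i
      · rw [List.Vector.get_zero, List.Vector.cons_head_tail]

theorem sum_single_apply_of_lt {N k : ℕ} (y : ℕ → ℕ) {j : ℕ} (hj : j < N ∨ N + k ≤ j) :
    (∑ i ∈ Finset.range k, single (N + i) (y i)) j = 0 := by
  rw [Finsupp.finsetSum_apply]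
  refine Finset.sum_eq_zero fun i hi => ?_
  have := Finset.mem_range.1 hi
  exact single_eq_of_ne (by omega)

theorem exists_clear_range (N k : ℕ) : ∃ R, IsProgram R ∧
    ∀ (s : ℕ →₀ ℕ) (y : ℕ → ℕ), (∀ j, N ≤ j → s j = 0) →
      Runs R (s + ∑ i ∈ Finset.range k, single (N + i) (y i)) s := by
  induction k with
  | zero => exact ⟨_, skip, fun s y _ s' => by simp [eq_comm]⟩
  | succ k ih =>
    obtain ⟨R, hR, hRr⟩ := ih
    obtain ⟨C, hC, hCr⟩ := exists_clear (N + k)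
    refine ⟨_, hC.comp hR, fun s y hs => ?_⟩
    rw [Finset.sum_range_succ, ← add_assoc]
    refine (hCr _ _ ?_).comp (hRr s y hs)
    rw [Finsupp.add_apply, hs _ (by omega), sum_single_apply_of_lt _ (Or.inr le_rfl)]

theorem Realizes.comp {m n : ℕ} {f : List.Vector ℕ n →. ℕ} {g : Fin n → List.Vector ℕ m →. ℕ}
    (hf : Realizes f) (hg : ∀ i, Realizes (g i)) :
    Realizes fun v => (List.Vector.mOfFn fun i => g i v) >>= f := by
  intro r o N hr ho hro
  have hargs : ∀ k ≤ n, ∃ R, IsProgram R ∧ ∀ s : ℕ →₀ ℕ, (∀ j, N ≤ j → s j = 0) → ∀ s',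
      R s s' ↔ ∃ y : ℕ → ℕ, (∀ i : Fin n, (i : ℕ) < k →
        y i ∈ g i (List.Vector.ofFn fun i => s (r i))) ∧
        s' = s + ∑ i ∈ Finset.range k, single (N + i) (y i) := by
    intro k
    induction k with
    | zero => exact fun _ => ⟨_, skip, fun s _ s' => by simp [eq_comm]⟩
    | succ k ih =>
      intro hk
      obtain ⟨R, hR, hRr⟩ := ih (by omega)
      obtain ⟨G, hG, hGr⟩ := hg ⟨k, hk⟩ r (N + k) (N + n) (fun i => by have := hr i; omega)
        (by omega) (fun i => by have := hr i; omega)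
      refine ⟨_, hR.comp hG, fun s hs s' => ?_⟩
      have hclean : ∀ y : ℕ → ℕ, ∀ j, N + n ≤ j →
          (s + ∑ i ∈ Finset.range k, single (N + i) (y i)) j = 0 := fun y j hj => by
        rw [Finsupp.add_apply, hs j (by omega), sum_single_apply_of_lt _ (by omega)]
      have hin : ∀ (y : ℕ → ℕ) i, (s + ∑ i ∈ Finset.range k, single (N + i) (y i)) (r i) =
          s (r i) := fun y i => by
        rw [Finsupp.add_apply, sum_single_apply_of_lt _ (Or.inl (hr i)), add_zero]
      constructor
      · rintro ⟨u, hu, hu'⟩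
        obtain ⟨y, hy, rfl⟩ := (hRr s hs u).1 hu
        obtain ⟨z, hz, rfl⟩ := (hGr _ (hclean y) s').1 hu'
        simp only [hin] at hz
        refine ⟨Function.update y k z, fun i hi => ?_, ?_⟩
        · obtain hi | hi := (Nat.lt_succ_iff_lt_or_eq.1 hi)
          · rw [Function.update_of_ne hi.ne]
            exact hy i hi
          · obtain rfl : i = ⟨k, hk⟩ := Fin.ext hi
            simpa using hz
        · rw [Finset.sum_range_succ, ← add_assoc, Function.update_self]
          congr 2
          refine Finset.sum_congr rfl fun i hi => ?_
          rw [Function.update_of_ne (Finset.mem_range.1 hi).ne]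
      · rintro ⟨y, hy, rfl⟩
        refine ⟨_, (hRr s hs _).2 ⟨y, fun i hi => hy i (by omega), rfl⟩,
          (hGr _ (hclean y) _).2 ⟨y k, ?_, ?_⟩⟩
        · simp only [hin]
          exact hy ⟨k, hk⟩ (Nat.lt_succ_self k)
        · rw [Finset.sum_range_succ, ← add_assoc]
  obtain ⟨A, hA, hAr⟩ := hargs n le_rfl
  obtain ⟨F, hF, hFr⟩ := hf (fun i => N + i) o (N + n) (fun i => by omega) (by omega)
    (fun i => by omega)
  obtain ⟨C, hC, hCr⟩ := exists_clear_range N n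
  refine ⟨_, hA.comp (hF.comp hC), fun s hs s' => ?_⟩
  have hclean : ∀ y : ℕ → ℕ, ∀ j, N + n ≤ j →
      (s + ∑ i ∈ Finset.range n, single (N + i) (y i)) j = 0 := fun y j hj => by
    rw [Finsupp.add_apply, hs j (by omega), sum_single_apply_of_lt _ (by omega)]
  have hin : ∀ (y : ℕ → ℕ) (i : Fin n),
      (s + ∑ i ∈ Finset.range n, single (N + i) (y i)) (N + i) = y i := fun y i => by
    rw [Finsupp.add_apply, hs _ (by omega), zero_add, Finsupp.finsetSum_apply,
      Finset.sum_eq_single (i : ℕ)]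
    · simp
    · intro b _ hb
      exact single_eq_of_ne (by omega)
    · intro h
      exact absurd (Finset.mem_range.2 i.2) h
  have hclear : ∀ (y : ℕ → ℕ) z, Runs C
      (s + ∑ i ∈ Finset.range n, single (N + i) (y i) + single o z) (s + single o z) := by
    intro y z
    rw [add_right_comm]
    refine hCr _ _ fun j hj => ?_
    rw [Finsupp.add_apply, hs j hj, single_eq_of_ne (by omega), add_zero]
  have hmem : ∀ v z, z ∈ ((List.Vector.mOfFn fun i => g i v) >>= f) ↔
      ∃ w : List.Vector ℕ n, (∀ i, w.get i ∈ g i v) ∧ z ∈ f w := fun v z =>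
    Part.mem_bind_iff.trans (exists_congr fun w => and_congr_left' (mem_mOfFn _ w))
  constructor
  · rintro ⟨u, hu, v, hv, hv'⟩
    obtain ⟨y, hy, rfl⟩ := (hAr s hs u).1 hu
    obtain ⟨z, hz, rfl⟩ := (hFr _ (hclean y) v).1 hv
    simp only [hin] at hz
    exact ⟨z, (hmem _ _).2 ⟨_, fun i => by simpa using hy i i.2, hz⟩, (hclear y z s').1 hv'⟩
  · rintro ⟨z, h, rfl⟩
    obtain ⟨w, hw, hz⟩ := (hmem _ _).1 h
    let y : ℕ → ℕ := fun i => if h : i < n then w.get ⟨i, h⟩ else 0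
    have hy : ∀ i : Fin n, y i = w.get i := fun i => by simp [y]
    refine ⟨_, (hAr s hs _).2 ⟨y, fun i _ => ?_, rfl⟩, _, (hFr _ (hclean y) _).2 ⟨z, ?_, rfl⟩,
      (hclear y z _).2 rfl⟩
    · rw [hy]
      exact hw i
    · simp only [hin, hy]
      simpa using hz

end IsProgram

namespace IsProgram

open Finsupp Relation

theorem Realizes.prec {n : ℕ} {f : List.Vector ℕ n → ℕ} {g : List.Vector ℕ (n + 2) → ℕ}
    (hf : Realizes fun v => Part.some (f v)) (hg : Realizes fun v => Part.some (g v)) :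
    Realizes fun v : List.Vector ℕ (n + 1) =>
      Part.some (v.head.rec (f v.tail) fun y IH => g (y ::ᵥ IH ::ᵥ v.tail)) := by
  intro r o N hr ho hro
  have hr' : ∀ i : Fin n, r i.succ < N := fun i => hr _
  obtain ⟨P₁, hP₁, h₁⟩ := exists_copy (i := r 0) (o := N) (m := N + 1) (hr 0).ne
    (by have := hr 0; omega) (by omega)
  obtain ⟨P₂, hP₂, h₂⟩ := hf (fun i => r i.succ) (N + 2) (N + 4) (fun i => by have := hr' i; omega)
    (by omega) (fun i => by have := hr' i; omega)
  obtain ⟨G, hG, hGr⟩ := hg (Fin.cons (N + 1) (Fin.cons (N + 2) fun i => r i.succ)) (N + 3) (N + 4)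
    (by
      refine Fin.cases ?_ (Fin.cases ?_ fun i => ?_)
      · simp
      · simp
      · have := hr' i
        simp only [Fin.cons_succ]
        omega) (by omega)
    (by
      refine Fin.cases ?_ (Fin.cases ?_ fun i => ?_)
      · simp
      · simp
      · have := hr' i
        simp only [Fin.cons_succ]
        omega)
  obtain ⟨C₁, hC₁, hc₁⟩ := exists_clear (N + 2)
  obtain ⟨M₁, hM₁, hm₁⟩ := exists_move (i := N + 3) (o := N + 2) (by omega)
  obtain ⟨M₂, hM₂, hm₂⟩ := exists_move (i := N + 2) (o := o) (by omega)
  obtain ⟨C₂, hC₂, hc₂⟩ := exists_clear (N + 1)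
  refine ⟨_, hP₁.comp (hP₂.comp (((hG.comp (hC₁.comp (hM₁.comp (inc (N + 1))))).loop (i := N)).comp
    (hM₂.comp hC₂))), fun s hs => ?_⟩
  set v := List.Vector.ofFn fun i => s (r i) with hv
  have hhead : v.head = s (r 0) := by simp [hv, List.Vector.ofFn]
  have htail : v.tail = List.Vector.ofFn fun i => s (r i.succ) := by simp [hv, List.Vector.ofFn]
  let φ : ℕ → ℕ := fun k => k.rec (f v.tail) fun y IH => g (y ::ᵥ IH ::ᵥ v.tail)
  have hφ₀ : φ 0 = f v.tail := rfl
  have hφ : ∀ j, φ (j + 1) = g (j ::ᵥ φ j ::ᵥ v.tail) := fun _ => rfl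
  have key : ∀ {R : (ℕ →₀ ℕ) → (ℕ →₀ ℕ) → Prop}, Runs R s (s + single o (φ (s (r 0)))) →
      ∀ s', R s s' ↔ ∃ y ∈ (fun v : List.Vector ℕ (n + 1) => Part.some
        (v.head.rec (f v.tail) fun y IH => g (y ::ᵥ IH ::ᵥ v.tail) : ℕ)) v,
          s' = s + single o y := fun H s' => by
    rw [H s']
    simp [φ, hhead]
  refine key ?_
  refine (h₁ s (hs _ (by omega))).comp ?_
  have e₂ : Runs P₂ (s + single N (s (r 0))) (s + single N (s (r 0)) + single (N + 2) (φ 0)) := by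
    intro s'
    rw [h₂ _ fun j hj => ?_]
    · have : ∀ i : Fin n, (s + single N (s (r 0))) (r i.succ) = s (r i.succ) := fun i => by
        rw [Finsupp.add_apply, single_eq_of_ne (hr' i).ne, add_zero]
      simp only [this, ← htail, Part.mem_some_iff, exists_eq_left, hφ₀]
    · rw [Finsupp.add_apply, hs j (by omega), single_eq_of_ne (by omega), add_zero]
  refine e₂.comp ?_
  let st : ℕ → ℕ →₀ ℕ := fun j => s + single (N + 1) j + single (N + 2) (φ j)
  have hst : ∀ j i, i < N → st j i = s i := fun j i hi => by
    simp only [st, Finsupp.add_apply]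
    rw [single_eq_of_ne (by omega), single_eq_of_ne (by omega), add_zero, add_zero]
  have eG : ∀ j k, Runs G (st j + single N k) (st j + single N k + single (N + 3) (φ (j + 1))) := by
    intro j k s'
    rw [hGr _ fun i hi => ?_]
    · have h₀ : (st j + single N k) (N + 1) = j := by simp [st, hs]
      have h₁ : (st j + single N k) (N + 2) = φ j := by simp [st, hs]
      have h₂ : ∀ i, (st j + single N k) (r (Fin.succ i)) = s (r (Fin.succ i)) := fun i => by
        rw [Finsupp.add_apply, hst _ _ (hr' i), single_eq_of_ne (hr' i).ne, add_zero]
      have : List.Vector.ofFn (fun i => (st j + single N k)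
          ((Fin.cons (N + 1) (Fin.cons (N + 2) fun i => r i.succ) : Fin (n + 2) → ℕ) i)) =
          j ::ᵥ φ j ::ᵥ v.tail := by
        rw [htail]
        simp [List.Vector.ofFn, h₀, h₁, h₂, -Finsupp.coe_add]
      simp only [this, hφ, Part.mem_some_iff, exists_eq_left]
    · simp only [st, Finsupp.add_apply, hs i (by omega), single_eq_of_ne (show i ≠ N by omega),
        single_eq_of_ne (show i ≠ N + 1 by omega), single_eq_of_ne (show i ≠ N + 2 by omega),
        add_zero]
  have eB : ∀ j k, Runs (Comp G (Comp C₁ (Comp M₁ fun s s' => s' = s + single (N + 1) 1)))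
      (st j + single N k) (st (j + 1) + single N k) := by
    intro j k
    refine (eG j k).comp ?_
    have e₁ := hc₁ (s + single (N + 1) j + single N k + single (N + 3) (φ (j + 1))) (φ j)
      (by simp [hs])
    have e₂ := hm₁ (s + single (N + 1) j + single N k) (φ (j + 1)) (by simp [hs])
    have e₃ := e₁.comp (e₂.comp (runs_inc (N + 1) _))
    have h : st j + single N k + single (N + 3) (φ (j + 1)) = s + single (N + 1) j + single N k +
        single (N + 3) (φ (j + 1)) + single (N + 2) (φ j) := by
      simp only [st]
      abel
    have h' : st (j + 1) + single N k = s + single (N + 1) j + single N k +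
        single (N + 2) (φ (j + 1)) + single (N + 1) 1 := by
      simp only [st, single_add]
      abel
    rw [h, h']
    exact e₃
  have eL : ∀ k j, Runs (Loop N (Comp G (Comp C₁ (Comp M₁ fun s s' => s' = s + single (N + 1) 1))))
      (st j + single N k) (st (j + k)) := by
    intro k
    induction k with
    | zero =>
      intro j
      simpa using loop_zero (i := N) (s := st j) (by simp [st, hs])
    | succ k ih =>
      intro j s'
      rw [single_add, ← add_assoc, loop_succ (eB j k), ih (j + 1) s', Nat.add_right_comm,
        Nat.add_assoc]
  have h0 : s + single N (s (r 0)) + single (N + 2) (φ 0) = st 0 + single N (s (r 0)) := by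
    simp only [st, single_zero, add_zero, add_right_comm]
  rw [h0]
  refine (eL (s (r 0)) 0).comp ?_
  rw [Nat.zero_add]
  refine (hm₂ _ _ (by simp [hs])).comp ?_
  rw [add_right_comm]
  exact hc₂ _ _ (by simp [hs, single_eq_of_ne (show N + 1 ≠ o by omega)])


end IsProgram

namespace IsProgram

open Finsupp Relation

theorem Realizes.rfind {n : ℕ} {f : List.Vector ℕ (n + 1) → ℕ}
    (hf : Realizes fun v => Part.some (f v)) :
    Realizes fun v : List.Vector ℕ n => Nat.rfind fun k => Part.some (f (k ::ᵥ v) = 0) := by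
  intro r o N hr ho hro
  obtain ⟨F, hF, hFr⟩ := hf (Fin.cons N r) (N + 1) (N + 2)
    (by
      refine Fin.cases ?_ fun i => ?_
      · simp
      · have := hr i
        simp only [Fin.cons_succ]
        omega) (by omega)
    (by
      refine Fin.cases ?_ fun i => ?_
      · simp
      · have := hr i
        simp only [Fin.cons_succ]
        omega)
  obtain ⟨C, hC, hCr⟩ := exists_clear (N + 1)
  obtain ⟨M, hM, hMr⟩ := exists_move (i := N) (o := o) (by omega)
  refine ⟨_, hF.comp (((hC.comp ((inc N).comp hF)).loop (i := N + 1)).comp hM), fun s hs => ?_⟩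
  set v := List.Vector.ofFn fun i => s (r i) with hv
  have eF : ∀ k, Runs F (s + single N k) (s + single N k + single (N + 1) (f (k ::ᵥ v))) := by
    intro k s'
    rw [hFr _ fun j hj => ?_]
    · have h₀ : (s + single N k) N = k := by simp [hs]
      have h₁ : ∀ i, (s + single N k) (r i) = s (r i) := fun i => by
        rw [Finsupp.add_apply, single_eq_of_ne (hr i).ne, add_zero]
      have : List.Vector.ofFn (fun i => (s + single N k) ((Fin.cons N r : Fin (n + 1) → ℕ) i)) =
          k ::ᵥ v := by
        simp [hv, List.Vector.ofFn, h₀, h₁, -Finsupp.coe_add]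
      simp only [this, Part.mem_some_iff, exists_eq_left]
    · rw [Finsupp.add_apply, hs j (by omega), single_eq_of_ne (by omega), add_zero]
  let B := Comp C (Comp (fun s s' => s' = s + single N 1) F)
  let st : ℕ → ℕ →₀ ℕ := fun k => s + single N k + single (N + 1) (f (k ::ᵥ v))
  have hst : ∀ k, st k (N + 1) = f (k ::ᵥ v) := fun k => by simp [st, hs]
  have eB : ∀ k m, Runs B (s + single N k + single (N + 1) m) (st (k + 1)) := by
    intro k m
    refine (hCr _ m (by simp [hs])).comp ((runs_inc N _).comp ?_)
    rw [add_assoc s, ← single_add]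
    exact eF (k + 1)
  have eloop : ∀ k, f (k ::ᵥ v) ≠ 0 → ∀ s', Loop (N + 1) B (st k) s' ↔
      Loop (N + 1) B (st (k + 1)) s' := by
    intro k hk s'
    obtain ⟨m, hm⟩ := Nat.exists_eq_succ_of_ne_zero hk
    simp only [st]
    rw [hm, Nat.succ_eq_add_one, single_add, ← add_assoc]
    exact loop_succ (eB k m)
  have hreach : ∀ u, ReflTransGen (Comp (fun s s' => s = s' + single (N + 1) 1) B) (st 0) u →
      ∃ k, u = st k ∧ ∀ j < k, f (j ::ᵥ v) ≠ 0 := by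
    intro u hu
    induction hu with
    | refl => exact ⟨0, rfl, fun j hj => absurd hj (Nat.not_lt_zero j)⟩
    | tail _ hstep ih =>
      obtain ⟨k, rfl, hk⟩ := ih
      obtain ⟨w, hw, hw'⟩ := hstep
      have hne : f (k ::ᵥ v) ≠ 0 := by
        rw [← hst, hw]
        simp
      obtain ⟨m, hm⟩ := Nat.exists_eq_succ_of_ne_zero hne
      have : w = s + single N k + single (N + 1) m := by
        refine add_right_cancel (b := single (N + 1) 1) ?_
        rw [← hw, add_assoc, ← single_add, ← Nat.succ_eq_add_one m, ← hm]
      refine ⟨k + 1, (eB k m _).1 (this ▸ hw'), fun j hj => ?_⟩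
      obtain hj | rfl := Nat.lt_succ_iff_lt_or_eq.1 hj
      · exact hk j hj
      · exact hne
  have hloop : ∀ s', Loop (N + 1) B (st 0) s' ↔
      ∃ k, (f (k ::ᵥ v) = 0 ∧ ∀ j < k, f (j ::ᵥ v) ≠ 0) ∧ s' = s + single N k := by
    intro s'
    constructor
    · rintro ⟨_, hu, rfl, h⟩
      obtain ⟨k, rfl, hk⟩ := hreach _ hu
      rw [hst] at h
      exact ⟨k, ⟨h, hk⟩, by simp [st, h]⟩
    · rintro ⟨k, ⟨h, hk⟩, rfl⟩
      have : ∀ i ≤ k, Loop (N + 1) B (st 0) (s + single N k) ↔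
          Loop (N + 1) B (st i) (s + single N k) := by
        intro i
        induction i with
        | zero => simp
        | succ i ih => exact fun hi => (ih (by omega)).trans (eloop i (hk i hi) _)
      rw [this k le_rfl, loop_zero (by rw [hst, h])]
      simp [st, h]
  have hmem : ∀ k, (k ∈ Nat.rfind fun k => Part.some (decide (f (k ::ᵥ v) = 0))) ↔
      f (k ::ᵥ v) = 0 ∧ ∀ j < k, f (j ::ᵥ v) ≠ 0 := fun k => by
    refine Nat.mem_rfind.trans ?_
    simp
  have hstart := eF 0
  rw [single_zero, add_zero] at hstart
  intro s'
  rw [hstart.comp_iff]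
  have h0 : s + single (N + 1) (f (0 ::ᵥ v)) = st 0 := by simp [st]
  rw [h0]
  constructor
  · rintro ⟨u, hu, hu'⟩
    obtain ⟨k, hk, rfl⟩ := (hloop u).1 hu
    exact ⟨k, (hmem k).2 hk, (hMr s k (hs N le_rfl) s').1 hu'⟩
  · rintro ⟨k, hk, rfl⟩
    exact ⟨_, (hloop _).2 ⟨k, (hmem k).1 hk, rfl⟩, (hMr s k (hs N le_rfl) _).2 rfl⟩

theorem realizes_of_primrec' {n : ℕ} {f : List.Vector ℕ n → ℕ} (hf : Nat.Primrec' f) :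
    Realizes fun v => Part.some (f v) := by
  induction hf with
  | zero => exact realizes_zero
  | succ => exact realizes_succ
  | get i => exact realizes_get i
  | comp g _ _ ihf ihg =>
    have := Realizes.comp ihf ihg
    simpa [Part.bind_eq_bind] using this
  | prec _ _ ihf ihg => exact Realizes.prec ihf ihg

theorem realizes_of_partrec' {n : ℕ} {f : List.Vector ℕ n →. ℕ} (hf : Nat.Partrec' f) :
    Realizes f := by
  induction hf with
  | prim h => exact realizes_of_primrec' h
  | comp g _ _ ihf ihg => exact Realizes.comp ihf ihg
  | rfind _ ih => exact Realizes.rfind ih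

/-- Some counter program has an undecidable halting problem. -/
theorem exists_not_computablePred : ∃ R, IsProgram R ∧
    ¬ ComputablePred fun m : ℕ => ∃ s', R (single 0 m) s' := by
  have hpart : Nat.Partrec' (n := 1) fun v =>
      (Nat.Partrec.Code.eval (Denumerable.ofNat Nat.Partrec.Code v.head) 0) := by
    refine Nat.Partrec'.part_iff₁ (f := fun m =>
      Nat.Partrec.Code.eval (Denumerable.ofNat Nat.Partrec.Code m) 0) |>.2 ?_
    exact Nat.Partrec.Code.eval_part.comp (Computable.ofNat _) (Computable.const 0)
  obtain ⟨R, hR, hRr⟩ := realizes_of_partrec' hpart (fun _ => 0) 1 2 (by simp) (by simp) (by simp)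
  refine ⟨R, hR, fun h => ComputablePred.halting_problem 0 ?_⟩
  refine ComputablePred.computable_of_manyOneReducible ?_ h
  refine ⟨Encodable.encode, Computable.encode, fun c => ?_⟩
  have : ∀ s', R (single 0 (Encodable.encode c)) s' ↔ _ := hRr (single 0 (Encodable.encode c))
    fun j hj => single_eq_of_ne (by omega)
  simp only [this]
  simp [Part.dom_iff_mem]

end IsProgram

section RationalSubset

open scoped Computability Pointwise

variable {α M : Type*} [Monoid M] {f : FreeMonoid α →* M} {X Y : Set M}

/-- The images of regular languages under a homomorphism from a free monoid. -/
def IsRationalImage (f : FreeMonoid α →* M) (X : Set M) : Prop :=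
  ∃ L : Language α, L.IsRegular ∧ X = (fun w => f (FreeMonoid.ofList w)) '' L

namespace IsRationalImage

theorem singleton (w : List α) : IsRationalImage f {f (FreeMonoid.ofList w)} :=
  ⟨_, Language.isRegular_singleton w, (Set.image_singleton).symm⟩

theorem one : IsRationalImage f {1} := by
  simpa using singleton (f := f) []

theorem empty : IsRationalImage f ∅ :=
  ⟨0, Language.isRegular_zero, (Set.image_empty _).symm⟩

theorem union (hX : IsRationalImage f X) (hY : IsRationalImage f Y) :
    IsRationalImage f (X ∪ Y) := by
  obtain ⟨L, hL, rfl⟩ := hX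
  obtain ⟨L', hL', rfl⟩ := hY
  exact ⟨L + L', hL.add hL', (Set.image_union _ _ _).symm⟩

theorem mul (hX : IsRationalImage f X) (hY : IsRationalImage f Y) : IsRationalImage f (X * Y) := by
  obtain ⟨L, hL, rfl⟩ := hX
  obtain ⟨L', hL', rfl⟩ := hY
  refine ⟨L * L', hL.mul hL', ?_⟩
  ext g
  constructor
  · rintro ⟨_, ⟨u, hu, rfl⟩, _, ⟨v, hv, rfl⟩, rfl⟩
    exact ⟨u ++ v, Language.append_mem_mul hu hv, by simp [FreeMonoid.ofList_append]⟩
  · rintro ⟨_, h, rfl⟩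
    obtain ⟨u, hu, v, hv, rfl⟩ := Language.mem_mul.1 h
    exact ⟨_, ⟨u, hu, rfl⟩, _, ⟨v, hv, rfl⟩, by simp [FreeMonoid.ofList_append]⟩

theorem closure (hX : IsRationalImage f X) :
    IsRationalImage f (Submonoid.closure X : Set M) := by
  obtain ⟨L, hL, rfl⟩ := hX
  refine ⟨L∗, hL.kstar, ?_⟩
  ext g
  constructor
  · intro h
    induction h using Submonoid.closure_induction with
    | mem x hx =>
      obtain ⟨w, hw, rfl⟩ := hx
      exact ⟨w, le_kstar (a := L) hw, rfl⟩
    | one => exact ⟨[], Language.nil_mem_kstar L, map_one f⟩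
    | mul x y _ _ hx hy =>
      obtain ⟨u, hu, rfl⟩ := hx
      obtain ⟨v, hv, rfl⟩ := hy
      exact ⟨u ++ v, (kstar_mul_kstar L).le (Language.append_mem_mul hu hv),
        by simp [FreeMonoid.ofList_append]⟩
  · rintro ⟨_, h, rfl⟩
    obtain ⟨l, rfl, hl⟩ := Language.mem_kstar.1 h
    clear h
    induction l with
    | nil => simp
    | cons w l ih =>
      simp only [List.flatten_cons, FreeMonoid.ofList_append, map_mul]
      exact mul_mem (Submonoid.subset_closure ⟨w, hl w (by simp), rfl⟩)
        (ih fun y hy => hl y (by simp [hy]))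

theorem singleton_mul {g h : M} (hg : IsRationalImage f {g}) (hh : IsRationalImage f {h}) :
    IsRationalImage f {g * h} := by
  rw [← Set.singleton_mul_singleton]
  exact hg.mul hh

theorem singleton_pow {g : M} (hg : IsRationalImage f {g}) (n : ℕ) :
    IsRationalImage f {g ^ n} := by
  induction n with
  | zero => simpa using one
  | succ n ih =>
    rw [pow_succ]
    exact ih.singleton_mul hg

theorem powers {g : M} (hg : IsRationalImage f {g}) :
    IsRationalImage f (Submonoid.powers g : Set M) := by
  rw [Submonoid.powers_eq_closure]
  exact hg.closure

theorem of_finite (hX : X.Finite) (h : ∀ g ∈ X, IsRationalImage f {g}) : IsRationalImage f X := by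
  induction X, hX using Set.Finite.induction_on with
  | empty => exact empty
  | @insert a s _ _ ih =>
    rw [Set.insert_eq]
    exact (h a (by simp)).union (ih fun g hg => h g (by simp [hg]))

end IsRationalImage

end RationalSubset

section FreeGroup

theorem FreeGroup.mk_map_true_injective {α : Type*} {u v : List α}
    (h : FreeGroup.mk (u.map fun x => (x, true)) = FreeGroup.mk (v.map fun x => (x, true))) :
    u = v := by
  classical
  have hred : ∀ w : List α, FreeGroup.reduce (w.map fun x => (x, true)) =
      w.map fun x => (x, true) := fun w => by
    refine FreeGroup.IsReduced.reduce_eq ?_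
    refine List.Pairwise.isChain (List.pairwise_of_forall_mem_list ?_)
    simp
  have := congrArg FreeGroup.toWord h
  rw [FreeGroup.toWord_mk, FreeGroup.toWord_mk, hred, hred] at this
  exact List.map_injective_iff.2 (fun _ _ h => (Prod.ext_iff.1 h).1) this

theorem List.flatMap_replicate_append_injective {ks ks' : List ℕ}
    (h : (ks.flatMap fun k => List.replicate k true ++ [false]) =
      ks'.flatMap fun k => List.replicate k true ++ [false]) : ks = ks' := by
  have key : ∀ (k k' : ℕ) (u v : List Bool),
      List.replicate k true ++ false :: u = List.replicate k' true ++ false :: v →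
        k = k' ∧ u = v := by
    intro k
    induction k with
    | zero =>
      intro k' u v h
      cases k' <;> simp_all [List.replicate_succ]
    | succ k ih =>
      intro k' u v h
      cases k' with
      | zero => simp [List.replicate_succ] at h
      | succ k' =>
        rw [List.replicate_succ, List.replicate_succ] at h
        obtain ⟨rfl, rfl⟩ := ih k' u v (List.cons.inj h).2
        exact ⟨rfl, rfl⟩
  induction ks generalizing ks' with
  | nil => cases ks' <;> simp_all
  | cons k ks ih =>
    cases ks' with
    | nil => simp at h
    | cons k' ks' =>
      simp only [List.flatMap_cons, List.append_assoc, List.singleton_append] at h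
      obtain ⟨rfl, h'⟩ := key _ _ _ _ h
      rw [ih h']

theorem FreeGroup.prod_pow_mul_injective {ks ks' : List ℕ}
    (h : (ks.map fun k => FreeGroup.of true ^ k * FreeGroup.of false).prod =
      (ks'.map fun k => FreeGroup.of true ^ k * FreeGroup.of false).prod) : ks = ks' := by
  have key : ∀ ks : List ℕ, (ks.map fun k => FreeGroup.of true ^ k * FreeGroup.of false).prod =
      FreeGroup.mk ((ks.flatMap fun k => List.replicate k true ++ [false]).map
        fun x => (x, true)) := by
    intro ks
    induction ks with
    | nil => rfl
    | cons k ks ih =>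
      rw [List.map_cons, List.prod_cons, ih, List.flatMap_cons, List.map_append,
        ← FreeGroup.mul_mk, List.map_append, ← FreeGroup.mul_mk]
      congr 2
      induction k with
      | zero => rfl
      | succ k ih =>
        rw [pow_succ', ih, List.replicate_succ, List.map_cons]
        rfl
  rw [key, key] at h
  exact List.flatMap_replicate_append_injective (FreeGroup.mk_map_true_injective h)

end FreeGroup

section RegisterCode

open Finsupp Relation

/-- The Gödel number of the contents of the registers. -/
noncomputable def registerCode (s : ℕ →₀ ℕ) : ℕ := s.prod fun i k => Nat.nth Nat.Prime i ^ k

theorem registerCode_single (i m : ℕ) : registerCode (single i m) = Nat.nth Nat.Prime i ^ m :=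
  prod_single_index (pow_zero _)

theorem registerCode_add (s t : ℕ →₀ ℕ) :
    registerCode (s + t) = registerCode s * registerCode t :=
  prod_add_index' (fun _ => pow_zero _) fun _ _ _ => pow_add _ _ _

theorem registerCode_add_single (s : ℕ →₀ ℕ) (i : ℕ) :
    registerCode (s + single i 1) = Nat.nth Nat.Prime i * registerCode s := by
  rw [registerCode_add, registerCode_single, pow_one, mul_comm]

theorem nth_prime_dvd_registerCode {s : ℕ →₀ ℕ} {i : ℕ} :
    Nat.nth Nat.Prime i ∣ registerCode s ↔ s i ≠ 0 := by
  constructor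
  · intro h
    obtain ⟨j, hj, hdvd⟩ := (Nat.prime_nth_prime i).prime.exists_mem_finset_dvd h
    have := (Nat.prime_dvd_prime_iff_eq (Nat.prime_nth_prime i) (Nat.prime_nth_prime j)).1
      ((Nat.prime_nth_prime i).dvd_of_dvd_pow hdvd)
    rw [Nat.nth_injective Nat.infinite_setOfPred_prime this]
    exact mem_support_iff.1 hj
  · intro h
    rw [← single_add_erase i s, registerCode_add, registerCode_single]
    exact (dvd_pow_self _ h).mul_right _

/-- Relations on natural numbers given by nondeterministic programs with one register, which can be
multiplied by a constant, divided by a constant, and tested for nondivisibility. -/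
inductive IsFactorProgram : (ℕ → ℕ → Prop) → Prop
  | skip : IsFactorProgram fun x y => x = y
  | mul (p : ℕ) : IsFactorProgram fun x y => y = p * x
  | div (p : ℕ) : IsFactorProgram fun x y => x = p * y
  | test (p : ℕ) : 0 < p → IsFactorProgram fun x y => y = x ∧ ¬ p ∣ x
  | comp {R R'} : IsFactorProgram R → IsFactorProgram R' → IsFactorProgram (Relation.Comp R R')
  | star {R} : IsFactorProgram R → IsFactorProgram (Relation.ReflTransGen R)

theorem IsProgram.exists_isFactorProgram {R : (ℕ →₀ ℕ) → (ℕ →₀ ℕ) → Prop} (hR : IsProgram R) :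
    ∃ Q, IsFactorProgram Q ∧
      ∀ s y, Q (registerCode s) y ↔ ∃ s', y = registerCode s' ∧ R s s' := by
  induction hR with
  | skip => exact ⟨_, .skip, fun s y => by simp [eq_comm]⟩
  | inc i =>
    refine ⟨_, .mul (Nat.nth Nat.Prime i), fun s y => ?_⟩
    simp [registerCode_add_single]
  | dec i =>
    refine ⟨_, .div (Nat.nth Nat.Prime i), fun s y => ?_⟩
    constructor
    · intro h
      have hi : s i ≠ 0 := nth_prime_dvd_registerCode.1 ⟨y, h⟩
      have hs : s = s - single i 1 + single i 1 := by
        rw [tsub_add_cancel_of_le]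
        simpa [single_le_iff] using Nat.one_le_iff_ne_zero.2 hi
      refine ⟨_, ?_, hs⟩
      rw [hs, registerCode_add_single] at h
      exact (mul_left_cancel₀ (Nat.prime_nth_prime i).ne_zero h).symm
    · rintro ⟨s', rfl, rfl⟩
      exact registerCode_add_single s' i
  | test i =>
    refine ⟨_, .test (Nat.nth Nat.Prime i) (Nat.prime_nth_prime i).pos, fun s y => ?_⟩
    rw [nth_prime_dvd_registerCode, not_not]
    constructor
    · rintro ⟨rfl, h⟩
      exact ⟨s, rfl, rfl, h⟩
    · rintro ⟨_, rfl, rfl, h⟩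
      exact ⟨rfl, h⟩
  | comp _ _ ih ih' =>
    obtain ⟨Q, hQ, h⟩ := ih
    obtain ⟨Q', hQ', h'⟩ := ih'
    refine ⟨_, hQ.comp hQ', fun s y => ?_⟩
    constructor
    · rintro ⟨z, hz, hz'⟩
      obtain ⟨t, rfl, ht⟩ := (h s z).1 hz
      obtain ⟨u, rfl, hu⟩ := (h' t y).1 hz'
      exact ⟨u, rfl, t, ht, hu⟩
    · rintro ⟨u, rfl, t, ht, hu⟩
      exact ⟨_, (h s _).2 ⟨t, rfl, ht⟩, (h' t _).2 ⟨u, rfl, hu⟩⟩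
  | star _ ih =>
    obtain ⟨Q, hQ, h⟩ := ih
    refine ⟨_, hQ.star, fun s y => ?_⟩
    constructor
    · intro hy
      induction hy with
      | refl => exact ⟨s, rfl, .refl⟩
      | tail _ hstep ih =>
        obtain ⟨t, rfl, ht⟩ := ih
        obtain ⟨u, rfl, hu⟩ := (h t _).1 hstep
        exact ⟨u, rfl, ht.tail hu⟩
    · rintro ⟨u, rfl, hu⟩
      induction hu with
      | refl => exact .refl
      | @tail t u _ hstep ih => exact ih.tail ((h t _).2 ⟨u, rfl, hstep⟩)

end RegisterCode

section Encoding

open scoped Pointwise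
open Relation

variable {G : Type*} [Group G] {a b c d : G} {α : Type*} {f : FreeMonoid α →* G}

/-- `IsTrace x l y` says that the pairs in `l` are consecutive steps leading from `x` to `y`. -/
def IsTrace (x : ℕ) : List (ℕ × ℕ) → ℕ → Prop
  | [], y => x = y
  | p :: l, y => x = p.1 ∧ IsTrace p.2 l y

theorem IsTrace.append {x y z : ℕ} {l l' : List (ℕ × ℕ)} (h : IsTrace x l y)
    (h' : IsTrace y l' z) : IsTrace x (l ++ l') z := by
  induction l generalizing x with
  | nil => exact (show x = y from h) ▸ h'
  | cons p l ih => exact ⟨h.1, ih h.2⟩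

theorem IsTrace.exists_of_append {x z : ℕ} {l l' : List (ℕ × ℕ)} (h : IsTrace x (l ++ l') z) :
    ∃ y, IsTrace x l y ∧ IsTrace y l' z := by
  induction l generalizing x with
  | nil => exact ⟨x, rfl, h⟩
  | cons p l ih =>
    obtain ⟨y, hy, hy'⟩ := ih h.2
    exact ⟨y, ⟨h.1, hy⟩, hy'⟩

theorem isTrace_of_map_eq {x y : ℕ} {l : List (ℕ × ℕ)}
    (h : l.map Prod.fst ++ [y] = x :: l.map Prod.snd) : IsTrace x l y := by
  induction l generalizing x with
  | nil => simpa [IsTrace, eq_comm] using h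
  | cons p l ih =>
    simp only [List.map_cons, List.cons_append, List.cons.injEq] at h
    exact ⟨h.1.symm, ih h.2⟩

/-- The group element recording a list of computation steps. -/
def traceValue (a b c d : G) (l : List (ℕ × ℕ)) : G :=
  (l.map fun p => b ^ p.1 * c ^ p.2 * (d * a)).prod

theorem traceValue_append (l l' : List (ℕ × ℕ)) :
    traceValue a b c d (l ++ l') = traceValue a b c d l * traceValue a b c d l' := by
  simp [traceValue]

/-- The set `X` consists of values of traces and represents the relation `R`. -/
def RepresentsRel (a b c d : G) (R : ℕ → ℕ → Prop) (X : Set G) : Prop :=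
  (∀ g ∈ X, ∃ l, g = traceValue a b c d l ∧ ∀ x y, IsTrace x l y → R x y) ∧
    ∀ x y, R x y → ∃ l, traceValue a b c d l ∈ X ∧ IsTrace x l y

theorem representsRel_of_single {R : ℕ → ℕ → Prop} {X : Set G}
    (h : ∀ g, g ∈ X ↔ ∃ x y, R x y ∧ g = b ^ x * c ^ y * (d * a)) :
    RepresentsRel a b c d R X := by
  constructor
  · intro g hg
    obtain ⟨x, y, hxy, rfl⟩ := (h g).1 hg
    refine ⟨[(x, y)], by simp [traceValue], ?_⟩
    rintro x' y' ⟨rfl, rfl⟩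
    exact hxy
  · intro x y hxy
    exact ⟨[(x, y)], (h _).2 ⟨x, y, hxy, by simp [traceValue]⟩, rfl, rfl⟩

theorem RepresentsRel.comp {R R' : ℕ → ℕ → Prop} {X Y : Set G} (hX : RepresentsRel a b c d R X)
    (hY : RepresentsRel a b c d R' Y) : RepresentsRel a b c d (Comp R R') (X * Y) := by
  constructor
  · rintro _ ⟨g, hg, h, hh, rfl⟩
    obtain ⟨l, rfl, hl⟩ := hX.1 g hg
    obtain ⟨l', rfl, hl'⟩ := hY.1 h hh
    refine ⟨l ++ l', (traceValue_append l l').symm, fun x y hxy => ?_⟩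
    obtain ⟨z, hz, hz'⟩ := hxy.exists_of_append
    exact ⟨z, hl _ _ hz, hl' _ _ hz'⟩
  · rintro x y ⟨z, hz, hz'⟩
    obtain ⟨l, hl, hlt⟩ := hX.2 _ _ hz
    obtain ⟨l', hl', hlt'⟩ := hY.2 _ _ hz'
    exact ⟨l ++ l', (traceValue_append (a := a) (b := b) (c := c) (d := d) l l').symm ▸
      Set.mul_mem_mul hl hl', hlt.append hlt'⟩

theorem RepresentsRel.star {R : ℕ → ℕ → Prop} {X : Set G} (hX : RepresentsRel a b c d R X) :
    RepresentsRel a b c d (ReflTransGen R) (Submonoid.closure X : Set G) := by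
  constructor
  · intro g hg
    induction hg using Submonoid.closure_induction with
    | mem g hg =>
      obtain ⟨l, rfl, hl⟩ := hX.1 g hg
      exact ⟨l, rfl, fun x y hxy => .single (hl x y hxy)⟩
    | one => exact ⟨[], rfl, fun x y hxy => (show x = y from hxy) ▸ .refl⟩
    | mul g h _ _ ihg ihh =>
      obtain ⟨l, rfl, hl⟩ := ihg
      obtain ⟨l', rfl, hl'⟩ := ihh
      refine ⟨l ++ l', (traceValue_append l l').symm, fun x y hxy => ?_⟩
      obtain ⟨z, hz, hz'⟩ := hxy.exists_of_append
      exact (hl _ _ hz).trans (hl' _ _ hz')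
  · intro x y hxy
    induction hxy with
    | refl => exact ⟨[], one_mem (Submonoid.closure X), rfl⟩
    | tail _ hstep ih =>
      obtain ⟨l, hl, hlt⟩ := ih
      obtain ⟨l', hl', hlt'⟩ := hX.2 _ _ hstep
      refine ⟨l ++ l', ?_, hlt.append hlt'⟩
      rw [traceValue_append]
      exact mul_mem (SetLike.mem_coe.1 hl) (Submonoid.subset_closure hl')

theorem IsFactorProgram.exists_representsRel (hbc : Commute b c) (ha : IsRationalImage f {a})
    (hb : IsRationalImage f {b}) (hc : IsRationalImage f {c}) (hd : IsRationalImage f {d})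
    {R : ℕ → ℕ → Prop} (hR : IsFactorProgram R) :
    ∃ X, IsRationalImage f X ∧ RepresentsRel a b c d R X := by
  induction hR with
  | skip =>
    refine ⟨{1}, .one, ?_, ?_⟩
    · rintro _ rfl
      exact ⟨[], rfl, fun _ _ => id⟩
    · rintro x _ rfl
      exact ⟨[], rfl, rfl⟩
  | mul p =>
    refine ⟨_, (hb.singleton_mul (hc.singleton_pow p)).powers.mul (hd.singleton_mul ha),
      representsRel_of_single fun g => ?_⟩
    have key : ∀ k, (b * c ^ p) ^ k = b ^ k * c ^ (p * k) := fun k => by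
      rw [(hbc.pow_right p).mul_pow, ← pow_mul]
    constructor
    · rintro ⟨_, ⟨x, rfl⟩, _, rfl, rfl⟩
      exact ⟨x, _, rfl, by simp only [key]⟩
    · rintro ⟨x, _, rfl, rfl⟩
      exact ⟨_, ⟨x, rfl⟩, _, rfl, by simp only [key]⟩
  | div p =>
    refine ⟨_, ((hb.singleton_pow p).singleton_mul hc).powers.mul (hd.singleton_mul ha),
      representsRel_of_single fun g => ?_⟩
    have key : ∀ k, (b ^ p * c) ^ k = b ^ (p * k) * c ^ k := fun k => by
      rw [(hbc.pow_left p).mul_pow, ← pow_mul]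
    constructor
    · rintro ⟨_, ⟨y, rfl⟩, _, rfl, rfl⟩
      exact ⟨_, y, rfl, by simp only [key]⟩
    · rintro ⟨_, y, rfl, rfl⟩
      exact ⟨_, ⟨y, rfl⟩, _, rfl, by simp only [key]⟩
  | test p hp =>
    refine ⟨_, ((IsRationalImage.of_finite ((Finset.Ioo 0 p).finite_toSet.image
      fun r => b ^ r * c ^ r) ?_).mul ((hb.singleton_pow p).singleton_mul
        (hc.singleton_pow p)).powers).mul (hd.singleton_mul ha),
      representsRel_of_single fun g => ?_⟩
    · rintro _ ⟨r, -, rfl⟩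
      exact (hb.singleton_pow r).singleton_mul (hc.singleton_pow r)
    · have key : ∀ r q, b ^ r * c ^ r * (b ^ p * c ^ p) ^ q =
          b ^ (r + p * q) * c ^ (r + p * q) := by
        intro r q
        rw [(hbc.pow_pow p p).mul_pow, ← pow_mul, ← pow_mul, pow_add, pow_add,
          (hbc.pow_pow (p * q) r).symm.mul_mul_mul_comm]
      constructor
      · rintro ⟨_, ⟨_, ⟨r, hr, rfl⟩, _, ⟨q, rfl⟩, rfl⟩, _, rfl, rfl⟩
        rw [Finset.coe_Ioo, Set.mem_Ioo] at hr
        refine ⟨r + p * q, _, ⟨rfl, fun h => ?_⟩, by simp only [key]⟩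
        have := Nat.le_of_dvd hr.1 ((Nat.dvd_add_left (dvd_mul_right p q)).1 h)
        omega
      · rintro ⟨_, x, ⟨rfl, hx⟩, rfl⟩
        refine ⟨_, ⟨_, ⟨x % p, ?_, rfl⟩, _, ⟨x / p, rfl⟩, rfl⟩, _, rfl, ?_⟩
        · rw [Finset.coe_Ioo, Set.mem_Ioo]
          exact ⟨Nat.pos_of_ne_zero fun h => hx (Nat.dvd_of_mod_eq_zero h), Nat.mod_lt x hp⟩
        · simp only [key, Nat.mod_add_div]
  | comp _ _ ih ih' =>
    obtain ⟨X, hX, h⟩ := ih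
    obtain ⟨Y, hY, h'⟩ := ih'
    exact ⟨_, hX.mul hY, h.comp h'⟩
  | star _ ih =>
    obtain ⟨X, hX, h⟩ := ih
    exact ⟨_, hX.closure, h.star⟩

/-- The group element whose comparison with the value of a trace checks its consistency. -/
def checkValue (a b c d : G) (zs : List ℕ) : G := (zs.map fun z => c ^ z * b ^ z * a * d).prod

theorem IsTrace.traceValue_mul (hab : Commute a b) (hcd : Commute c d)
    {x y : ℕ} {l : List (ℕ × ℕ)} (h : IsTrace x l y) :
    traceValue a b c d l * b ^ y * d = b ^ x * d * checkValue a b c d (l.map Prod.snd) := by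
  induction l generalizing x with
  | nil =>
    obtain rfl : x = y := h
    simp [traceValue, checkValue]
  | cons p l ih =>
    obtain ⟨rfl, h⟩ := h
    have e := ih h
    obtain ⟨x, z⟩ := p
    simp only [traceValue, checkValue, List.map_cons, List.prod_cons] at e ⊢
    rw [mul_assoc, mul_assoc, ← mul_assoc (List.prod _), e]
    simp only [← mul_assoc]
    congr 2
    rw [mul_assoc (b ^ x), (hcd.pow_left z).eq, mul_assoc _ a, (hab.pow_right z).eq]
    simp only [← mul_assoc]

/-- The set of inverses of the elements `d * checkValue a b c d zs`. -/
theorem exists_isRationalImage_check (hbc : Commute b c) (ha : IsRationalImage f {a⁻¹})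
    (hb : IsRationalImage f {b⁻¹}) (hc : IsRationalImage f {c⁻¹}) (hd : IsRationalImage f {d⁻¹}) :
    ∃ Y, IsRationalImage f Y ∧ ∀ g, g ∈ Y ↔ ∃ zs, g = (d * checkValue a b c d zs)⁻¹ := by
  refine ⟨_, ((hd.singleton_mul ha).mul (hb.singleton_mul hc).powers).closure.mul hd, fun g => ?_⟩
  have key : ∀ z, d⁻¹ * a⁻¹ * (b⁻¹ * c⁻¹) ^ z = (c ^ z * b ^ z * a * d)⁻¹ := fun z => by
    rw [hbc.inv_inv.mul_pow]
    simp [mul_assoc]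
  constructor
  · rintro ⟨k, hk, _, rfl, rfl⟩
    suffices ∃ zs, k = (checkValue a b c d zs)⁻¹ by
      obtain ⟨zs, rfl⟩ := this
      exact ⟨zs, (mul_inv_rev _ _).symm⟩
    induction hk using Submonoid.closure_induction with
    | mem k hk =>
      obtain ⟨_, rfl, _, ⟨z, rfl⟩, rfl⟩ := hk
      exact ⟨[z], by simpa [checkValue] using key z⟩
    | one => exact ⟨[], by simp [checkValue]⟩
    | mul k k' _ _ ih ih' =>
      obtain ⟨zs, rfl⟩ := ih
      obtain ⟨zs', rfl⟩ := ih'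
      exact ⟨zs' ++ zs, by simp [checkValue]⟩
  · rintro ⟨zs, rfl⟩
    rw [mul_inv_rev]
    refine Set.mul_mem_mul (SetLike.mem_coe.2 ?_) rfl
    induction zs with
    | nil => simp [checkValue]
    | cons z zs ih =>
      rw [checkValue, List.map_cons, List.prod_cons, mul_inv_rev]
      refine mul_mem ih (Submonoid.subset_closure ?_)
      rw [← key]
      exact Set.mul_mem_mul rfl ⟨z, rfl⟩

end Encoding

section Undecidability

open scoped Pointwise
open Finsupp

theorem map_traceValue {G H : Type*} [Group G] [Group H] (φ : G →* H) (a b c d : G)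
    (l : List (ℕ × ℕ)) :
    φ (traceValue a b c d l) = traceValue (φ a) (φ b) (φ c) (φ d) l := by
  simp [traceValue, map_list_prod, Function.comp_def]

theorem map_checkValue {G H : Type*} [Group G] [Group H] (φ : G →* H) (a b c d : G)
    (zs : List ℕ) :
    φ (checkValue a b c d zs) = checkValue (φ a) (φ b) (φ c) (φ d) zs := by
  simp [checkValue, map_list_prod, Function.comp_def]

variable {S : Type} {I : S → S → Prop}

/-- The homomorphism to a free group of rank two given by two dependent generators. -/
theorem exists_hom_freeGroup (hsym : ∀ a b, I a b → I b a) {s t : S} (hst : ¬ I s t)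
    (hne : s ≠ t) :
    ∃ φ : GraphGroup I →* FreeGroup Bool, φ (PresentedGroup.of s) = FreeGroup.of true ∧
      φ (PresentedGroup.of t) = FreeGroup.of false ∧
      ∀ u, u ≠ s → u ≠ t → φ (PresentedGroup.of u) = 1 := by
  classical
  let φ : S → FreeGroup Bool := fun u =>
    if u = s then FreeGroup.of true else if u = t then FreeGroup.of false else 1
  refine ⟨GraphGroup.lift φ fun u v huv => ?_, ?_, ?_, fun u hu hu' => ?_⟩
  · by_cases h : u = s ∨ u = t
    · by_cases h' : v = s ∨ v = t
      · obtain rfl | rfl := h <;> obtain rfl | rfl := h'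
        · exact Commute.refl _
        · exact absurd huv hst
        · exact absurd (hsym _ _ huv) hst
        · exact Commute.refl _
      · rw [not_or] at h'
        simp [φ, h'.1, h'.2]
    · rw [not_or] at h
      simp [φ, h.1, h.2]
  · simp [GraphGroup.lift_of, φ]
  · simp [GraphGroup.lift_of, φ, hne.symm]
  · simp [GraphGroup.lift_of, φ, hu, hu']

theorem isTrace_of_traceValue_mul_eq (hirr : ∀ a, ¬ I a a) (hsym : ∀ a b, I a b → I b a)
    {a b c d : S} (hab : I a b) (hbc : I b c) (hcd : I c d) (hac : ¬ I a c) (hbd : ¬ I b d)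
    (hnac : a ≠ c) (hnbd : b ≠ d) {x y : ℕ} {l : List (ℕ × ℕ)} {zs : List ℕ}
    (h : traceValue (PresentedGroup.of (rels := GraphGroupRels I) a) (PresentedGroup.of b)
        (PresentedGroup.of c) (PresentedGroup.of d) l * PresentedGroup.of b ^ y *
        PresentedGroup.of d =
      PresentedGroup.of b ^ x * (PresentedGroup.of d * checkValue
        (PresentedGroup.of (rels := GraphGroupRels I) a) (PresentedGroup.of b)
        (PresentedGroup.of c) (PresentedGroup.of d) zs)) :
    IsTrace x l y := by
  have ne : ∀ {u v}, I u v → u ≠ v := fun h h' => hirr _ (h' ▸ h)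
  have hnad : a ≠ d := fun h => hbd (h ▸ hsym _ _ hab)
  obtain ⟨φ, hφb, hφd, hφ⟩ := exists_hom_freeGroup hsym hbd hnbd
  obtain ⟨ψ, hψc, hψa, hψ⟩ := exists_hom_freeGroup hsym (fun h => hac (hsym _ _ h)) hnac.symm
  have h₁ := congrArg φ h
  have h₂ := congrArg ψ h
  simp only [map_mul, map_pow, map_traceValue, map_checkValue, hφb, hφd,
    hφ a (ne hab) hnad, hφ c (ne hbc).symm (ne hcd)] at h₁
  simp only [map_mul, map_pow, map_traceValue, map_checkValue, hψc, hψa,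
    hψ b (ne hbc) (ne hab).symm, hψ d (ne hcd).symm hnad.symm] at h₂
  have e₁ : l.map Prod.fst ++ [y] = x :: zs := by
    apply FreeGroup.prod_pow_mul_injective
    simpa [traceValue, checkValue, Function.comp_def, mul_assoc] using h₁
  have e₂ : l.map Prod.snd = zs := by
    apply FreeGroup.prod_pow_mul_injective
    simpa [traceValue, checkValue, Function.comp_def] using h₂
  exact isTrace_of_map_eq (e₂ ▸ e₁)

theorem computable_replicate {α : Type*} [Primcodable α] (x : α) :
    Computable fun m : ℕ => List.replicate (2 ^ m) x := by
  have hpow : Primrec fun m : ℕ => 2 ^ m := by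
    refine (Primrec.nat_rec' (f := id) (g := fun _ => 1) (h := fun _ p => p.2 * 2) .id (.const 1)
      (Primrec.nat_mul.comp (Primrec.snd.comp .snd) (.const 2)).to₂).of_eq fun m => ?_
    simp only [id]
    induction m with
    | zero => rfl
    | succ m ih => rw [pow_succ, ← ih]
  refine ((Primrec.list_map (Primrec.list_range.comp hpow)
    (g := fun _ _ => x) (.const x)).of_eq fun m => ?_).to_comp
  simp

theorem exists_isRegular_not_computablePred [Primcodable S] (hirr : ∀ a, ¬ I a a)
    (hsym : ∀ a b, I a b → I b a) {a b c d : S} (hab : I a b) (hbc : I b c) (hcd : I c d)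
    (hac : ¬ I a c) (hbd : ¬ I b d) (hnac : a ≠ c) (hnbd : b ≠ d) :
    ∃ L : Language (S ⊕ S), L.IsRegular ∧ ¬ ComputablePred fun w =>
      graphEval I (FreeMonoid.ofList w) ∈
        (fun v => graphEval I (FreeMonoid.ofList v)) '' (L : Set (List (S ⊕ S))) := by
  obtain ⟨R, hR, hundec⟩ := IsProgram.exists_not_computablePred
  obtain ⟨Q, hQ, hQR⟩ := hR.exists_isFactorProgram
  have hpos : ∀ s, IsRationalImage (graphEval I)
      {PresentedGroup.of (rels := GraphGroupRels I) s} := fun s => by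
    simpa [graphEval] using IsRationalImage.singleton (f := graphEval I) [Sum.inl s]
  have hneg : ∀ s, IsRationalImage (graphEval I)
      {(PresentedGroup.of (rels := GraphGroupRels I) s)⁻¹} := fun s => by
    simpa [graphEval] using IsRationalImage.singleton (f := graphEval I) [Sum.inr s]
  obtain ⟨X, hX, hXQ⟩ := hQ.exists_representsRel (GraphGroup.commute_of hbc) (hpos a) (hpos b)
    (hpos c) (hpos d)
  obtain ⟨Y, hY, hYmem⟩ := exists_isRationalImage_check (GraphGroup.commute_of hbc) (hneg a)
    (hneg b) (hneg c) (hneg d)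
  obtain ⟨L, hL, hLmem⟩ := ((hX.mul (hpos b).powers).mul (hpos d)).mul hY
  refine ⟨L, hL, fun hdec => hundec ?_⟩
  refine ComputablePred.computable_of_manyOneReducible ?_ hdec
  refine ⟨fun m => List.replicate (2 ^ m) (Sum.inl b), computable_replicate _, fun m => ?_⟩
  have heval : graphEval I (FreeMonoid.ofList (List.replicate (2 ^ m) (Sum.inl b))) =
      PresentedGroup.of b ^ registerCode (single 0 m) := by
    rw [graphEval_ofList, registerCode_single, Nat.nth_prime_zero_eq_two]
    simp [letterValue]
  beta_reduce
  rw [heval, ← hLmem]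
  have hstep : (∃ s', R (single 0 m) s') ↔ ∃ y, Q (registerCode (single 0 m)) y := by
    simp only [hQR]
    exact ⟨fun ⟨s', h⟩ => ⟨_, s', rfl, h⟩, fun ⟨_, s', _, h⟩ => ⟨s', h⟩⟩
  rw [hstep]
  generalize registerCode (single 0 m) = x
  constructor
  · rintro ⟨y, hy⟩
    obtain ⟨l, hl, hlt⟩ := hXQ.2 x y hy
    refine ⟨_, ⟨_, ⟨_, hl, _, ⟨y, rfl⟩, rfl⟩, _, rfl, rfl⟩, _,
      (hYmem _).2 ⟨l.map Prod.snd, rfl⟩, ?_⟩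
    have := hlt.traceValue_mul (GraphGroup.commute_of hab) (GraphGroup.commute_of hcd)
    simp only [this, mul_assoc, mul_inv_cancel, mul_one]
  · rintro ⟨_, ⟨_, ⟨g, hg, _, ⟨y, rfl⟩, rfl⟩, _, rfl, rfl⟩, k, hk, h⟩
    obtain ⟨zs, rfl⟩ := (hYmem _).1 hk
    obtain ⟨l, rfl, hl⟩ := hXQ.1 g hg
    exact ⟨y, hl x y (isTrace_of_traceValue_mul_eq hirr hsym hab hbc hcd hac hbd hnac hnbd
      (mul_inv_eq_iff_eq_mul.1 h))⟩

end Undecidability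

/-- The rational subset membership problem for a graph group is decidable if and only
if the independence alphabet is a transitive forest. -/
theorem rationalSubsetMembership_computable_iff_transitiveForest
    {S : Type} [Fintype S] [DecidableEq S] (I : S → S → Prop)
    (hirr : ∀ a : S, ¬ I a a) (hsym : ∀ a b : S, I a b → I b a) :
    (∀ L : Language (S ⊕ S), L.IsRegular →
      ComputablePred (fun w : List (S ⊕ S) =>
        graphEval I (FreeMonoid.ofList w) ∈
          (fun v : List (S ⊕ S) => graphEval I (FreeMonoid.ofList v)) '' L))
    ↔ IsTransitiveForest I := by
  constructor
  · intro hdec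
    by_contra h
    obtain ⟨a, b, c, d, hab, hbc, hcd, hac, hbd, hnac, hnbd⟩ :=
      exists_path_of_not_isTransitiveForest hirr hsym h
    obtain ⟨L, hL, hundec⟩ :=
      exists_isRegular_not_computablePred hirr hsym hab hbc hcd hac hbd hnac hnbd
    exact hundec (hdec L hL)
  · exact fun h L hL => h.computablePred_mem hirr hsym hL
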